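/- For all integers i ≥ 2 and n ≥ i, setting α_i = ∏_{j=1}^{i} (1 − 1/p_j^2), one has ∏_{k=1}^{n} (1 + 1/p_k) ≤ α_i · (e^γ · log(log N_n) + 2.51/log(log N_n)). -/

import Mathlib

open Real Finset

/-- `Nk k` is the `k`-th primorial: the product of the first `k` primes
(`Nat.nth Nat.Prime i` is the `(i+1)`-st prime, so `Nat.nth Nat.Prime 0 = 2`). -/
noncomputable def Nk (k : ℕ) : ℕ := ∏ i ∈ Finset.range k, Nat.nth Nat.Prime i

/-- `M k = exp (e^(-γ) * N_k / φ(N_k)) - log N_k`. -/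
noncomputable def M (k : ℕ) : ℝ :=
  Real.exp (Real.exp (-Real.eulerMascheroniConstant) * (Nk k : ℝ) / (Nat.totient (Nk k) : ℝ))
    - Real.log (Nk k)




namespace PR
open Complex Filter Topology Metric

theorem factor_finset (f : ℂ → ℂ) (hf : Differentiable ℂ f)
    (hne : ∀ a, analyticOrderAt f a ≠ ⊤) (F : Finset ℂ) :
    ∃ g : ℂ → ℂ, Differentiable ℂ g ∧
      (∀ z, f z = (∏ a ∈ F, (z - a) ^ (analyticOrderNatAt f a)) * g z) ∧
      (∀ a ∈ F, g a ≠ 0) := by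
  classical
  induction F using Finset.induction_on with
  | empty => exact ⟨f, hf, by simp, by simp⟩
  | insert b F hb ih =>
    obtain ⟨g, hg, hfg, hg0⟩ := ih
    set P : ℂ → ℂ := fun z => ∏ a ∈ F, (z - a) ^ (analyticOrderNatAt f a) with hP
    have hPd : Differentiable ℂ P := by
      intro z
      apply DifferentiableAt.fun_finsetProd
      intro a _
      fun_prop
    have hPb : P b ≠ 0 := by
      rw [hP]
      refine Finset.prod_ne_zero_iff.2 fun a ha => pow_ne_zero _ (sub_ne_zero.2 ?_)
      rintro rfl; exact hb ha
    have hfe : f = P * g := by ext z; exact hfg z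
    have hord : analyticOrderAt g b = analyticOrderAt f b := by
      rw [hfe, analyticOrderAt_mul (hPd.analyticAt b) (hg.analyticAt b),
        (hPd.analyticAt b).analyticOrderAt_eq_zero.2 hPb, zero_add]
    set m := analyticOrderNatAt f b with hm
    have hgm : analyticOrderAt g b = m := by
      rw [hord, hm, Nat.cast_analyticOrderNatAt (hne b)]
    obtain ⟨h, hh, hhb, hhe⟩ := ((hg.analyticAt b).analyticOrderAt_eq_natCast).1 hgm
    refine ⟨fun z => if z = b then h b else g z / (z - b) ^ m, ?_, ?_, ?_⟩
    · intro z
      by_cases hz : z = b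
      · subst hz
        refine hh.differentiableAt.congr_of_eventuallyEq ?_
        filter_upwards [hhe] with w hw
        split_ifs with h1
        · rw [h1]
        · rw [hw, smul_eq_mul, mul_div_cancel_left₀]
          exact pow_ne_zero _ (sub_ne_zero.2 h1)
      · have : DifferentiableAt ℂ (fun z => g z / (z - b) ^ m) z := by
          refine (hg z).div (by fun_prop) (pow_ne_zero _ (sub_ne_zero.2 hz))
        refine this.congr_of_eventuallyEq ?_
        filter_upwards [isOpen_ne.mem_nhds hz] with w hw
        rw [if_neg hw]
    · intro z
      rw [Finset.prod_insert hb]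
      beta_reduce
      by_cases hz : z = b
      · subst hz
        have h1 := hhe.self_of_nhds
        rw [if_pos rfl, hfg z, h1, smul_eq_mul]
        ring
      · have := pow_ne_zero m (sub_ne_zero.2 hz)
        rw [if_neg hz, hfg z, ← hm]
        field_simp
    · intro a ha
      beta_reduce
      by_cases hab : a = b
      · rw [if_pos hab]; exact hhb
      · rw [if_neg hab]
        refine div_ne_zero (hg0 a ((Finset.mem_insert.1 ha).resolve_left hab)) (pow_ne_zero _ (sub_ne_zero.2 hab))

theorem logDeriv_deriv_bound (h : ℂ → ℂ) (hd : Differentiable ℂ h) (z0 : ℂ) (r B : ℝ) (hr : 0 < r)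
    (hB : 0 < B) (hne : ∀ z ∈ ball z0 r, h z ≠ 0)
    (hb : ∀ z ∈ ball z0 r, ‖h z‖ ≤ ‖h z0‖ * Real.exp B) (z : ℂ) (hz : ‖z - z0‖ ≤ r / 4) :
    ‖deriv (fun w => deriv h w / h w) z‖ ≤ 128 * B / r ^ 2 := by
  have hdd : Differentiable ℂ (deriv h) := fun w => (hd.analyticAt w).deriv.differentiableAt
  have hq : DifferentiableOn ℂ (fun w => deriv h w / h w) (ball z0 r) := fun w hw =>
    ((hdd w).div (hd w) (hne w hw)).differentiableWithinAt
  have hz0 : z0 ∈ ball z0 r := mem_ball_self hr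
  obtain ⟨G1, hG1⟩ := hq.isExactOn_ball
  set G : ℂ → ℂ := fun w => G1 w - G1 z0 with hG
  have hGd : ∀ w ∈ ball z0 r, HasDerivAt G (deriv h w / h w) w := fun w hw =>
    (hG1 w hw).sub_const _
  have hG0 : G z0 = 0 := by simp [hG]
  have hexp : ∀ w ∈ ball z0 r, h w * Complex.exp (-G w) = h z0 := by
    intro w hw
    have hconst : ∀ w ∈ ball z0 r, HasDerivAt (fun w => h w * Complex.exp (-G w)) 0 w := by
      intro w hw
      have h1 : HasDerivAt (fun w => h w * Complex.exp (-G w))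
          (deriv h w * Complex.exp (-G w) + h w * (Complex.exp (-G w) * -(deriv h w / h w))) w :=
        (hd w).hasDerivAt.mul ((hGd w hw).neg.cexp)
      have h2 : deriv h w * Complex.exp (-G w) + h w * (Complex.exp (-G w) * -(deriv h w / h w)) = 0 := by
        have := hne w hw
        field_simp
        ring
      rwa [h2] at h1
    have := (convex_ball z0 r).is_const_of_fderivWithin_eq_zero (𝕜 := ℂ)
      (f := fun w => h w * Complex.exp (-G w))
      (fun w hw => (hconst w hw).differentiableAt.differentiableWithinAt)
      (fun w hw => by
        rw [fderivWithin_of_isOpen isOpen_ball hw]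
        have := (hconst w hw).hasFDerivAt.fderiv
        rw [this]; ext; simp) hw hz0
    simpa [hG0] using this
  have hre : ∀ w ∈ ball z0 r, (G w).re ≤ B := by
    intro w hw
    have h1 := hexp w hw
    have h2 : ‖h w‖ = ‖h z0‖ * Real.exp (G w).re := by
      rw [← h1, norm_mul, Complex.norm_exp, mul_assoc, ← Real.exp_add]; simp
    have h3 := hb w hw
    rw [h2] at h3
    have h4 := le_of_mul_le_mul_left h3 (norm_pos_iff.2 (hne z0 hz0))
    exact Real.exp_le_exp.1 h4
  have hbd : ∀ w, ‖w - z0‖ ≤ 3 * r / 4 → ‖G w‖ ≤ 6 * B := by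
    intro w hw
    have hmem : ∀ v, v ∈ ball (0:ℂ) r → z0 + v ∈ ball z0 r := by
      intro v hv; simpa [mem_ball, dist_eq_norm] using hv
    have h1 := Complex.borelCaratheodory_zero (f := fun v => G (z0 + v)) (M := B) (R := r) (z := w - z0) hB
      (fun v hv => by
        have := (hGd _ (hmem v hv)).differentiableAt
        have h2 : DifferentiableAt ℂ (fun v => G (z0 + v)) v :=
          DifferentiableAt.fun_comp' v (g := G) (f := fun v => z0 + v) this (by fun_prop)
        exact h2.differentiableWithinAt)
      (fun v hv => hre _ (hmem v hv)) hr (by rw [mem_ball, dist_zero_right]; linarith) (by simp [hG0])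
    rw [add_sub_cancel] at h1
    refine h1.trans ?_
    rw [div_le_iff₀ (by linarith)]
    nlinarith [norm_nonneg (w - z0)]
  have hcl : ∀ w s, 0 < s → ‖w - z0‖ + s < r → closedBall w s ⊆ ball z0 r := by
    intro w s hs hws v hv
    rw [mem_closedBall, dist_eq_norm] at hv
    rw [mem_ball, dist_eq_norm]
    calc ‖v - z0‖ = ‖(v - w) + (w - z0)‖ := by ring_nf
      _ ≤ ‖v - w‖ + ‖w - z0‖ := norm_add_le _ _
      _ < r := by linarith
  have hsph : ∀ w v : ℂ, ∀ s t : ℝ, ‖w - z0‖ ≤ t → v ∈ sphere w s → ‖v - z0‖ ≤ s + t := by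
    intro w v s t h1 h2
    rw [mem_sphere, dist_eq_norm] at h2
    calc ‖v - z0‖ = ‖(v - w) + (w - z0)‖ := by ring_nf
      _ ≤ ‖v - w‖ + ‖w - z0‖ := norm_add_le _ _
      _ ≤ s + t := by linarith
  have h1 : ∀ w, ‖w - z0‖ ≤ r / 2 → ‖deriv h w / h w‖ ≤ 6 * B / (r / 4) := by
    intro w hw
    have hsub := hcl w (r/4) (by linarith) (by linarith)
    have hw' : w ∈ ball z0 r := hsub (mem_closedBall_self (by linarith))
    rw [← (hGd w hw').deriv]
    refine Complex.norm_deriv_le_of_forall_mem_sphere_norm_le (by linarith) ?_ ?_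
    · apply DifferentiableOn.diffContOnCl
      rw [closure_ball _ (by linarith)]
      exact fun v hv => (hGd v (hsub hv)).differentiableAt.differentiableWithinAt
    · intro v hv
      exact hbd v ((hsph w v _ _ hw hv).trans (by linarith))
  have h2 := Complex.norm_deriv_le_of_forall_mem_sphere_norm_le (f := fun w => deriv h w / h w) (c := z) (R := r/4)
    (C := 6 * B / (r / 4)) (by linarith) (by
      have hsub := hcl z (r/4) (by linarith) (by linarith)
      apply DifferentiableOn.diffContOnCl
      rw [closure_ball _ (by linarith)]
      exact hq.mono hsub)
    (fun v hv => h1 v ((hsph z v _ _ hz hv).trans (by linarith)))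
  refine h2.trans ?_
  rw [div_div, div_le_div_iff₀ (by positivity) (by positivity)]
  nlinarith [mul_pos hB (pow_pos hr 2)]

end PR



namespace PR
open Complex Filter Topology Metric

theorem order_neg (f : ℂ → ℂ) (heven : ∀ z, f (-z) = f z) (a : ℂ) :
    analyticOrderNatAt f (-a) = analyticOrderNatAt f a := by
  have h1 : analyticOrderAt (f ∘ Neg.neg) a = analyticOrderAt f (-a) := by
    refine analyticOrderAt_comp_of_deriv_ne_zero (g := Neg.neg) ?_ ?_
    · exact (differentiable_id.neg (𝕜 := ℂ)).analyticAt a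
    · have : deriv (Neg.neg : ℂ → ℂ) a = -1 := by
        simp
      rw [this]; simp
  have h2 : f ∘ Neg.neg = f := by ext z; simp [heven]
  rw [h2] at h1
  unfold analyticOrderNatAt
  rw [h1]

theorem deriv_zero_of_even (g P : ℂ → ℂ) (hg : Differentiable ℂ g)
    (hg0 : g 0 ≠ 0) (hP : ∀ᶠ z in 𝓝[≠] (0:ℂ), P z ≠ 0) (hPe : ∀ z, P (-z) ^ 2 = P z ^ 2)
    (he : ∀ z, P (-z) * g (-z) = P z * g z) : deriv g 0 = 0 := by
  have h1 : ∀ᶠ z in 𝓝[≠] (0:ℂ), g (-z) ^ 2 - g z ^ 2 = 0 := by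
    filter_upwards [hP] with z hz
    have := congrArg (· ^ 2) (he z)
    simp only [mul_pow, hPe] at this
    have h3 := mul_left_cancel₀ (pow_ne_zero 2 hz) this
    rw [h3, sub_self]
  have h2 : ∀ᶠ z in 𝓝 (0:ℂ), g (-z) ^ 2 - g z ^ 2 = 0 := by
    have := eventually_nhdsWithin_iff.1 h1
    filter_upwards [this] with z hz
    by_cases h0 : z = 0
    · simp [h0]
    · exact hz h0
  have hd : HasDerivAt (fun z => g (-z) ^ 2 - g z ^ 2) (-(4 * g 0 * deriv g 0)) 0 := by
    have ha := (hg 0).hasDerivAt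
    have hb : HasDerivAt (fun z => g (-z)) (-deriv g 0) 0 := by
      have : HasDerivAt g (deriv g 0) (-0) := by simpa using ha
      have := this.scomp (0:ℂ) (hasDerivAt_neg (0:ℂ))
      simpa [Function.comp_def] using this
    have := (hb.pow 2).sub (ha.pow 2)
    refine this.congr_deriv ?_
    simp; ring
  have hd0 : HasDerivAt (fun z => g (-z) ^ 2 - g z ^ 2) 0 0 :=
    (hasDerivAt_const (0:ℂ) (0:ℂ)).congr_of_eventuallyEq h2
  have := hd.unique hd0
  have h4 : 4 * g 0 * deriv g 0 = 0 := by linear_combination -this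
  simpa [hg0] using h4

theorem had_finite (f : ℂ → ℂ) (hf : Differentiable ℂ f) (heven : ∀ z, f (-z) = f z)
    (hne : ∀ a, analyticOrderAt f a ≠ ⊤) (F : Finset ℂ) (N : ℝ) (hN : 8 ≤ N)
    (hF : ∀ a, a ∈ F ↔ f a = 0 ∧ ‖a‖ ≤ N) (B : ℝ) (hB : 0 < B) (hf0 : f (3/2) ≠ 0)
    (hbd : ∀ z, ‖z‖ ≤ 4 * N + 2 → ‖f z‖ ≤ ‖f (3/2)‖ * Real.exp B) (z : ℂ) (hz : f z ≠ 0)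
    (hzN : ‖z - 3/2‖ ≤ (N - 2) / 4) :
    ‖logDeriv f z - ∑ a ∈ F, (analyticOrderNatAt f a : ℂ) / (z - a)‖ ≤ 128 * B / (N - 2) ^ 2 * ‖z‖ := by
  obtain ⟨g, hg, hfg, hgF⟩ := factor_finset f hf hne F
  set P : ℂ → ℂ := fun z => ∏ a ∈ F, (z - a) ^ (analyticOrderNatAt f a) with hP
  have h32 : ‖(3/2 : ℂ)‖ = 3/2 := by norm_num
  have hgne : ∀ w, ‖w‖ ≤ N → g w ≠ 0 := by
    intro w hw h0
    by_cases hwF : w ∈ F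
    · exact hgF w hwF h0
    · exact hwF ((hF w).2 ⟨by rw [hfg, h0, mul_zero], hw⟩)
  have hsym : ∀ a, a ∈ F ↔ -a ∈ F := by
    intro a; rw [hF, hF, heven, norm_neg]
  have hPe : ∀ z, P (-z) ^ 2 = P z ^ 2 := by
    intro z
    have h1 : P (-z) = ∏ a ∈ F, (-1 : ℂ) ^ (analyticOrderNatAt f a) * (z - a) ^ (analyticOrderNatAt f a) := by
      rw [hP]
      refine Finset.prod_bij (fun a _ => -a) (fun a ha => (hsym a).1 ha) (fun a _ b _ h => neg_injective h)
        (fun b hb => ⟨-b, (hsym b).1 hb, neg_neg b⟩) (fun a ha => ?_)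
      rw [order_neg f heven, ← mul_pow]
      congr 1; ring
    rw [h1, Finset.prod_mul_distrib, mul_pow, ← Finset.prod_pow]
    have : ∏ x ∈ F, ((-1 : ℂ) ^ (analyticOrderNatAt f x)) ^ 2 = 1 := by
      refine Finset.prod_eq_one fun a _ => ?_
      rw [← pow_mul, mul_comm, pow_mul]; simp
    rw [this, one_mul]
  have hPne : ∀ w, w ∉ F → P w ≠ 0 := by
    intro w hw
    refine Finset.prod_ne_zero_iff.2 fun a ha => pow_ne_zero _ (sub_ne_zero.2 ?_)
    rintro rfl; exact hw ha
  have hPev : ∀ᶠ z in 𝓝[≠] (0:ℂ), P z ≠ 0 := by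
    have h1 : ∀ᶠ z in 𝓝[≠] (0:ℂ), z ∉ (F.erase 0 : Finset ℂ) := by
      have : IsOpen ((F.erase 0 : Finset ℂ) : Set ℂ)ᶜ := (Finset.finite_toSet _).isClosed.isOpen_compl
      exact mem_nhdsWithin_of_mem_nhds (this.mem_nhds (by simp))
    filter_upwards [h1, self_mem_nhdsWithin] with w hw hw0
    exact hPne w fun hh => hw (Finset.mem_erase.2 ⟨hw0, hh⟩)
  have hg0 : deriv g 0 = 0 := deriv_zero_of_even g P hg (hgne 0 (by simp; linarith)) hPev hPe
    (fun z => by rw [← hfg, ← hfg, heven])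
  -- growth of g
  have hPlow : ∀ w ∈ sphere (3/2 : ℂ) (4 * N), ‖P (3/2)‖ ≤ ‖P w‖ := by
    intro w hw
    rw [hP]
    simp only [norm_prod, norm_pow]
    refine Finset.prod_le_prod (fun _ _ => by positivity) fun a ha => pow_le_pow_left₀ (norm_nonneg _) ?_ _
    have ha' := ((hF a).1 ha).2
    rw [mem_sphere, dist_eq_norm] at hw
    have h1 : ‖(3/2 : ℂ) - a‖ ≤ 3/2 + N := (norm_sub_le _ _).trans (by rw [h32]; linarith)
    have h2 : ‖w - 3/2‖ ≤ ‖w - a‖ + ‖(3/2:ℂ) - a‖ := by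
      calc ‖w - 3/2‖ = ‖(w - a) - (3/2 - a)‖ := by ring_nf
        _ ≤ _ := norm_sub_le _ _
    linarith
  have hP0 : P (3/2) ≠ 0 := fun h => hf0 ((hfg _).trans (by change P (3/2) * _ = 0; rw [h, zero_mul]))
  have hgs : ∀ w ∈ sphere (3/2 : ℂ) (4 * N), ‖g w‖ ≤ ‖g (3/2)‖ * Real.exp B := by
    intro w hw
    have h1 := hPlow w hw
    have hw2 : ‖w‖ ≤ 4 * N + 2 := by
      rw [mem_sphere, dist_eq_norm] at hw
      calc ‖w‖ = ‖(w - 3/2) + 3/2‖ := by ring_nf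
        _ ≤ ‖w - 3/2‖ + ‖(3/2:ℂ)‖ := norm_add_le _ _
        _ ≤ _ := by rw [hw, h32]; linarith
    have h2 := hbd w hw2
    rw [hfg w, hfg (3/2)] at h2
    change ‖P w * g w‖ ≤ ‖P (3/2) * g (3/2)‖ * _ at h2
    rw [norm_mul, norm_mul] at h2
    have h3 : ‖P (3/2)‖ * ‖g w‖ ≤ ‖P (3/2)‖ * (‖g (3/2)‖ * Real.exp B) := by
      calc _ ≤ ‖P w‖ * ‖g w‖ := by gcongr
        _ ≤ _ := h2
        _ = _ := by ring
    exact le_of_mul_le_mul_left h3 (norm_pos_iff.2 hP0)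
  have hgb : ∀ w ∈ ball (3/2 : ℂ) (N - 2), ‖g w‖ ≤ ‖g (3/2)‖ * Real.exp B := by
    intro w hw
    refine Complex.norm_le_of_forall_mem_frontier_norm_le (U := ball (3/2 : ℂ) (4 * N)) isBounded_ball
      hg.diffContOnCl ?_ ?_
    · rw [frontier_ball _ (by linarith)]; exact hgs
    · exact subset_closure (ball_subset_ball (by linarith) hw)
  have hgb0 : ∀ w ∈ ball (3/2 : ℂ) (N - 2), g w ≠ 0 := by
    intro w hw
    refine hgne w ?_
    rw [mem_ball, dist_eq_norm] at hw
    calc ‖w‖ = ‖(w - 3/2) + 3/2‖ := by ring_nf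
        _ ≤ ‖w - 3/2‖ + ‖(3/2:ℂ)‖ := norm_add_le _ _
        _ ≤ _ := by rw [h32]; linarith
  have hD := logDeriv_deriv_bound g hg (3/2) (N - 2) B (by linarith) hB hgb0 hgb
  have hgd : Differentiable ℂ (deriv g) := fun w => (hg.analyticAt w).deriv.differentiableAt
  have hsub : closedBall (3/2:ℂ) ((N-2)/4) ⊆ ball (3/2:ℂ) (N-2) := closedBall_subset_ball (by linarith)
  have hmv := Convex.norm_image_sub_le_of_norm_deriv_le (𝕜 := ℂ) (f := fun w => deriv g w / g w)
    (s := closedBall (3/2:ℂ) ((N-2)/4)) (C := 128 * B / (N - 2) ^ 2) (x := 0) (y := z)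
    (fun w hw => (hgd w).div (hg w) (hgb0 w (hsub hw)))
    (fun w hw => hD w (by rwa [mem_closedBall, dist_eq_norm] at hw))
    (convex_closedBall _ _) (by rw [mem_closedBall, dist_eq_norm, zero_sub, norm_neg, h32]; linarith)
    (by rwa [mem_closedBall, dist_eq_norm])
  simp only [hg0, zero_div, sub_zero] at hmv
  have hzF : z ∉ F := fun h => hz ((hF z).1 h).1
  have hgz : g z ≠ 0 := fun h => hz (by rw [hfg, h, mul_zero])
  have hPd : DifferentiableAt ℂ P z := by
    apply DifferentiableAt.fun_finsetProd
    intro a _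
    fun_prop
  have hlog : logDeriv f z = ∑ a ∈ F, (analyticOrderNatAt f a : ℂ) / (z - a) + deriv g z / g z := by
    have h1 : f = fun z => P z * g z := funext hfg
    rw [h1, logDeriv_mul z (hPne z hzF) hgz hPd (hg z), ← h1]
    congr 1
    rw [hP, logDeriv_prod]
    · refine Finset.sum_congr rfl fun a ha => ?_
      rw [logDeriv_fun_pow (f := fun z => z - a) (by fun_prop), logDeriv_apply]
      simp [div_eq_mul_inv]
    · intro a ha
      refine pow_ne_zero _ (sub_ne_zero.2 ?_)
      rintro rfl; exact hzF ha
    · intro a ha; fun_prop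
  rw [hlog, add_sub_cancel_left]
  exact hmv

end PR



namespace PR
open Complex Filter Topology Metric

theorem sum_sym (F : Finset ℂ) (m : ℂ → ℕ) (hm : ∀ a, m (-a) = m a) (hF : ∀ a, a ∈ F ↔ -a ∈ F) (z : ℂ)
    (hz : z ∉ F) :
    ∑ a ∈ F, (m a : ℂ) / (z - a) = ∑ a ∈ F, (m a : ℂ) * (z / (z ^ 2 - a ^ 2)) := by
  have h1 : ∑ a ∈ F, (m a : ℂ) / (z - a) = ∑ a ∈ F, (m a : ℂ) / (z + a) := by
    refine Finset.sum_bij (fun a _ => -a) (fun a ha => (hF a).1 ha) (fun a _ b _ h => neg_injective h)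
        (fun b hb => ⟨-b, (hF b).1 hb, neg_neg b⟩) (fun a ha => ?_)
    rw [hm, sub_eq_add_neg]
  have h2 : ∑ a ∈ F, (m a : ℂ) / (z - a) =
      (∑ a ∈ F, (m a : ℂ) / (z - a) + ∑ a ∈ F, (m a : ℂ) / (z + a)) / 2 := by
    rw [← h1]; ring
  rw [h2, ← Finset.sum_add_distrib, Finset.sum_div]
  refine Finset.sum_congr rfl fun a ha => ?_
  have ha1 : z - a ≠ 0 := by intro h; rw [sub_eq_zero] at h; subst h; exact hz ha
  have ha2 : z + a ≠ 0 := by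
    intro h; rw [add_eq_zero_iff_eq_neg] at h; subst h; exact hz ((hF a).1 ha)
  have ha3 : z ^ 2 - a ^ 2 ≠ 0 := by
    rw [sq_sub_sq]; exact mul_ne_zero ha2 ha1
  rw [div_add_div _ _ ha1 ha2, div_div, mul_div_assoc', div_eq_div_iff (by simp [ha1, ha2]) ha3]
  ring

theorem tendsto_sum_of_cover (t : ℂ → ℂ) (ht : Summable t) (F : ℕ → Finset ℂ)
    (hF : ∀ a, t a ≠ 0 → ∀ᶠ N in atTop, a ∈ F N) :
    Tendsto (fun N => ∑ a ∈ F N, t a) atTop (𝓝 (∑' a, t a)) := by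
  classical
  have h := ht.hasSum
  rw [HasSum, SummationFilter.unconditional_filter] at h
  intro U hU
  have h1 := h hU
  rw [Filter.mem_map, mem_atTop_sets] at h1
  obtain ⟨S, hS⟩ := h1
  have h2 : ∀ᶠ N in atTop, ∀ a ∈ S, t a ≠ 0 → a ∈ F N := by
    rw [Filter.eventually_all_finset]
    intro a ha
    by_cases h0 : t a = 0
    · exact Eventually.of_forall fun N h => (h h0).elim
    · filter_upwards [hF a h0] with N hN _ using hN
  rw [Filter.mem_map]
  filter_upwards [h2] with N hN
  have h3 : ∑ a ∈ F N, t a = ∑ a ∈ F N ∪ S, t a := by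
    refine Finset.sum_subset Finset.subset_union_left fun a ha hna => ?_
    by_contra h0
    rcases Finset.mem_union.1 ha with h | h
    · exact hna h
    · exact hna (hN a h h0)
  have := hS (F N ∪ S) Finset.subset_union_right
  simpa [h3] using this

/-- Data of an even entire function of slow growth with zeros in the strip. -/
structure EvenEntire (f : ℂ → ℂ) (B : ℕ → ℝ) : Prop where
  diff : Differentiable ℂ f
  even : ∀ z, f (-z) = f z
  ne : f (3/2) ≠ 0
  strip : ∀ a, f a = 0 → |a.re| < 1/2
  bd : ∀ N : ℕ, ∀ z, ‖z‖ ≤ 4 * N + 2 → ‖f z‖ ≤ Real.exp (B N)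
  lim : Tendsto (fun N : ℕ => B N / (N:ℝ) ^ 2) atTop (𝓝 0)

variable {f : ℂ → ℂ} {B : ℕ → ℝ}

theorem EvenEntire.order_ne_top (h : EvenEntire f B) (a : ℂ) : analyticOrderAt f a ≠ ⊤ := by
  intro ht
  have := (AnalyticOnNhd.analyticOrderAt_eq_top_iff_eq_zero a fun z => h.diff.analyticAt z).1 ht
  exact h.ne (by rw [this]; rfl)

theorem EvenEntire.finite (h : EvenEntire f B) (R : ℝ) : {a | f a = 0 ∧ ‖a‖ ≤ R}.Finite := by
  have h1 : f ⁻¹' {0}ᶜ ∈ codiscrete ℂ :=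
    AnalyticOnNhd.preimage_zero_mem_codiscrete (fun z _ => h.diff.analyticAt z) h.ne
  rw [mem_codiscrete'] at h1
  have hc : IsClosed (f ⁻¹' {0}) := by simpa using h1.1
  have hd : IsDiscrete (f ⁻¹' {0}) := by simpa [← Set.preimage_compl] using h1.2
  have := ((isCompact_closedBall (0:ℂ) R).inter_right hc).finite (hd.mono Set.inter_subset_right)
  refine this.subset ?_
  rintro a ⟨ha, hb⟩
  exact ⟨by simpa using hb, ha⟩

theorem EvenEntire.eq_zero (_h : EvenEntire f B) {a : ℂ} (ha : analyticOrderNatAt f a ≠ 0) : f a = 0 :=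
  apply_eq_zero_of_analyticOrderNatAt_ne_zero ha

theorem EvenEntire.tendsto (h : EvenEntire f B) (F : ℕ → Finset ℂ)
    (hF : ∀ N : ℕ, ∀ a, a ∈ F N ↔ f a = 0 ∧ ‖a‖ ≤ N) (z : ℂ) (hz : f z ≠ 0) :
    Tendsto (fun N : ℕ => ∑ a ∈ F N, (analyticOrderNatAt f a : ℂ) * (z / (z ^ 2 - a ^ 2))) atTop
      (𝓝 (logDeriv f z)) := by
  have h0 : 0 < ‖f (3/2)‖ := norm_pos_iff.2 h.ne
  set b : ℕ → ℝ := fun N => |B N| + |Real.log ‖f (3/2)‖| + 1 with hb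
  have hbpos : ∀ N, 0 < b N := fun N => by positivity
  have hbb : ∀ N : ℕ, ∀ z, ‖z‖ ≤ 4 * (N:ℝ) + 2 → ‖f z‖ ≤ ‖f (3/2)‖ * Real.exp (b N) := by
    intro N z hz
    refine (h.bd N z hz).trans ?_
    have h5 : ‖f (3/2)‖ * Real.exp (b N) = Real.exp (Real.log ‖f (3/2)‖ + b N) := by
      rw [Real.exp_add (Real.log _), Real.exp_log h0]
    rw [h5]
    apply Real.exp_le_exp.2
    have h1 := le_abs_self (B N)
    have h2 := neg_abs_le (Real.log ‖f (3/2)‖)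
    simp only [hb]; linarith
  have hlim : Tendsto (fun N : ℕ => b N / (N:ℝ)^2) atTop (𝓝 0) := by
    have h1 : Tendsto (fun N : ℕ => |B N / (N:ℝ)^2|) atTop (𝓝 0) := by
      simpa using h.lim.abs
    have h2 : Tendsto (fun N : ℕ => (|Real.log ‖f (3/2)‖| + 1) / (N:ℝ)^2) atTop (𝓝 0) := by
      apply Tendsto.div_atTop tendsto_const_nhds
      exact (tendsto_pow_atTop (by norm_num)).comp tendsto_natCast_atTop_atTop
    have := h1.add h2
    rw [add_zero] at this
    refine this.congr fun N => ?_
    rw [abs_div, abs_of_nonneg (by positivity : (0:ℝ) ≤ (N:ℝ)^2), ← add_div, ← add_assoc]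
  have hlim2 : Tendsto (fun N : ℕ => 512 * (b N / (N:ℝ)^2) * ‖z‖) atTop (𝓝 0) := by
    have := (hlim.const_mul 512).mul_const ‖z‖
    simpa using this
  rw [tendsto_iff_norm_sub_tendsto_zero]
  refine squeeze_zero' (Eventually.of_forall fun _ => norm_nonneg _) ?_ hlim2
  filter_upwards [eventually_ge_atTop (max 8 ⌈4 * ‖z - 3/2‖ + 2⌉₊)] with N hN
  have hN8 : (8:ℝ) ≤ N := by exact_mod_cast (le_max_left _ _).trans hN
  have hNz : 4 * ‖z - 3/2‖ + 2 ≤ N := (Nat.le_ceil _).trans (by exact_mod_cast (le_max_right _ _).trans hN)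
  have h1 := had_finite f h.diff h.even h.order_ne_top (F N) N hN8 (hF N) (b N) (hbpos N) h.ne (hbb N) z hz
    (by linarith)
  have hzF : z ∉ F N := fun hh => hz ((hF N z).1 hh).1
  rw [sum_sym (F N) _ (order_neg f h.even) (fun a => by rw [hF, hF, h.even, norm_neg]) z hzF, norm_sub_rev] at h1
  refine h1.trans ?_
  gcongr
  rw [mul_div_assoc', div_le_div_iff₀ (by nlinarith) (by positivity)]
  nlinarith [hbpos N, mul_nonneg (hbpos N).le (show 0 ≤ 4 * ((N:ℝ) - 2)^2 - (N:ℝ)^2 by nlinarith)]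

theorem re_term_lower (a : ℂ) (ha : |a.re| < 1/2) :
    (1/3) * (1 / (1 + ‖a‖ ^ 2)) ≤ ((3/2 : ℂ) / ((3/2 : ℂ) ^ 2 - a ^ 2)).re := by
  obtain ⟨b, c⟩ := a
  simp only at ha
  have hb2 : b ^ 2 < 1 / 4 := by
    have := sq_lt_sq' (abs_lt.1 ha).1 (abs_lt.1 ha).2; norm_num at this ⊢; linarith
  have hn : ‖(⟨b, c⟩ : ℂ)‖ ^ 2 = b ^ 2 + c ^ 2 := by
    rw [← Complex.normSq_eq_norm_sq, Complex.normSq_mk]; ring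
  have h1 : (3/2 : ℂ) ^ 2 - (⟨b, c⟩ : ℂ) ^ 2 = ⟨9/4 - b^2 + c^2, -2 * b * c⟩ := by
    apply Complex.ext <;> simp [pow_two] <;> ring
  have h2 : (3/2 : ℂ) = ((3/2 : ℝ) : ℂ) := by push_cast; rfl
  rw [h1, hn, h2, Complex.div_re, Complex.ofReal_re, Complex.ofReal_im, Complex.normSq_mk]
  simp only [zero_mul, zero_div, add_zero]
  set X := 9/4 - b^2 + c^2 with hX
  have hX2 : 2 + c ^ 2 ≤ X := by rw [hX]; linarith
  have hd : 0 < X * X + -2 * b * c * (-2 * b * c) := by nlinarith [sq_nonneg (b*c), sq_nonneg c]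
  rw [mul_one_div, div_le_div_iff₀ (by positivity) hd]
  have e1 : 4 * (b * c) ^ 2 ≤ c ^ 2 := by nlinarith [sq_nonneg c]
  have e2 : c ^ 2 ≤ X * X := by nlinarith [sq_nonneg c]
  have e3 : X ≤ 9 / 4 * (1 + (b^2 + c^2)) := by rw [hX]; nlinarith [sq_nonneg c, sq_nonneg b]
  nlinarith [mul_le_mul_of_nonneg_left e3 (show 0 ≤ X by nlinarith [sq_nonneg c])]

theorem EvenEntire.exists_F (h : EvenEntire f B) : ∃ F : ℕ → Finset ℂ,
    ∀ N : ℕ, ∀ a, a ∈ F N ↔ f a = 0 ∧ ‖a‖ ≤ N :=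
  ⟨fun N => (h.finite N).toFinset, fun N a => by simp⟩

theorem EvenEntire.summable (h : EvenEntire f B) :
    Summable (fun a : ℂ => (analyticOrderNatAt f a : ℝ) * (1 / (1 + ‖a‖ ^ 2))) := by
  classical
  obtain ⟨F, hF⟩ := h.exists_F
  have ht := (Complex.continuous_re.tendsto _).comp (h.tendsto F hF (3/2) h.ne)
  refine summable_of_sum_le (c := 3 * (logDeriv f (3/2)).re) (fun a => by positivity) fun S => ?_
  have key : ∀ᶠ N in atTop, (1/3) * ∑ a ∈ S, (analyticOrderNatAt f a : ℝ) * (1 / (1 + ‖a‖ ^ 2)) ≤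
      (Complex.re ∘ fun N : ℕ => ∑ a ∈ F N, (analyticOrderNatAt f a : ℂ) * ((3/2) / ((3/2) ^ 2 - a ^ 2))) N := by
    have h2 : ∀ᶠ N in atTop, ∀ a ∈ S, f a = 0 → a ∈ F N := by
      rw [Filter.eventually_all_finset]
      intro a ha
      filter_upwards [eventually_ge_atTop ⌈‖a‖⌉₊] with N hN h0
      exact (hF N a).2 ⟨h0, (Nat.le_ceil _).trans (by exact_mod_cast hN)⟩
    filter_upwards [h2] with N hN
    simp only [Function.comp_apply, Complex.re_sum]
    rw [Finset.mul_sum]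
    calc ∑ a ∈ S, (1/3) * ((analyticOrderNatAt f a : ℝ) * (1 / (1 + ‖a‖ ^ 2)))
        ≤ ∑ a ∈ S ∩ F N, (1/3) * ((analyticOrderNatAt f a : ℝ) * (1 / (1 + ‖a‖ ^ 2))) := by
          apply le_of_eq; symm
          refine Finset.sum_subset Finset.inter_subset_left fun a ha hna => ?_
          have : analyticOrderNatAt f a = 0 := by
            by_contra h0
            exact hna (Finset.mem_inter.2 ⟨ha, hN a ha (h.eq_zero h0)⟩)
          simp [this]
      _ ≤ ∑ a ∈ F N, (1/3) * ((analyticOrderNatAt f a : ℝ) * (1 / (1 + ‖a‖ ^ 2))) :=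
          Finset.sum_le_sum_of_subset_of_nonneg Finset.inter_subset_right fun a _ _ => by positivity
      _ ≤ _ := by
          refine Finset.sum_le_sum fun a ha => ?_
          have := re_term_lower a (h.strip a ((hF N a).1 ha).1)
          calc _ = (analyticOrderNatAt f a : ℝ) * ((1/3) * (1 / (1 + ‖a‖ ^ 2))) := by ring
            _ ≤ _ := mul_le_mul_of_nonneg_left this (by positivity)
            _ = _ := by simp [Complex.mul_re]
  have := ge_of_tendsto ht key
  linarith

theorem EvenEntire.hasSum (h : EvenEntire f B) (z : ℂ) (hz : f z ≠ 0) :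
    HasSum (fun a : ℂ => (analyticOrderNatAt f a : ℂ) * (z / (z ^ 2 - a ^ 2))) (logDeriv f z) := by
  obtain ⟨F, hF⟩ := h.exists_F
  have hs : Summable (fun a : ℂ => (analyticOrderNatAt f a : ℂ) * (z / (z ^ 2 - a ^ 2))) := by
    refine Summable.of_norm_bounded_eventually
      (g := fun a => (2 * ‖z‖) * ((analyticOrderNatAt f a : ℝ) * (1 / (1 + ‖a‖ ^ 2)))) (h.summable.mul_left _) ?_
    rw [Filter.eventually_cofinite]
    refine (h.finite (2 * ‖z‖ + 1)).subset fun a ha => ?_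
    simp only [Set.mem_ofPred_eq] at ha ⊢
    have hm : analyticOrderNatAt f a ≠ 0 := by
      intro h0; apply ha; simp [h0]
    refine ⟨h.eq_zero hm, ?_⟩
    by_contra hlt
    push Not at hlt
    apply ha
    have h1 : ‖a‖ ^ 2 - ‖z‖ ^ 2 ≤ ‖z ^ 2 - a ^ 2‖ := by
      rw [← norm_pow, ← norm_pow, norm_sub_rev]; exact norm_sub_norm_le _ _
    have h2 : (1 + ‖a‖ ^ 2) / 2 ≤ ‖z ^ 2 - a ^ 2‖ := by nlinarith [norm_nonneg z, norm_nonneg a]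
    rw [norm_mul, norm_div, Complex.norm_natCast]
    calc (analyticOrderNatAt f a : ℝ) * (‖z‖ / ‖z ^ 2 - a ^ 2‖)
        ≤ (analyticOrderNatAt f a : ℝ) * (‖z‖ / ((1 + ‖a‖ ^ 2) / 2)) := by gcongr
      _ = _ := by field_simp
  have h1 := tendsto_sum_of_cover _ hs F (fun a ha => by
    have hm : analyticOrderNatAt f a ≠ 0 := by
      intro h0; apply ha; simp [h0]
    filter_upwards [eventually_ge_atTop ⌈‖a‖⌉₊] with N hN
    exact (hF N a).2 ⟨h.eq_zero hm, (Nat.le_ceil _).trans (by exact_mod_cast hN)⟩)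
  have h2 := tendsto_nhds_unique h1 (h.tendsto F hF z hz)
  rw [← h2]
  exact hs.hasSum

end PR



namespace PR
open Complex Filter Topology Metric MeasureTheory HurwitzZeta

theorem kernel_bound : ∃ p C : ℝ, 0 < p ∧ 0 < C ∧ ∀ t : ℝ, 1 < t →
    ‖(hurwitzEvenFEPair 0).f_modif t‖ ≤ C * Real.exp (-p * t) := by
  obtain ⟨p, hp, hO⟩ := isBigO_atTop_evenKernel_sub 0
  rw [if_pos rfl] at hO
  obtain ⟨c, hc⟩ := hO.bound
  obtain ⟨T, hT⟩ := eventually_atTop.1 hc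
  have hcont : ContinuousOn (fun x => evenKernel 0 x - 1) (Set.Icc 1 (max T 1)) :=
    ((continuousOn_evenKernel 0).mono (fun x hx => lt_of_lt_of_le one_pos hx.1)).sub continuousOn_const
  obtain ⟨K, hK⟩ := isCompact_Icc.exists_bound_of_continuousOn hcont
  refine ⟨p, |c| + |K| * Real.exp (p * max T 1) + 1, hp, by positivity, fun t ht => ?_⟩
  have h1 : (hurwitzEvenFEPair 0).f_modif t = ((evenKernel 0 t - 1 : ℝ) : ℂ) := by
    have h2 : t ∉ Set.Ioo (0:ℝ) 1 := fun h => by linarith [h.2]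
    simp [WeakFEPair.f_modif, hurwitzEvenFEPair, ht, not_lt.2 ht.le]
  rw [h1, Complex.norm_real]
  have hnn : 0 < Real.exp (-p * t) := Real.exp_pos _
  rcases le_total t (max T 1) with h | h
  · have h3 := hK t ⟨ht.le, h⟩
    have h4 : 1 ≤ Real.exp (p * max T 1) * Real.exp (-p * t) := by
      rw [← Real.exp_add]; apply Real.one_le_exp; nlinarith
    have : |K| ≤ |K| * (Real.exp (p * max T 1) * Real.exp (-p * t)) := le_mul_of_one_le_right (abs_nonneg _) h4
    nlinarith [le_abs_self K, mul_nonneg (abs_nonneg c) hnn.le]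
  · have h3 := hT t ((le_max_left _ _).trans h)
    rw [Real.norm_eq_abs (Real.exp _), abs_of_pos hnn] at h3
    have : c * Real.exp (-p * t) ≤ |c| * Real.exp (-p * t) := by gcongr; exact le_abs_self c
    nlinarith [mul_nonneg (mul_nonneg (abs_nonneg K) (Real.exp_pos (p * max T 1)).le) hnn.le]

theorem Lambda0_bound : ∃ K C q : ℝ, 0 < K ∧ 0 < C ∧ 1 ≤ q ∧ ∀ n : ℕ, ∀ s : ℂ, 1/2 ≤ s.re →
    s.re ≤ 2 * (n + 1) → ‖completedRiemannZeta₀ s‖ ≤ K + C * (n.factorial : ℝ) * q ^ (n + 1) := by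
  obtain ⟨p, C, hp, hC, hb⟩ := kernel_bound
  set h := (hurwitzEvenFEPair 0).f_modif with hh
  have hconv : ∀ w : ℂ, MellinConvergent h w := fun w =>
    ((hurwitzEvenFEPair 0).isStrongFEPair_toStrongFEPair.hasMellin w).1
  have hnorm : ∀ w : ℂ, ∀ t ∈ Set.Ioi (0:ℝ), ‖(t:ℂ) ^ (w - 1) • h t‖ = t ^ (w.re - 1) * ‖h t‖ := by
    intro w t ht
    rw [norm_smul, Complex.norm_cpow_eq_rpow_re_of_pos ht]; simp
  have hintg : ∀ w : ℂ, IntegrableOn (fun t => t ^ (w.re - 1) * ‖h t‖) (Set.Ioi 0) := by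
    intro w
    have := (hconv w).norm
    refine (integrableOn_congr_fun (fun t ht => ?_) measurableSet_Ioi).1 this
    exact hnorm w t ht
  refine ⟨|∫ t in Set.Ioi (0:ℝ), t ^ ((1/4:ℝ) - 1) * ‖h t‖| + 1, C, max 1 (1/p), by positivity, hC, le_max_left _ _, ?_⟩
  intro n s hs1 hs2
  have e1 : completedRiemannZeta₀ s = (mellin h (s/2)) / 2 := rfl
  have hre : (s/2).re = s.re / 2 := by simp
  have hg : IntegrableOn (fun t : ℝ => t ^ (((n:ℝ) + 1) - 1) * Real.exp (-(p * t))) (Set.Ioi 0) := by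
    have := integrableOn_rpow_mul_exp_neg_mul_rpow (p := 1) (s := ((n:ℝ)+1) - 1) (b := p)
      (by simp; linarith [(Nat.cast_nonneg n : (0:ℝ) ≤ n)]) (by norm_num) hp
    simpa using this
  have hGam := Real.integral_rpow_mul_exp_neg_mul_Ioi (a := (n:ℝ) + 1) (r := p) (by positivity) hp
  have h4 := hintg ((1/4 : ℝ) : ℂ)
  rw [Complex.ofReal_re] at h4
  have h5 : ‖mellin h (s/2)‖ ≤ (∫ t in Set.Ioi (0:ℝ), t ^ ((1/4:ℝ) - 1) * ‖h t‖) + C * ((1/p) ^ ((n:ℝ)+1) * Real.Gamma ((n:ℝ)+1)) := by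
    rw [← hGam, ← integral_const_mul, ← integral_add h4 (hg.const_mul C)]
    refine (norm_integral_le_integral_norm _).trans ?_
    refine setIntegral_mono_on (hconv _).norm (h4.add (hg.const_mul C)) measurableSet_Ioi fun t ht => ?_
    rw [hnorm _ t ht, hre]
    have ht0 : (0:ℝ) < t := ht
    rcases le_or_gt t 1 with h1 | h1
    · have : t ^ (s.re / 2 - 1) ≤ t ^ ((1/4:ℝ) - 1) :=
        Real.rpow_le_rpow_of_exponent_ge ht0 h1 (by linarith)
      have h7 : 0 ≤ C * (t ^ (((n:ℝ) + 1) - 1) * Real.exp (-(p * t))) := by positivity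
      nlinarith [mul_le_mul_of_nonneg_right this (norm_nonneg (h t))]
    · have : t ^ (s.re / 2 - 1) ≤ t ^ (((n:ℝ) + 1) - 1) :=
        Real.rpow_le_rpow_of_exponent_le h1.le (by linarith)
      have h7 := hb t h1
      have h8 : 0 ≤ t ^ ((1/4:ℝ) - 1) * ‖h t‖ := by positivity
      have h9 : t ^ (s.re / 2 - 1) * ‖h t‖ ≤ t ^ (((n:ℝ) + 1) - 1) * (C * Real.exp (-p * t)) := by gcongr
      have : -(p * t) = -p * t := by ring
      rw [this]
      linarith
  rw [e1, norm_div]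
  rw [Real.Gamma_nat_eq_factorial] at h5
  have h6 : (1/p) ^ ((n:ℝ)+1) ≤ (max 1 (1/p)) ^ (n+1) := by
    rw [← Nat.cast_succ, Real.rpow_natCast]
    gcongr
    exact le_max_right _ _
  have h7 : C * ((1/p) ^ ((n:ℝ)+1) * (n.factorial:ℝ)) ≤ C * (n.factorial : ℝ) * (max 1 (1/p)) ^ (n+1) := by
    calc _ ≤ C * ((max 1 (1/p)) ^ (n+1) * (n.factorial:ℝ)) := by gcongr
      _ = _ := by ring
  have h8 := le_abs_self (∫ t in Set.Ioi (0:ℝ), t ^ ((1/4:ℝ) - 1) * ‖h t‖)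
  have : ‖(2:ℂ)‖ = 2 := by simp
  rw [this]
  have := norm_nonneg (mellin h (s/2))
  linarith

end PR



namespace PR
open Complex Filter Topology Metric MeasureTheory HurwitzZeta

/-- The Riemann xi function (twice the usual normalization). -/
noncomputable def xi (s : ℂ) : ℂ := s * (s - 1) * completedRiemannZeta₀ s + 1

/-- xi centred at one half. -/
noncomputable def fx (z : ℂ) : ℂ := xi (1/2 + z)

theorem xi_diff : Differentiable ℂ xi := by
  unfold xi
  have := differentiable_completedZeta₀
  fun_prop

theorem xi_one_sub (s : ℂ) : xi (1 - s) = xi s := by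
  unfold xi; rw [completedRiemannZeta₀_one_sub]; ring

theorem xi_eq (s : ℂ) (h0 : 0 < s.re) (h1 : s ≠ 1) :
    xi s = s * (s - 1) * (Gammaℝ s * riemannZeta s) := by
  have h2 : 1 - s ≠ 0 := sub_ne_zero.2 (Ne.symm h1)
  have hs0 : s ≠ 0 := by rintro rfl; simp at h0
  have hG : Gammaℝ s ≠ 0 := Gammaℝ_ne_zero_of_re_pos h0
  rw [riemannZeta_def_of_ne_zero hs0, mul_div_cancel₀ _ hG, completedRiemannZeta_eq]
  unfold xi
  field_simp
  ring

theorem xi_one : xi 1 = 1 := by simp [xi]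

theorem xi_ne_zero (s : ℂ) (h : 1 ≤ s.re) : xi s ≠ 0 := by
  by_cases h1 : s = 1
  · rw [h1, xi_one]; simp
  · rw [xi_eq s (by linarith) h1]
    refine mul_ne_zero (mul_ne_zero ?_ (sub_ne_zero.2 h1)) (mul_ne_zero (Gammaℝ_ne_zero_of_re_pos (by linarith))
      (riemannZeta_ne_zero_of_one_le_re h))
    rintro rfl; simp at h; linarith

theorem fx_even (z : ℂ) : fx (-z) = fx z := by
  unfold fx; rw [← xi_one_sub]; congr 1; ring

theorem fx_diff : Differentiable ℂ fx := by
  unfold fx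
  exact xi_diff.comp (by fun_prop)

theorem fx_strip (a : ℂ) (h : fx a = 0) : |a.re| < 1/2 := by
  have key : ∀ a : ℂ, fx a = 0 → a.re < 1/2 := by
    intro a h
    by_contra hh
    push Not at hh
    refine xi_ne_zero (1/2 + a) ?_ h
    simp; norm_num; linarith
  rw [abs_lt]
  have h2 := key (-a) (by rw [fx_even]; exact h)
  simp only [Complex.neg_re] at h2
  exact ⟨by linarith, key a h⟩

theorem fx_growth : ∃ A : ℝ, 0 ≤ A ∧ ∀ N : ℕ, ∀ z : ℂ, ‖z‖ ≤ 4 * N + 2 →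
    ‖fx z‖ ≤ Real.exp (A * ((N + 1) * √((N:ℝ) + 1))) := by
  obtain ⟨K, C, q, hK, hC, hq, hb⟩ := Lambda0_bound
  have key : ∀ N : ℕ, ∀ z : ℂ, 0 ≤ z.re → ‖z‖ ≤ 4 * N + 2 →
    ‖fx z‖ ≤ Real.exp ((|Real.log (K + C + 1)| + 12 + 2 * Real.log q) * ((N + 1) * √((N:ℝ) + 1))) := by
    intro N z hz hzN
    set s : ℂ := 1/2 + z with hs
    have hre : s.re = 1/2 + z.re := by simp [hs]
    have hzre : z.re ≤ ‖z‖ := Complex.re_le_norm z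
    have h1 := hb (2 * N + 1) s (by rw [hre]; linarith) (by rw [hre]; push_cast; linarith)
    have hn1 : ‖s‖ ≤ 4 * N + 3 := by
      refine (norm_add_le _ _).trans ?_
      norm_num; linarith
    have hn2 : ‖s - 1‖ ≤ 4 * N + 3 := by
      have : s - 1 = z - 1/2 := by rw [hs]; ring
      rw [this]
      refine (norm_sub_le _ _).trans ?_
      norm_num; linarith
    set Q : ℝ := ((2 * N + 1).factorial : ℝ) * q ^ (2 * N + 1 + 1) with hQ
    have hfac1 : (1:ℝ) ≤ ((2 * N + 1).factorial : ℝ) := by exact_mod_cast Nat.factorial_pos _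
    have hQ1 : 1 ≤ Q := by
      have := one_le_pow₀ hq (n := 2 * N + 1 + 1)
      nlinarith
    have hX : (3:ℝ) ≤ 4 * N + 3 := by linarith [(Nat.cast_nonneg N : (0:ℝ) ≤ N)]
    have h2 : ‖fx z‖ ≤ (4 * N + 3) ^ 2 * ((K + C + 1) * Q) := by
      have h3 : ‖completedRiemannZeta₀ s‖ ≤ (K + C) * Q := by
        refine h1.trans ?_
        rw [mul_assoc, ← hQ]; nlinarith
      calc ‖fx z‖ ≤ ‖s‖ * ‖s - 1‖ * ‖completedRiemannZeta₀ s‖ + 1 := by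
            unfold fx xi
            refine (norm_add_le _ _).trans ?_
            rw [norm_mul, norm_mul, norm_one]
        _ ≤ (4 * N + 3) * (4 * N + 3) * ((K + C) * Q) + 1 := by gcongr
        _ ≤ _ := by nlinarith
    have hfac : ((2 * N + 1).factorial : ℝ) ≤ (4 * N + 3) ^ (2 * N + 1) := by
      have : ((2 * N + 1).factorial : ℝ) ≤ ((2 * N + 1 : ℕ) : ℝ) ^ (2 * N + 1) := by
        exact_mod_cast Nat.factorial_le_pow _
      refine this.trans ?_
      gcongr
      push_cast; linarith
    have h4 : ‖fx z‖ ≤ (K + C + 1) * ((4 * N + 3) ^ (2 * N + 3) * q ^ (2 * N + 2)) := by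
      refine h2.trans ?_
      calc ((4:ℝ) * N + 3) ^ 2 * ((K + C + 1) * Q) ≤ (4 * N + 3) ^ 2 * ((K + C + 1) * ((4 * N + 3) ^ (2 * N + 1) * q ^ (2 * N + 1 + 1))) := by
            gcongr
            rw [hQ]
            gcongr
        _ = _ := by ring
    refine h4.trans ?_
    have hq0 : 0 < q := by linarith
    have hpos : 0 < (K + C + 1) * (((4:ℝ) * N + 3) ^ (2 * N + 3) * q ^ (2 * N + 2)) := by positivity
    rw [← Real.exp_log hpos]
    apply Real.exp_le_exp.2
    rw [Real.log_mul (by positivity) (by positivity), Real.log_mul (by positivity) (by positivity), Real.log_pow, Real.log_pow]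
    set S := √((N:ℝ) + 1) with hS
    have hS1 : 1 ≤ S := by rw [hS]; exact Real.one_le_sqrt.2 (by linarith [(Nat.cast_nonneg N : (0:ℝ) ≤ N)])
    have hSS : S * S = N + 1 := Real.mul_self_sqrt (by positivity)
    have hl1 : Real.log (4 * N + 3) ≤ 4 * S := by
      have : Real.log (4 * N + 3) ≤ Real.log ((2 * S) ^ 2) := by
        apply Real.log_le_log (by linarith); nlinarith
      rw [Real.log_pow] at this
      have h5 := Real.log_le_sub_one_of_pos (show 0 < 2 * S by linarith)
      push_cast at this
      linarith
    have hl0 : 0 ≤ Real.log (4 * N + 3) := Real.log_nonneg (by linarith)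
    have hq1 : 0 ≤ Real.log q := Real.log_nonneg hq
    have hT : 1 ≤ ((N:ℝ) + 1) * S := by nlinarith
    push_cast
    have t1 : Real.log (K + C + 1) ≤ |Real.log (K + C + 1)| * (((N:ℝ) + 1) * S) :=
      (le_abs_self _).trans (le_mul_of_one_le_right (abs_nonneg _) hT)
    have t2 : (2 * (N:ℝ) + 3) * Real.log (4 * N + 3) ≤ 12 * (((N:ℝ) + 1) * S) := by
      nlinarith [(Nat.cast_nonneg N : (0:ℝ) ≤ N)]
    have t3 : (2 * (N:ℝ) + 2) * Real.log q ≤ 2 * Real.log q * (((N:ℝ) + 1) * S) := by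
      nlinarith [mul_nonneg hq1 (show (0:ℝ) ≤ N + 1 by positivity)]
    linarith
  refine ⟨|Real.log (K + C + 1)| + 12 + 2 * Real.log q, by have := Real.log_nonneg hq; positivity, fun N z hz => ?_⟩
  rcases le_total 0 z.re with h | h
  · exact key N z h hz
  · rw [← fx_even]
    exact key N (-z) (by simpa using h) (by simpa using hz)

theorem fx_evenEntire : ∃ B, EvenEntire fx B := by
  obtain ⟨A, hA, hb⟩ := fx_growth
  refine ⟨fun N => A * ((N + 1) * √((N:ℝ) + 1)), fx_diff, fx_even, ?_, fx_strip, hb, ?_⟩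
  · exact xi_ne_zero _ (by norm_num)
  · have h1 : Tendsto (fun N : ℕ => (4 * A) / √(N:ℝ)) atTop (𝓝 0) :=
      Tendsto.div_atTop tendsto_const_nhds (Real.tendsto_sqrt_atTop.comp tendsto_natCast_atTop_atTop)
    refine squeeze_zero' (Eventually.of_forall fun N => by positivity) ?_ h1
    filter_upwards [eventually_ge_atTop 1] with N hN
    have hN' : (1:ℝ) ≤ N := by exact_mod_cast hN
    have h2 : √((N:ℝ) + 1) ≤ 2 * √(N:ℝ) := by
      rw [Real.sqrt_le_left (by positivity), mul_pow, Real.sq_sqrt (by positivity)]; linarith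
    have h3 : 0 < √(N:ℝ) := Real.sqrt_pos.2 (by linarith)
    have h4 : √(N:ℝ) * √(N:ℝ) = N := Real.mul_self_sqrt (by positivity)
    rw [div_le_div_iff₀ (by positivity) h3]
    have : (N + 1) * √((N:ℝ) + 1) * √(N:ℝ) ≤ 4 * (N:ℝ)^2 := by
      calc (N + 1) * √((N:ℝ) + 1) * √(N:ℝ) ≤ (2 * N) * (2 * √(N:ℝ)) * √(N:ℝ) := by gcongr; linarith
        _ = 4 * N * (√(N:ℝ) * √(N:ℝ)) := by ring
        _ = _ := by rw [h4]; ring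
    nlinarith [mul_le_mul_of_nonneg_left this hA]

/-- multiplicity of the zero a of fx. -/
noncomputable def mm (a : ℂ) : ℕ := analyticOrderNatAt fx a

theorem mm_zero {a : ℂ} (h : mm a ≠ 0) : fx a = 0 := apply_eq_zero_of_analyticOrderNatAt_ne_zero h

theorem mm_strip {a : ℂ} (h : mm a ≠ 0) : |a.re| < 1/2 := fx_strip a (mm_zero h)

theorem mm_neg (a : ℂ) : mm (-a) = mm a := order_neg fx fx_even a

theorem mm_ne_zero_of_zero {a : ℂ} (h : fx a = 0) : mm a ≠ 0 := by
  obtain ⟨B, hB⟩ := fx_evenEntire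
  intro h0
  have h1 : analyticOrderAt fx a = 0 := by
    rw [← Nat.cast_analyticOrderNatAt (hB.order_ne_top a)]
    exact_mod_cast h0
  exact (fx_diff.analyticAt a).analyticOrderAt_eq_zero.1 h1 h

theorem mm_summable : Summable (fun a : ℂ => (mm a : ℝ) * (1 / (1 + ‖a‖ ^ 2))) := by
  obtain ⟨B, hB⟩ := fx_evenEntire
  exact hB.summable

theorem xi_hasSum (s : ℂ) (hs : xi s ≠ 0) :
    HasSum (fun a : ℂ => (mm a : ℂ) * ((s - 1/2) / ((s - 1/2) ^ 2 - a ^ 2))) (logDeriv xi s) := by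
  obtain ⟨B, hB⟩ := fx_evenEntire
  have h1 : fx (s - 1/2) = xi s := by unfold fx; congr 1; ring
  have h2 := hB.hasSum (s - 1/2) (by rw [h1]; exact hs)
  have h3 : logDeriv fx (s - 1/2) = logDeriv xi s := by
    have : deriv fx (s - 1/2) = deriv xi s := by
      unfold fx
      rw [deriv_comp_const_add]; congr 1; ring
    rw [logDeriv_apply, logDeriv_apply, h1, this]
  rw [h3] at h2
  exact h2

end PR



namespace PR
open Complex Filter Topology Metric MeasureTheory

theorem digamma_real {x : ℝ} (hx : 0 < x) :
    digamma (x:ℂ) = ((deriv (fun y => Real.log (Real.Gamma y)) x : ℝ) : ℂ) := by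
  have hd : DifferentiableAt ℂ Complex.Gamma (x:ℂ) := by
    apply Complex.differentiableAt_Gamma
    intro m h
    have := congrArg Complex.re h
    simp at this
    have : (0:ℝ) ≤ m := Nat.cast_nonneg m
    linarith
  have h1 := hd.hasDerivAt.comp_ofReal
  have hr : DifferentiableAt ℝ Real.Gamma x := by
    apply Real.differentiableAt_Gamma
    intro m h
    have : (0:ℝ) ≤ m := Nat.cast_nonneg m
    linarith
  have h2 := hr.hasDerivAt.ofReal_comp
  have h3 : (fun y : ℝ => Complex.Gamma (y:ℂ)) = fun y : ℝ => ((Real.Gamma y : ℝ) : ℂ) := by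
    ext y; rw [Complex.Gamma_ofReal]
  rw [h3] at h1
  have h4 := h1.unique h2
  have h5 := Real.Gamma_pos_of_pos hx
  rw [digamma_def, logDeriv_apply, h4, Complex.Gamma_ofReal,
    (hr.hasDerivAt.log h5.ne').deriv]
  push_cast; rfl

/-- real digamma -/
noncomputable def dg (x : ℝ) : ℝ := deriv (fun y => Real.log (Real.Gamma y)) x

theorem dg_slope {x : ℝ} (hx : 0 < x) : dg x ≤ Real.log x ∧ Real.log x ≤ dg (x + 1) := by
  have hdd : ∀ y : ℝ, 0 < y → HasDerivAt (Real.log ∘ Real.Gamma) (dg y) y := by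
    intro y hy
    have hr : DifferentiableAt ℝ Real.Gamma y := by
      apply Real.differentiableAt_Gamma
      intro m h
      have : (0:ℝ) ≤ m := Nat.cast_nonneg m
      linarith
    exact (hr.log (Real.Gamma_pos_of_pos hy).ne').hasDerivAt
  have hs : slope (Real.log ∘ Real.Gamma) x (x + 1) = Real.log x := by
    rw [slope_def_field]
    simp only [Function.comp]
    rw [Real.Gamma_add_one hx.ne', Real.log_mul hx.ne' (Real.Gamma_pos_of_pos hx).ne']
    ring
  constructor
  · rw [← hs]
    exact Real.convexOn_log_Gamma.le_slope_of_hasDerivAt (by simpa using hx) (by simp; linarith) (by linarith) (hdd x hx)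
  · rw [← hs]
    exact Real.convexOn_log_Gamma.slope_le_of_hasDerivAt (by simpa using hx) (by simp; linarith) (by linarith) (hdd _ (by linarith))

theorem dg_add_one {x : ℝ} (hx : 0 < x) : dg (x + 1) = dg x + 1 / x := by
  have h := digamma_apply_add_one (x:ℂ) (by
    intro m h
    have := congrArg Complex.re h
    simp at this
    have : (0:ℝ) ≤ m := Nat.cast_nonneg m
    linarith)
  have h1 := digamma_real hx
  have h2 := digamma_real (x := x + 1) (by linarith)
  rw [h1] at h
  push_cast at h2
  rw [h2] at h
  have h3 : ((dg (x+1) : ℝ) : ℂ) = ((dg x + 1 / x : ℝ) : ℂ) := by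
    push_cast; rw [one_div]; exact h
  exact_mod_cast h3

theorem dg_hasSum {x : ℝ} (hx : 0 < x) :
    HasSum (fun k : ℕ => 1 / ((k:ℝ) + 1) - 1 / (x + (k + 1))) (dg (x + 1) + eulerMascheroniConstant) := by
  rw [hasSum_iff_tendsto_nat_of_nonneg]
  · have hp : ∀ n : ℕ, ∑ k ∈ range n, (1 / ((k:ℝ) + 1) - 1 / (x + (k + 1))) =
        (harmonic n : ℝ) - (dg (x + 1 + n) - dg (x + 1)) := by
      intro n
      induction n with
      | zero => simp
      | succ n ih =>
        rw [sum_range_succ, ih, harmonic_succ]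
        have := dg_add_one (x := x + 1 + n) (by positivity)
        push_cast
        rw [← add_assoc (x + 1), this]
        have : x + 1 + (n:ℝ) = x + (n + 1) := by ring
        rw [this]
        ring
    simp_rw [hp]
    have h1 := Real.tendsto_harmonic_sub_log
    have h2 : Tendsto (fun n : ℕ => dg (x + 1 + n) - Real.log n) atTop (𝓝 0) := by
      have hl : Tendsto (fun n : ℕ => (x + 1) / (n:ℝ)) atTop (𝓝 0) :=
        tendsto_const_div_atTop_nhds_zero_nat _
      refine tendsto_of_tendsto_of_tendsto_of_le_of_le' tendsto_const_nhds hl ?_ ?_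
      · filter_upwards [eventually_gt_atTop 0] with n hn
        have hn' : (0:ℝ) < n := by exact_mod_cast hn
        have := (dg_slope (x := x + n) (by positivity)).2
        have h3 : Real.log n ≤ Real.log (x + n) := Real.log_le_log hn' (by linarith)
        rw [show x + 1 + (n:ℝ) = x + n + 1 by ring]
        linarith
      · filter_upwards [eventually_gt_atTop 0] with n hn
        have hn' : (0:ℝ) < n := by exact_mod_cast hn
        have := (dg_slope (x := x + 1 + n) (by positivity)).1
        have h3 : Real.log (x + 1 + n) - Real.log n ≤ (x + 1) / n := by
          rw [← Real.log_div (by positivity) hn'.ne']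
          have := Real.log_le_sub_one_of_pos (x := (x + 1 + n) / n) (by positivity)
          have h4 : (x + 1 + n) / n - 1 = (x + 1) / n := by field_simp; ring
          linarith
        linarith
    have h3 := (h1.sub h2).add_const (dg (x + 1))
    simp only [sub_zero] at h3
    rw [add_comm (dg (x + 1))]
    refine h3.congr (fun n => ?_)
    ring
  · intro k
    have : 1 / (x + ((k:ℝ) + 1)) ≤ 1 / ((k:ℝ) + 1) := by
      apply one_div_le_one_div_of_le <;> [positivity; linarith]
    linarith

theorem term_bound {z : ℂ} (hz : 0 ≤ z.re) (k : ℕ) :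
    ‖(1 / ((k:ℂ) + 1) - 1 / (z + (k + 1)))‖ ≤ ‖z‖ * (1 / ((k:ℝ) + 1) ^ 2) := by
  have h1 : (k:ℂ) + 1 ≠ 0 := Nat.cast_add_one_ne_zero k
  have hre : (k:ℝ) + 1 ≤ (z + (k + 1)).re := by simp; exact hz
  have h3 : (k:ℝ) + 1 ≤ ‖z + (k + 1)‖ := hre.trans (Complex.re_le_norm _)
  have hk : (0:ℝ) < (k:ℝ) + 1 := by positivity
  have h2 : z + (k + 1) ≠ 0 := by
    intro h; rw [h, norm_zero] at h3; linarith
  have h4 : (1 / ((k:ℂ) + 1) - 1 / (z + (k + 1))) = z / (((k:ℂ) + 1) * (z + (k + 1))) := by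
    field_simp; ring
  have h5 : ‖(k:ℂ) + 1‖ = k + 1 := by
    have : (k:ℂ) + 1 = ((k + 1 : ℕ) : ℂ) := by push_cast; rfl
    rw [this, Complex.norm_natCast]; push_cast; rfl
  rw [h4, norm_div, norm_mul, h5, div_eq_mul_one_div]
  apply mul_le_mul_of_nonneg_left _ (norm_nonneg _)
  apply one_div_le_one_div_of_le (by positivity)
  rw [sq]
  exact mul_le_mul_of_nonneg_left h3 hk.le

theorem summable_sq : Summable (fun k : ℕ => 1 / ((k:ℝ) + 1) ^ 2) := by
  have := (summable_nat_add_iff 1).2 (Real.summable_one_div_nat_pow.2 (by norm_num : 1 < 2))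
  simpa using this

theorem digamma_hasSum {z : ℂ} (hz : 0 < z.re) :
    HasSum (fun k : ℕ => 1 / ((k:ℂ) + 1) - 1 / (z + (k + 1)))
      (digamma (z + 1) + eulerMascheroniConstant) := by
  set R : ℝ := ‖z‖ + 3 with hR
  set U : Set ℂ := {w : ℂ | 0 < w.re} ∩ ball 0 R with hU
  have hUo : IsOpen U := (isOpen_lt continuous_const Complex.continuous_re).inter isOpen_ball
  have hUc : IsPreconnected U :=
    ((convex_halfSpace_re_gt 0).inter (convex_ball 0 R)).isPreconnected
  set F : ℕ → ℂ → ℂ := fun k w => 1 / ((k:ℂ) + 1) - 1 / (w + (k + 1)) with hF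
  have hne : ∀ k : ℕ, ∀ w ∈ U, w + ((k:ℂ) + 1) ≠ 0 := by
    intro k w hw h
    have := congrArg Complex.re h
    have h1 : 0 < w.re := hw.1
    simp at this
    have : (0:ℝ) ≤ k := Nat.cast_nonneg k
    linarith
  have hu : Summable (fun k : ℕ => R * (1 / ((k:ℝ) + 1) ^ 2)) := summable_sq.mul_left R
  have hb : ∀ (k : ℕ) (w : ℂ), w ∈ U → ‖F k w‖ ≤ R * (1 / ((k:ℝ) + 1) ^ 2) := by
    intro k w hw
    refine (term_bound (le_of_lt hw.1) k).trans ?_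
    have : ‖w‖ ≤ R := by have := hw.2; simp at this; exact this.le
    gcongr
  have hdiff : DifferentiableOn ℂ (fun w => ∑' k, F k w) U := by
    apply differentiableOn_tsum_of_summable_norm hu _ hUo hb
    intro k w hw
    apply DifferentiableAt.differentiableWithinAt
    have := hne k w hw
    simp only [hF]
    fun_prop (disch := assumption)
  have hdig : DifferentiableOn ℂ (fun w => digamma (w + 1) + eulerMascheroniConstant) U := by
    intro w hw
    apply DifferentiableAt.differentiableWithinAt
    have hw1 : 0 < w.re := hw.1
    have hg : DifferentiableAt ℂ digamma (w + 1) := by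
      have hop : IsOpen {v : ℂ | 0 < v.re} := isOpen_lt continuous_const Complex.continuous_re
      have hD : DifferentiableOn ℂ Complex.Gamma {v : ℂ | 0 < v.re} := by
        intro v hv
        apply DifferentiableAt.differentiableWithinAt
        apply Complex.differentiableAt_Gamma
        intro m h
        have hv' : 0 < v.re := hv
        rw [h] at hv'
        simp at hv'
        have : (0:ℝ) ≤ m := Nat.cast_nonneg m
        linarith
      have hm : w + 1 ∈ {v : ℂ | 0 < v.re} := by simp; linarith
      have h1 := (hD.deriv hop).differentiableAt (hop.mem_nhds hm)
      have h2 := hD.differentiableAt (hop.mem_nhds hm)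
      have h3 : Complex.Gamma (w + 1) ≠ 0 := Complex.Gamma_ne_zero_of_re_pos hm
      have := h1.div h2 h3
      exact this
    have h4 : DifferentiableAt ℂ (fun w : ℂ => w + 1) w := by fun_prop
    exact (DifferentiableAt.comp w hg h4).add_const _
  have hreal : ∀ x : ℝ, 0 < x → (∑' k, F k (x:ℂ)) = digamma ((x:ℂ) + 1) + eulerMascheroniConstant := by
    intro x hx
    have h1 := Complex.hasSum_ofReal.2 (dg_hasSum hx)
    have h2 := digamma_real (x := x + 1) (by linarith)
    push_cast at h2
    rw [h2]
    have h3 := h1.tsum_eq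
    unfold dg at h3
    push_cast at h3
    exact h3
  have h1U : (1:ℂ) ∈ U := by
    refine ⟨by simp, ?_⟩
    simp [hR]; linarith [norm_nonneg z]
  have heq := (hdiff.analyticOnNhd hUo).eqOn_of_preconnected_of_frequently_eq
    (hdig.analyticOnNhd hUo) hUc h1U (by
      have ht : Tendsto (fun n : ℕ => ((1 + 1 / ((n:ℝ) + 1) : ℝ) : ℂ)) atTop (𝓝[≠] 1) := by
        rw [tendsto_nhdsWithin_iff]
        constructor
        · have := (tendsto_one_div_add_atTop_nhds_zero_nat (𝕜 := ℝ)).const_add 1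
          rw [add_zero] at this
          have h3 := (Complex.continuous_ofReal.tendsto 1).comp this
          simp only [Complex.ofReal_one] at h3
          exact h3
        · filter_upwards with n
          intro h
          have h' : ((1 + 1 / ((n:ℝ) + 1) : ℝ) : ℂ) = ((1:ℝ):ℂ) := by rw [h]; simp
          have h'' := Complex.ofReal_injective h'
          have : 0 < 1 / ((n:ℝ) + 1) := by positivity
          linarith
      refine ht.frequently (Eventually.frequently (Eventually.of_forall fun n => ?_))
      exact hreal _ (by positivity))
  have hzU : z ∈ U := ⟨hz, by simp [hR]⟩
  have h2 := heq hzU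
  simp only at h2
  rw [← h2]
  exact (Summable.of_norm_bounded hu (fun k => hb k z hzU)).hasSum

end PR



namespace PR
open Complex Filter Topology Metric MeasureTheory

theorem normSq_log_step {x t : ℝ} (hx : 0 < x) :
    (1/2) * (Real.log ((x+1)^2+t^2) - Real.log (x^2+t^2)) - 1/2 * (1/(x^2+t^2)) ≤ x / (x^2+t^2) := by
  have h0 : 0 < x^2+t^2 := by positivity
  have h1 : 0 < (x+1)^2+t^2 := by positivity
  rw [← Real.log_div h1.ne' h0.ne']
  have h2 := Real.log_le_sub_one_of_pos (x := ((x+1)^2+t^2)/(x^2+t^2)) (by positivity)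
  have h3 : ((x+1)^2+t^2)/(x^2+t^2) - 1 = 2 * (x / (x^2+t^2)) + 1/(x^2+t^2) := by
    field_simp; ring
  linarith

theorem tele_step {x t : ℝ} (hx : 0 < x) (ht : 0 ≤ t) :
    1 / (x^2+t^2) ≤ 2 * (1/(x+t-1/2+0) - 1/(x+t+1/2)) ∨ x + t ≤ 1/2 := by
  by_cases h : x + t ≤ 1/2
  · right; exact h
  · left
    push Not at h
    have h1 : 0 < x + t - 1/2 := by linarith
    have e : 2 * (1/(x+t-1/2+0) - 1/(x+t+1/2)) = 2 / ((x+t)^2 - 1/4) := by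
      have h2 : (x+t)^2 - 1/4 = (x+t-1/2)*(x+t+1/2) := by ring
      have h3 : x+t+1/2 ≠ 0 := by positivity
      have h4 : x+t-1/2 ≠ 0 := h1.ne'
      rw [add_zero, h2, div_sub_div _ _ h4 h3]
      rw [mul_div_assoc']
      congr 1
      ring
    rw [e, div_le_div_iff₀ (by positivity) (by nlinarith)]
    nlinarith [sq_nonneg (x - t)]

theorem re_digamma_le {z : ℂ} (hz : 0 < z.re) :
    (digamma (z + 1)).re ≤ (1/2) * Real.log ((z.re+1)^2 + z.im^2) + 1 / (z.re + |z.im| + 1/2) := by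
  have h1 := Complex.hasSum_re (digamma_hasSum hz)
  have h2 := h1.tendsto_sum_nat
  set x := z.re with hx
  set t := |z.im| with ht
  have ht2 : z.im^2 = t^2 := (sq_abs _).symm
  have ht0 : 0 ≤ t := abs_nonneg _
  have hterm : ∀ k : ℕ, (1 / ((k:ℂ) + 1) - 1 / (z + (k + 1))).re =
      1 / ((k:ℝ)+1) - (x + (k+1)) / ((x+(k+1))^2 + t^2) := by
    intro k
    have e1 : (1 / ((k:ℂ) + 1)).re = 1 / ((k:ℝ)+1) := by
      have : (1 / ((k:ℂ) + 1)) = ((1 / ((k:ℝ)+1) : ℝ) : ℂ) := by push_cast; rfl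
      rw [this, Complex.ofReal_re]
    rw [Complex.sub_re, e1, one_div (z + _), Complex.inv_re, Complex.normSq_apply]
    simp only [Complex.add_re, Complex.add_im, Complex.natCast_re, Complex.natCast_im, Complex.one_re, Complex.one_im]
    rw [← ht2]
    congr 2; ring
  have hpart : ∀ n : ℕ, ∑ k ∈ range n, (1 / ((k:ℂ) + 1) - 1 / (z + (k + 1))).re ≤
      (harmonic n : ℝ) - (1/2) * (Real.log ((x+1+n)^2+t^2) - Real.log ((x+1)^2+t^2))
       + (1/(x+t+1/2) - 1/(x+t+n+1/2)) := by
    intro n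
    induction n with
    | zero => simp
    | succ n ih =>
      rw [sum_range_succ, hterm, harmonic_succ]
      have s1 := normSq_log_step (x := x + (n+1)) (t := t) (by positivity)
      have s2 := (tele_step (x := x + (n+1)) (t := t) (by positivity) ht0).resolve_right (by
        have : (0:ℝ) ≤ n := Nat.cast_nonneg n
        push Not; linarith)
      push_cast
      have e1 : x + 1 + (n:ℝ) = x + (n+1) := by ring
      have e2 : x + 1 + ((n:ℝ)+1) = x + (n+1) + 1 := by ring
      have e3 : x + t + (n:ℝ) + 1/2 = x + (n+1) + t - 1/2 + 0 := by ring
      have e4 : x + t + ((n:ℝ)+1) + 1/2 = x + (n+1) + t + 1/2 := by ring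
      rw [e1, e3] at ih
      rw [e2, e4]
      have e5 : 1 / ((n:ℝ)+1) = ((n:ℝ)+1)⁻¹ := one_div _
      linarith
  have h3 : Tendsto (fun n : ℕ => (harmonic n : ℝ) - Real.log n + ((1/2) * Real.log ((x+1)^2+t^2) + 1/(x+t+1/2))) atTop
      (𝓝 (eulerMascheroniConstant + ((1/2) * Real.log ((x+1)^2+t^2) + 1/(x+t+1/2)))) :=
    Real.tendsto_harmonic_sub_log.add_const _
  have h4 := le_of_tendsto_of_tendsto h2 h3 (by
    filter_upwards [eventually_gt_atTop 0] with n hn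
    refine (hpart n).trans ?_
    have hn' : (0:ℝ) < n := by exact_mod_cast hn
    have l1 : Real.log n ≤ 1/2 * Real.log ((x+1+n)^2+t^2) := by
      have : Real.log ((n:ℝ)^2) ≤ Real.log ((x+1+n)^2+t^2) := by
        apply Real.log_le_log (by positivity)
        nlinarith [sq_nonneg t]
      rw [Real.log_pow] at this
      push_cast at this
      linarith
    have l2 : 0 ≤ 1/(x+t+n+1/2) := by positivity
    linarith)
  simp only [Complex.add_re, Complex.ofReal_re] at h4
  rw [ht2]
  linarith

theorem xi_logDeriv {s : ℂ} (hs : 1 < s.re) :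
    logDeriv xi s = 1/(s-1) + deriv riemannZeta s / riemannZeta s - Real.log π / 2
      + digamma (s/2+1) / 2 := by
  have hs1 : s ≠ 1 := by rintro rfl; simp at hs
  have hs0 : s ≠ 0 := by rintro rfl; simp at hs; linarith
  have h1 : s - 1 ≠ 0 := sub_ne_zero.2 hs1
  have hz := riemannZeta_ne_zero_of_one_lt_re hs
  have hre : 0 < (s/2).re := by simp; linarith
  have hG := Complex.Gamma_ne_zero_of_re_pos hre
  have hloc : xi =ᶠ[𝓝 s] fun w => w * (w - 1) * ((π:ℂ)^(-w/2) * Complex.Gamma (w/2) * riemannZeta w) := by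
    have ho : IsOpen {w : ℂ | 1 < w.re} := isOpen_lt continuous_const Complex.continuous_re
    filter_upwards [ho.mem_nhds hs] with w hw
    have hw' : 1 < w.re := hw
    rw [xi_eq w (by linarith) (by rintro rfl; simp at hw')]
    rw [Gammaℝ_def]
  have hval : logDeriv xi s = logDeriv (fun w => w * (w - 1) * ((π:ℂ)^(-w/2) * Complex.Gamma (w/2) * riemannZeta w)) s := by
    rw [logDeriv_apply, logDeriv_apply, hloc.deriv_eq, hloc.eq_of_nhds]
  have hpi : (π:ℂ) ≠ 0 := by exact_mod_cast Real.pi_ne_zero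
  have hΓd : DifferentiableAt ℂ Complex.Gamma (s/2) := by
    apply Complex.differentiableAt_Gamma
    intro m h
    rw [h] at hre
    simp at hre
    have : (0:ℝ) ≤ m := Nat.cast_nonneg m
    linarith
  have hdiv : HasDerivAt (fun w : ℂ => w/2) (1/2) s := (hasDerivAt_id s).div_const 2
  have d1 : HasDerivAt (fun w : ℂ => Complex.Gamma (w/2)) (deriv Complex.Gamma (s/2) * (1/2)) s :=
    HasDerivAt.comp s hΓd.hasDerivAt hdiv
  have d2 : HasDerivAt (fun w : ℂ => (π:ℂ)^(-w/2)) ((π:ℂ)^(-s/2) * Complex.log π * (-1/2)) s := by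
    have : HasDerivAt (fun w : ℂ => -w/2) (-1/2) s := (hasDerivAt_id s).neg.div_const 2
    exact this.const_cpow (Or.inl hpi)
  have d3 := (differentiableAt_riemannZeta hs1).hasDerivAt
  have d4 : HasDerivAt (fun w : ℂ => w * (w-1)) (1 * (s-1) + s * 1) s :=
    (hasDerivAt_id s).mul ((hasDerivAt_id s).sub_const 1)
  have d5 := d4.mul ((d2.mul d1).mul d3)
  have hP : (π:ℂ)^(-s/2) ≠ 0 := by rw [Ne, Complex.cpow_eq_zero_iff]; tauto
  rw [hval, logDeriv_apply]
  have d5' := d5.deriv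
  simp only [Pi.mul_def] at d5'
  rw [d5', digamma_apply_add_one (s/2) (by
    intro m h
    rw [h] at hre
    simp at hre
    have : (0:ℝ) ≤ m := Nat.cast_nonneg m
    linarith), digamma_def, logDeriv_apply, ← Complex.ofReal_log Real.pi_pos.le]
  field_simp
  ring

theorem xi_logDeriv_one :
    logDeriv xi 1 = ((1 + eulerMascheroniConstant / 2 - Real.log (4 * π) / 2 : ℝ) : ℂ) := by
  set h : ℂ → ℂ := fun s => if s = 1 then 1 else (s - 1) * riemannZeta s with hh
  have hd : HasDerivAt h eulerMascheroniConstant 1 := by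
    rw [hasDerivAt_iff_tendsto_slope]
    refine tendsto_riemannZeta_sub_one_div.congr' ?_
    filter_upwards [self_mem_nhdsWithin] with s hs
    have hs : s ≠ 1 := hs
    have h1 : s - 1 ≠ 0 := sub_ne_zero.2 hs
    rw [slope_def_field]
    simp only [hh, if_neg hs, if_true]
    field_simp
  have hloc : xi =ᶠ[𝓝 1] fun w => w * h w * ((π:ℂ)^(-w/2) * Complex.Gamma (w/2)) := by
    have ho : IsOpen {w : ℂ | 0 < w.re} := isOpen_lt continuous_const Complex.continuous_re
    filter_upwards [ho.mem_nhds (by simp : (1:ℂ) ∈ {w : ℂ | 0 < w.re})] with w hw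
    by_cases h1 : w = 1
    · rw [h1, xi_one, ← Gammaℝ_def, Gammaℝ_one]
      simp [hh]
    · rw [xi_eq w hw h1, Gammaℝ_def]
      simp only [hh, if_neg h1]
      ring
  have hpi : (π:ℂ) ≠ 0 := by exact_mod_cast Real.pi_ne_zero
  have d1 : HasDerivAt (fun w : ℂ => Complex.Gamma (w/2)) (-√π * (eulerMascheroniConstant + 2 * Complex.log 2) * (1/2)) 1 :=
    HasDerivAt.comp (1:ℂ) Complex.hasDerivAt_Gamma_one_half ((hasDerivAt_id (1:ℂ)).div_const 2)
  have d2 : HasDerivAt (fun w : ℂ => (π:ℂ)^(-w/2)) ((π:ℂ)^(-1/2:ℂ) * Complex.log π * (-1/2)) 1 := by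
    have : HasDerivAt (fun w : ℂ => -w/2) (-1/2) 1 := (hasDerivAt_id (1:ℂ)).neg.div_const 2
    exact this.const_cpow (Or.inl hpi)
  have d4 := ((hasDerivAt_id (1:ℂ)).mul hd).mul (d2.mul d1)
  have d5 := d4.deriv
  simp only [Pi.mul_def, id] at d5
  have hG := Gammaℝ_one
  rw [Gammaℝ_def] at hG
  have hsp : ((√π : ℝ) : ℂ) = Complex.Gamma (1/2) := by
    rw [Complex.Gamma_one_half_eq]
    rw [Real.sqrt_eq_rpow, Complex.ofReal_cpow Real.pi_pos.le]
    push_cast; rfl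
  have h1 : h 1 = 1 := by simp [hh]
  have hlog : Real.log (4 * π) = 2 * Real.log 2 + Real.log π := by
    rw [Real.log_mul (by norm_num) Real.pi_ne_zero, show (4:ℝ) = 2^2 by norm_num, Real.log_pow]
    push_cast; ring
  rw [logDeriv_apply, xi_one, hloc.deriv_eq, d5, h1, hlog, hsp, ← Complex.ofReal_log Real.pi_pos.le]
  have hl2 : Complex.log 2 = ((Real.log 2 : ℝ):ℂ) := by
    rw [Complex.ofReal_log (by norm_num)]; norm_num
  rw [hl2]
  push_cast
  linear_combination (1 + (eulerMascheroniConstant:ℂ) - Real.log π / 2 - (eulerMascheroniConstant + 2 * Real.log 2)/2) * hG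

end PR



namespace PR
open Complex Filter Topology Metric MeasureTheory

theorem gamma_step_lo {m : ℝ} (hm : 1 ≤ m) : 1 / m ≤ Real.log (m + 1/2) - Real.log (m - 1/2) := by
  have h := Real.sum_range_le_log_div (x := 1/(2*m)) (by positivity) (by
    rw [div_lt_one (by positivity)]; linarith) 1
  have e : (1 + 1/(2*m)) / (1 - 1/(2*m)) = (m + 1/2) / (m - 1/2) := by
    have h1 : 2*m - 1 ≠ 0 := by linarith
    have h2 : m - 1/2 ≠ 0 := by linarith
    have h3 : 1 - 1/(2*m) ≠ 0 := by
      have : 1 - 1/(2*m) = (2*m-1)/(2*m) := by field_simp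
      rw [this]; positivity
    rw [div_eq_div_iff h3 h2]
    field_simp
  rw [e, Real.log_div (by linarith) (by linarith)] at h
  simp at h
  have : m⁻¹ * 2⁻¹ * 2 = 1/m := by field_simp
  linarith

theorem gamma_step_hi {m : ℝ} (hm : 1 ≤ m) : Real.log (m + 1/2) - Real.log (m - 1/2) ≤
    1 / m + (1/24) * (1/(m-1/2)^2 - 1/(m+1/2)^2) := by
  have hx0 : 0 < 1/(2*m) := by positivity
  have hx1 : 1/(2*m) ≤ 1/2 := by apply one_div_le_one_div_of_le <;> linarith
  have h := Real.log_div_le_sum_range_add (x := 1/(2*m)) (by positivity) (by linarith) 3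
  have e : (1 + 1/(2*m)) / (1 - 1/(2*m)) = (m + 1/2) / (m - 1/2) := by
    have h1 : 2*m - 1 ≠ 0 := by linarith
    have h2 : m - 1/2 ≠ 0 := by linarith
    have h3 : 1 - 1/(2*m) ≠ 0 := by linarith
    rw [div_eq_div_iff h3 h2]
    field_simp
  rw [e, Real.log_div (by linarith) (by linarith)] at h
  have e2 : (1/24) * (1/(m-1/2)^2 - 1/(m+1/2)^2) = 2 * ((1/(2*m))^3/(3 * (1-(1/(2*m))^2)^2)) := by
    have h1 : m - 1/2 ≠ 0 := by linarith
    have h2 : m + 1/2 ≠ 0 := by linarith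
    have h3 : 1-(1/(2*m))^2 = (m-1/2)*(m+1/2)/m^2 := by
      field_simp; ring
    rw [h3, div_sub_div _ _ (pow_ne_zero 2 h1) (pow_ne_zero 2 h2)]
    field_simp
    ring
  have e3 : 1 / m = 2 * (1/(2*m)) := by field_simp
  rw [e2, e3]
  generalize 1/(2*m) = x at *
  have key : x^3/3 + x^5/5 + x^7/(1-x^2) ≤ x^3/(3*(1-x^2)^2) := by
    have hy : 0 < 1 - x^2 := by nlinarith
    have e4 : x^3/(3*(1-x^2)^2) - (x^3/3 + x^5/5 + x^7/(1-x^2)) =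
       x^5 * (5*2 - 5*x^2 - 3*(1-x^2)^2 - 15*x^2*(1-x^2)) / (15*(1-x^2)^2) := by
      field_simp
      ring
    have : 0 ≤ x^5 * (5*2 - 5*x^2 - 3*(1-x^2)^2 - 15*x^2*(1-x^2)) / (15*(1-x^2)^2) := by
      apply div_nonneg _ (by positivity)
      apply mul_nonneg (by positivity)
      have : x^2 ≤ 1/4 := by nlinarith
      nlinarith [sq_nonneg x]
    linarith
  simp only [sum_range_succ, sum_range_zero] at h
  norm_num at h
  linarith

theorem gamma_le (n : ℕ) : eulerMascheroniConstant ≤ harmonic n - Real.log (n + 1/2) := by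
  have hanti : Antitone (fun n : ℕ => (harmonic n : ℝ) - Real.log (n + 1/2)) := by
    apply antitone_nat_of_succ_le
    intro n
    have := gamma_step_lo (m := n + 1) (by linarith [(Nat.cast_nonneg n : (0:ℝ) ≤ n)])
    rw [harmonic_succ]
    push_cast
    have e : (n:ℝ) + 1 - 1/2 = n + 1/2 := by ring
    rw [e] at this
    rw [one_div] at this
    linarith
  have ht : Tendsto (fun n : ℕ => (harmonic n : ℝ) - Real.log (n + 1/2)) atTop (𝓝 eulerMascheroniConstant) := by
    refine tendsto_of_tendsto_of_tendsto_of_le_of_le' Real.tendsto_harmonic_sub_log_add_one Real.tendsto_harmonic_sub_log ?_ ?_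
    · filter_upwards with n
      have : Real.log ((n:ℝ) + 1/2) ≤ Real.log (n + 1) := Real.log_le_log (by positivity) (by linarith)
      linarith
    · filter_upwards [eventually_gt_atTop 0] with n hn
      have hn' : (0:ℝ) < n := by exact_mod_cast hn
      have : Real.log (n:ℝ) ≤ Real.log (n + 1/2) := Real.log_le_log (by positivity) (by linarith)
      linarith
  exact hanti.le_of_tendsto ht n

theorem gamma_ge (n : ℕ) : harmonic n - Real.log (n + 1/2) - (1/24) * (1/((n:ℝ)+1/2)^2) ≤ eulerMascheroniConstant := by
  have hmono : Monotone (fun n : ℕ => (harmonic n : ℝ) - Real.log (n + 1/2) - (1/24) * (1/((n:ℝ)+1/2)^2)) := by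
    apply monotone_nat_of_le_succ
    intro n
    have := gamma_step_hi (m := n + 1) (by linarith [(Nat.cast_nonneg n : (0:ℝ) ≤ n)])
    rw [harmonic_succ]
    push_cast
    have e : (n:ℝ) + 1 - 1/2 = n + 1/2 := by ring
    rw [e] at this
    rw [one_div ((n:ℝ)+1)] at this
    linarith
  have ht : Tendsto (fun n : ℕ => (harmonic n : ℝ) - Real.log (n + 1/2) - (1/24) * (1/((n:ℝ)+1/2)^2)) atTop (𝓝 eulerMascheroniConstant) := by
    have hz : Tendsto (fun n : ℕ => (1/((n:ℝ)))) atTop (𝓝 0) := tendsto_one_div_atTop_nhds_zero_nat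
    have h1 := Real.tendsto_harmonic_sub_log_add_one.sub hz
    rw [sub_zero] at h1
    refine tendsto_of_tendsto_of_tendsto_of_le_of_le' h1 Real.tendsto_harmonic_sub_log ?_ ?_
    · filter_upwards [eventually_gt_atTop 0] with n hn
      have hn' : (1:ℝ) ≤ n := by exact_mod_cast hn
      have : Real.log ((n:ℝ) + 1/2) ≤ Real.log (n + 1) := Real.log_le_log (by positivity) (by linarith)
      have : 1 / ((n:ℝ)+1/2)^2 ≤ 1 / n := by
        apply one_div_le_one_div_of_le (by positivity)
        nlinarith
      have : 0 ≤ 1 / ((n:ℝ)+1/2)^2 := by positivity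
      linarith
    · filter_upwards [eventually_gt_atTop 0] with n hn
      have hn' : (0:ℝ) < n := by exact_mod_cast hn
      have : Real.log (n:ℝ) ≤ Real.log (n + 1/2) := Real.log_le_log (by positivity) (by linarith)
      have : 0 ≤ 1 / ((n:ℝ)+1/2)^2 := by positivity
      linarith
  exact hmono.ge_of_tendsto ht n

theorem gamma_bounds : 0.57721 < eulerMascheroniConstant ∧ eulerMascheroniConstant < 0.57725 := by
  have e : (((40:ℕ):ℝ) + 1/2) = 3^4/2 := by norm_num
  have e2 : Real.log ((3:ℝ)^4/2) = 4 * Real.log 3 - Real.log 2 := by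
    rw [Real.log_div (by norm_num) (by norm_num), Real.log_pow]; norm_num
  have h1 := gamma_le 40
  have h2 := gamma_ge 40
  rw [e, e2] at h1 h2
  have hh : (harmonic 40 : ℚ) = 2078178381193813/485721041551200 := by
    simp only [harmonic, sum_range_succ]
    norm_num
  rw [hh] at h1 h2
  push_cast at h1 h2
  have := Real.log_three_gt_d9
  have := Real.log_three_lt_d9
  have := Real.log_two_gt_d9
  have := Real.log_two_lt_d9
  constructor
  · norm_num at h2 ⊢; linarith
  · norm_num at h1 ⊢; linarith

theorem log_pi_bounds : 1.1447 < Real.log π ∧ Real.log π < 1.1448 := by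
  constructor
  · have h := Real.sum_range_le_log_div (x := 283/12283) (by norm_num) (by norm_num) 2
    have e : ((1:ℝ) + 283/12283)/(1-283/12283) = 3.1415/3 := by norm_num
    rw [e, Real.log_div (by norm_num) (by norm_num)] at h
    have h3 : Real.log 3.1415 ≤ Real.log π := Real.log_le_log (by norm_num) Real.pi_gt_d4.le
    have := Real.log_three_gt_d9
    norm_num [sum_range_succ] at h h3 ⊢
    linarith
  · have h := Real.log_div_le_sum_range_add (x := 177/7677) (by norm_num) (by norm_num) 2
    have e : ((1:ℝ) + 177/7677)/(1-177/7677) = 3.1416/3 := by norm_num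
    rw [e, Real.log_div (by norm_num) (by norm_num)] at h
    have h3 : Real.log π ≤ Real.log 3.1416 := Real.log_le_log Real.pi_pos Real.pi_lt_d4.le
    have := Real.log_three_lt_d9
    norm_num [sum_range_succ] at h h3 ⊢
    linarith

end PR



namespace PR
open Complex Filter Topology Metric MeasureTheory

theorem re_inv_pos {w : ℂ} (h : 0 < w.re) : 0 < (1 / w).re := by
  rw [one_div, Complex.inv_re]
  apply div_pos h
  rw [Complex.normSq_pos]
  rintro rfl
  simp at h

theorem vterm_eq {v a : ℂ} (hv : 1/2 ≤ v.re) (ha : |a.re| < 1/2) :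
    v / (v^2 - a^2) = (1 / (v - a) + 1 / (v + a)) / 2 := by
  have h := abs_lt.1 ha
  have h1 : v - a ≠ 0 := by
    intro h0; have := congrArg Complex.re h0; simp at this; linarith
  have h2 : v + a ≠ 0 := by
    intro h0; have := congrArg Complex.re h0; simp at this; linarith
  have e : v^2 - a^2 = (v - a) * (v + a) := by ring
  rw [e]
  field_simp
  ring

theorem vterm_nonneg {v a : ℂ} (hv : 1/2 ≤ v.re) (ha : |a.re| < 1/2) :
    0 ≤ (v / (v^2 - a^2)).re := by
  have h := abs_lt.1 ha
  rw [vterm_eq hv ha]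
  have h1 : 0 < (1 / (v - a)).re := re_inv_pos (by simp; linarith)
  have h2 : 0 < (1 / (v + a)).re := re_inv_pos (by simp; linarith)
  have : ((1 / (v - a) + 1 / (v + a)) / 2).re = ((1 / (v - a)).re + (1 / (v + a)).re) / 2 := by
    rw [← Complex.add_re]
    exact Complex.div_ofNat_re _ 2
  rw [this]
  positivity

theorem xi_hasSum_re (s : ℂ) (hs : 1 ≤ s.re) :
    HasSum (fun a : ℂ => (mm a : ℝ) * ((s - 1/2) / ((s - 1/2) ^ 2 - a ^ 2)).re) (logDeriv xi s).re := by
  have h := Complex.hasSum_re (xi_hasSum s (xi_ne_zero s hs))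
  have e : (fun a : ℂ => ((mm a : ℂ) * ((s - 1/2) / ((s - 1/2) ^ 2 - a ^ 2))).re) =
      fun a : ℂ => (mm a : ℝ) * ((s - 1/2) / ((s - 1/2) ^ 2 - a ^ 2)).re := by
    ext a
    rw [← Complex.re_ofReal_mul]; simp
  rw [← e]; exact h

theorem xi_term_nonneg (s : ℂ) (hs : 1 ≤ s.re) (a : ℂ) :
    0 ≤ (mm a : ℝ) * ((s - 1/2) / ((s - 1/2) ^ 2 - a ^ 2)).re := by
  by_cases h : mm a = 0
  · simp [h]
  · apply mul_nonneg (Nat.cast_nonneg _)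
    apply vterm_nonneg _ (mm_strip h)
    simp; norm_num; linarith

theorem xi_sum_le (s : ℂ) (hs : 1 ≤ s.re) (S : Finset ℂ) :
    ∑ a ∈ S, (mm a : ℝ) * ((s - 1/2) / ((s - 1/2) ^ 2 - a ^ 2)).re ≤ (logDeriv xi s).re :=
  sum_le_hasSum S (fun a _ => xi_term_nonneg s hs a) (xi_hasSum_re s hs)

/-- real part of the kernel for real v. -/
theorem kernel_re {v : ℝ} (hv : 1/2 ≤ v) {a : ℂ} (ha : |a.re| < 1/2) :
    1 / (a.im^2 + v^2 + 3/4) ≤ (1 / ((v:ℂ)^2 - a^2)).re ∧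
    ‖1 / ((v:ℂ)^2 - a^2)‖ ≤ 1 / (v^2 - a.re^2 + a.im^2) := by
  have hq : a.re^2 < 1/4 := by
    have := abs_lt.1 ha; nlinarith
  have hv2 : 1/4 ≤ v^2 := by nlinarith
  set X := v^2 - a.re^2 + a.im^2 with hX
  have hXp : 0 < X := by have := sq_nonneg a.im; linarith
  have hre : ((v:ℂ)^2 - a^2).re = X := by
    simp [sq, Complex.sub_re, Complex.mul_re, hX]; ring
  have him : ((v:ℂ)^2 - a^2).im = -2 * a.re * a.im := by
    simp [sq, Complex.mul_im]; ring
  constructor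
  · rw [one_div ((v:ℂ)^2 - a^2), Complex.inv_re, Complex.normSq_apply, hre, him]
    rw [div_le_div_iff₀ (by positivity) (by nlinarith [mul_self_nonneg (-2 * a.re * a.im)])]
    have h1 : a.im^2 ≤ X := by linarith
    have h2 : (-2 * a.re * a.im) * (-2 * a.re * a.im) ≤ 4 * a.re^2 * X := by
      nlinarith [sq_nonneg a.re]
    nlinarith [sq_nonneg a.re]
  · rw [norm_div, norm_one]
    apply one_div_le_one_div_of_le hXp
    rw [← hre]
    exact Complex.re_le_norm _

theorem kernel_sum {v : ℝ} (hv : 1/2 ≤ v) (S : Finset ℂ) :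
    ∑ a ∈ S, (mm a : ℝ) * (1 / (a.im^2 + v^2 + 3/4)) ≤ (logDeriv xi ((1/2 + v : ℝ):ℂ)).re / v := by
  have hv0 : 0 < v := by linarith
  rw [le_div_iff₀ hv0, sum_mul]
  refine le_trans ?_ (xi_sum_le ((1/2 + v : ℝ):ℂ) (by simp; norm_num; linarith) S)
  apply sum_le_sum
  intro a _
  by_cases h : mm a = 0
  · simp [h]
  have hk := (kernel_re hv (mm_strip h)).1
  have e : (((1/2 + v : ℝ):ℂ) - 1/2) = (v:ℂ) := by push_cast; ring
  rw [e, mul_assoc]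
  apply mul_le_mul_of_nonneg_left _ (Nat.cast_nonneg _)
  have e2 : ((v:ℂ) / ((v:ℂ)^2 - a^2)).re = v * (1 / ((v:ℂ)^2 - a^2)).re := by
    rw [← Complex.re_ofReal_mul, mul_one_div]
  rw [e2, mul_comm]
  exact mul_le_mul_of_nonneg_left hk hv0.le

theorem xi_one_val : (logDeriv xi 1).re ≤ 0.02315 := by
  rw [xi_logDeriv_one, Complex.ofReal_re, Real.log_mul (by norm_num) Real.pi_ne_zero,
    show (4:ℝ) = 2^2 by norm_num, Real.log_pow]
  have := gamma_bounds.2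
  have := log_pi_bounds.1
  have := Real.log_two_gt_d9
  push_cast
  linarith

theorem xi_pair (s : ℂ) (hs : 1 ≤ s.re) {a : ℂ} (h : mm a ≠ 0) (h0 : a ≠ 0) :
    2 * ((s - 1/2) / ((s - 1/2) ^ 2 - a ^ 2)).re ≤ (logDeriv xi s).re := by
  have h1 := xi_sum_le s hs {a, -a}
  have hne : a ≠ -a := by
    intro h; apply h0; exact self_eq_neg.1 h
  rw [sum_pair hne, mm_neg, neg_sq] at h1
  have h2 : (1:ℝ) ≤ mm a := by exact_mod_cast Nat.one_le_iff_ne_zero.2 h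
  have h3 : 0 ≤ ((s - 1/2) / ((s - 1/2) ^ 2 - a ^ 2)).re :=
    vterm_nonneg (by simp; norm_num; linarith) (mm_strip h)
  nlinarith

theorem mm_height {a : ℂ} (h : mm a ≠ 0) : 36 ≤ a.im^2 := by
  by_contra hlt
  push Not at hlt
  have hk := (kernel_re (v := 1/2) le_rfl (mm_strip h)).1
  have e2 : ((1 - 1/2 : ℂ) / ((1 - 1/2 : ℂ)^2 - a^2)).re = (1/2) * (1 / (((1/2:ℝ):ℂ)^2 - a^2)).re := by
    rw [← Complex.re_ofReal_mul, mul_one_div]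
    push_cast; norm_num
  have h3 : 1/37 ≤ (1 / (((1/2:ℝ):ℂ)^2 - a^2)).re := by
    refine le_trans ?_ hk
    apply one_div_le_one_div_of_le (by positivity)
    linarith
  by_cases h0 : a = 0
  · have h1 := xi_sum_le 1 (by simp) {0}
    rw [sum_singleton] at h1
    have h2 : (1:ℝ) ≤ mm 0 := by rw [← h0]; exact_mod_cast Nat.one_le_iff_ne_zero.2 h
    have := xi_one_val
    have e : ((1 - 1/2 : ℂ) / ((1 - 1/2 : ℂ)^2 - 0^2)).re = 2 := by norm_num
    rw [e] at h1
    linarith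
  · have h1 := xi_pair 1 (by simp) h h0
    have := xi_one_val
    rw [e2] at h1
    norm_num at h1 h3 this
    linarith

/-- The coefficient attached to a zero. -/
noncomputable def cc (a : ℂ) : ℂ := 1 / (1/4 - a^2)

theorem cc_norm {a : ℂ} (h : mm a ≠ 0) : ‖cc a‖ ≤ (37/36) * (1 / (a.im^2 + 1)) := by
  have hk := (kernel_re (v := 1/2) le_rfl (mm_strip h)).2
  have hh := mm_height h
  have e : (((1/2:ℝ):ℂ))^2 = 1/4 := by push_cast; norm_num
  rw [e] at hk
  refine hk.trans ?_
  have hq : a.re^2 < 1/4 := by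
    have := abs_lt.1 (mm_strip h); nlinarith
  rw [mul_one_div, div_le_div_iff₀ (by linarith) (by linarith)]
  linarith

theorem cc_sum (S : Finset ℂ) : ∑ a ∈ S, (mm a : ℝ) * (1 / (a.im^2 + 1)) ≤ 0.0463 := by
  have h := kernel_sum (v := 1/2) le_rfl S
  have e : (((1/2 + 1/2 : ℝ)):ℂ) = 1 := by push_cast; norm_num
  rw [e] at h
  have := xi_one_val
  have e2 : ∑ a ∈ S, (mm a : ℝ) * (1 / (a.im^2 + 1)) = ∑ a ∈ S, (mm a : ℝ) * (1 / (a.im^2 + (1/2)^2 + 3/4)) := by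
    apply sum_congr rfl; intro a _; norm_num [add_assoc]
  rw [e2]
  refine h.trans ?_
  linarith

theorem summable_im : Summable (fun a : ℂ => (mm a : ℝ) * (1 / (a.im^2 + 1))) :=
  summable_of_sum_le (fun a => by positivity) cc_sum

theorem summable_cc : Summable (fun a : ℂ => (mm a : ℝ) * ‖cc a‖) := by
  refine Summable.of_nonneg_of_le (fun a => by positivity) (fun a => ?_) (summable_im.mul_left (37/36))
  by_cases h : mm a = 0
  · simp [h]
  · have := cc_norm h
    calc _ ≤ (mm a : ℝ) * ((37/36) * (1 / (a.im^2 + 1))) := by gcongr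
      _ = _ := by ring

theorem tsum_cc : ∑' a : ℂ, (mm a : ℝ) * ‖cc a‖ ≤ 0.0476 := by
  have h1 : ∑' a : ℂ, (mm a : ℝ) * ‖cc a‖ ≤ ∑' a : ℂ, (37/36) * ((mm a : ℝ) * (1 / (a.im^2 + 1))) := by
    refine summable_cc.tsum_le_tsum (fun a => ?_) (summable_im.mul_left (37/36))
    by_cases h : mm a = 0
    · simp [h]
    · have := cc_norm h
      calc _ ≤ (mm a : ℝ) * ((37/36) * (1 / (a.im^2 + 1))) := by gcongr
        _ = _ := by ring
  rw [tsum_mul_left] at h1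
  have h2 := summable_im.tsum_le_of_sum_le cc_sum
  linarith

end PR



namespace PR
open Complex Filter Topology Metric MeasureTheory ArithmeticFunction

/-- minus the logarithmic derivative of zeta. -/
noncomputable def Zt (s : ℂ) : ℂ := -deriv riemannZeta s / riemannZeta s

theorem Zt_hasSum {s : ℂ} (hs : 1 < s.re) :
    HasSum (fun n : ℕ => LSeries.term (fun n => ((vonMangoldt n : ℝ) : ℂ)) s n) (Zt s) := by
  have h := (LSeriesSummable_vonMangoldt hs).LSeriesHasSum
  rw [LSeries_vonMangoldt_eq_deriv_riemannZeta_div hs] at h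
  exact h

theorem term_real (σ : ℝ) (n : ℕ) :
    LSeries.term (fun n => ((vonMangoldt n : ℝ) : ℂ)) (σ:ℂ) n = ((vonMangoldt n * (n:ℝ)^(-σ) : ℝ) : ℂ) := by
  rcases Nat.eq_zero_or_pos n with rfl | hn
  · simp
  · rw [LSeries.term_of_ne_zero hn.ne', Complex.ofReal_mul, Complex.ofReal_cpow (Nat.cast_nonneg n)]
    push_cast
    rw [Complex.cpow_neg, div_eq_mul_inv]

theorem three_four_one {σ t : ℝ} (hσ : 1 < σ) :
    0 ≤ 3 * (Zt σ).re + 4 * (Zt (σ + t * I)).re + (Zt (σ + 2 * t * I)).re := by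
  have h1 := Complex.hasSum_re (Zt_hasSum (s := (σ:ℂ)) (by simpa using hσ))
  have h2 := Complex.hasSum_re (Zt_hasSum (s := (σ + t * I:ℂ)) (by simpa using hσ))
  have h3 := Complex.hasSum_re (Zt_hasSum (s := (σ + 2 * t * I:ℂ)) (by simpa using hσ))
  have h := ((h1.mul_left 3).add (h2.mul_left 4)).add h3
  refine h.nonneg (fun n => ?_)
  rcases Nat.eq_zero_or_pos n with rfl | hn
  · simp
  have hn0 : (n:ℂ) ≠ 0 := by exact_mod_cast hn.ne'
  set z : ℂ := (n:ℂ)^(-(t * I)) with hz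
  have hzn : ‖z‖ = 1 := by
    rw [hz, Complex.norm_natCast_cpow_of_pos hn]; simp
  have e2 : LSeries.term (fun n => ((vonMangoldt n : ℝ) : ℂ)) (σ + t * I:ℂ) n =
      ((vonMangoldt n * (n:ℝ)^(-σ) : ℝ) : ℂ) * z := by
    rw [← term_real, LSeries.term_of_ne_zero hn.ne', LSeries.term_of_ne_zero hn.ne',
      Complex.cpow_add _ _ hn0, hz, Complex.cpow_neg]
    field_simp
  have e3 : LSeries.term (fun n => ((vonMangoldt n : ℝ) : ℂ)) (σ + 2 * t * I:ℂ) n =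
      ((vonMangoldt n * (n:ℝ)^(-σ) : ℝ) : ℂ) * (z * z) := by
    rw [← term_real, LSeries.term_of_ne_zero hn.ne', LSeries.term_of_ne_zero hn.ne',
      show (σ + 2 * t * I:ℂ) = σ + (t * I + t * I) by ring,
      Complex.cpow_add _ _ hn0, Complex.cpow_add _ _ hn0, hz, Complex.cpow_neg]
    field_simp
  rw [e2, e3, term_real, Complex.ofReal_re, Complex.re_ofReal_mul, Complex.re_ofReal_mul]
  have hA : 0 ≤ vonMangoldt n * (n:ℝ)^(-σ) := mul_nonneg vonMangoldt_nonneg (by positivity)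
  have hsq : z.re^2 + z.im^2 = 1 := by
    have := Complex.sq_norm z
    rw [hzn, Complex.normSq_apply] at this
    nlinarith
  rw [Complex.mul_re]
  have : 3 * (vonMangoldt n * (n:ℝ)^(-σ)) + 4 * (vonMangoldt n * (n:ℝ)^(-σ) * z.re) +
      vonMangoldt n * (n:ℝ)^(-σ) * (z.re * z.re - z.im * z.im) =
      (vonMangoldt n * (n:ℝ)^(-σ)) * (2 * (1 + z.re)^2) := by
    linear_combination (vonMangoldt n * (n:ℝ)^(-σ)) * (-1) * hsq
  rw [this]
  positivity

theorem Zt_real_nonneg {σ : ℝ} (hσ : 1 < σ) : 0 ≤ (Zt σ).re := by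
  have h1 := Complex.hasSum_re (Zt_hasSum (s := (σ:ℂ)) (by simpa using hσ))
  refine h1.nonneg (fun n => ?_)
  rw [term_real, Complex.ofReal_re]
  exact mul_nonneg vonMangoldt_nonneg (by positivity)

theorem Zt_re {s : ℂ} (hs : 1 < s.re) :
    (Zt s).re = (1/(s-1)).re - Real.log π / 2 + (digamma (s/2+1)).re / 2 - (logDeriv xi s).re := by
  have h := xi_logDeriv hs
  have h2 : Zt s = 1/(s-1) - Real.log π / 2 + digamma (s/2+1) / 2 - logDeriv xi s := by
    rw [h, Zt]; ring
  rw [h2]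
  have e1 : ((Real.log π : ℂ) / 2).re = Real.log π / 2 := by
    rw [Complex.div_ofNat_re, Complex.ofReal_re]
  simp only [Complex.sub_re, Complex.add_re, Complex.div_ofNat_re, Complex.ofReal_re]

theorem Zt_re_le {s : ℂ} (hs : 1 < s.re) :
    (Zt s).re ≤ (1/(s-1)).re - Real.log π / 2 + (1/4) * Real.log ((s.re/2+1)^2 + (s.im/2)^2)
      + (1/2) * (1 / (1 + |s.im|/2)) - (logDeriv xi s).re := by
  rw [Zt_re hs]
  have hre : (s/2).re = s.re/2 := Complex.div_ofNat_re _ _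
  have him : (s/2).im = s.im/2 := Complex.div_ofNat_im _ _
  have h := re_digamma_le (z := s/2) (by rw [hre]; linarith)
  rw [hre, him, abs_div, abs_of_pos (by norm_num : (0:ℝ) < 2)] at h
  have h2 : 1 / (s.re/2 + |s.im|/2 + 1/2) ≤ 1 / (1 + |s.im|/2) := by
    apply one_div_le_one_div_of_le (by positivity)
    linarith
  linarith

theorem digamma_re_real {x : ℝ} (hx : 0 < x) : (digamma ((x:ℂ))).re = dg x := by
  rw [digamma_real hx, Complex.ofReal_re]; rfl

theorem Zt_re_real_le {σ : ℝ} (hs : 1 < σ) :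
    (Zt σ).re ≤ 1/(σ-1) - Real.log π / 2 + (1/2) * Real.log (σ/2+1) := by
  rw [Zt_re (by simpa using hs)]
  have e : ((σ:ℂ)/2+1) = ((σ/2+1 : ℝ) : ℂ) := by push_cast; ring
  have e2 : (1/((σ:ℂ)-1)).re = 1/(σ-1) := by
    rw [show 1/((σ:ℂ)-1) = ((1/(σ-1) : ℝ):ℂ) by push_cast; rfl, Complex.ofReal_re]
  rw [e, e2, digamma_re_real (by positivity)]
  have h1 := (dg_slope (x := σ/2+1) (by positivity)).1
  have h2 : 0 ≤ (logDeriv xi σ).re :=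
    (xi_hasSum_re σ (by simpa using hs.le)).nonneg (fun a => xi_term_nonneg σ (by simpa using hs.le) a)
  linarith

theorem xi_real_le {s : ℝ} (hs : 1 < s) :
    (logDeriv xi s).re ≤ 1/(s-1) + 1/s + (1/2) * (Real.log s - Real.log (2 * π)) := by
  have h0 := Zt_re (s := (s:ℂ)) (by simpa using hs)
  have hn := Zt_real_nonneg hs
  have e : ((s:ℂ)/2+1) = ((s/2+1 : ℝ) : ℂ) := by push_cast; ring
  have e2 : (1/((s:ℂ)-1)).re = 1/(s-1) := by
    rw [show 1/((s:ℂ)-1) = ((1/(s-1) : ℝ):ℂ) by push_cast; rfl, Complex.ofReal_re]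
  rw [e, e2, digamma_re_real (by positivity), dg_add_one (by positivity)] at h0
  have h1 := (dg_slope (x := s/2) (by positivity)).1
  rw [Real.log_div (by linarith) (by norm_num)] at h1
  rw [Real.log_mul (by norm_num) Real.pi_ne_zero]
  have e3 : 1/(s/2) = 2 * (1/s) := by field_simp
  rw [e3] at h0
  linarith

/-- the logarithmic weight -/
noncomputable def lam (a : ℂ) : ℝ := Real.log (1 + (a.im^2+1)/34)

set_option maxHeartbeats 2000000 in
theorem zfr_aux {a : ℂ} (h : mm a ≠ 0) : 1 ≤ 17.45 * lam a * (1/2 - a.re) := by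
  have hh := mm_height h
  have hst := abs_lt.1 (mm_strip h)
  set g := a.im with hg
  have hlam : 0.693 ≤ lam a := by
    have : Real.log 2 ≤ lam a := Real.log_le_log (by norm_num) (by linarith)
    have := Real.log_two_gt_d9
    linarith
  set D := 1.25 * lam a with hD
  have hD0 : 0.866 ≤ D := by rw [hD]; linarith
  set E := 0.464 / D with hE
  have hE0 : 0 < E := by positivity
  have hE1 : E ≤ 0.536 := by
    rw [hE, div_le_iff₀ (by linarith)]; linarith
  have h341 := three_four_one (σ := 1 + E) (t := g) (by linarith)
  have z0 := Zt_re_real_le (σ := 1 + E) (by linarith)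
  have z1 := Zt_re_le (s := ((1 + E : ℝ):ℂ) + g * I) (by simp; linarith)
  have z2 := Zt_re_le (s := ((1 + E : ℝ):ℂ) + 2 * g * I) (by simp; linarith)
  have a0 : a ≠ 0 := by
    rintro rfl; simp [hg] at hh; linarith
  have x1 := xi_pair (((1 + E : ℝ):ℂ) + g * I) (by simp; linarith) h a0
  have x2 : 0 ≤ (logDeriv xi (((1 + E : ℝ):ℂ) + 2 * g * I)).re :=
    (xi_hasSum_re _ (by simp; linarith)).nonneg (fun b => xi_term_nonneg _ (by simp; linarith) b)
  rw [vterm_eq (by simp; linarith) (mm_strip h)] at x1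
  have hp : 0 < (1 / (((1 + E : ℝ):ℂ) + g * I - 1/2 + a)).re := re_inv_pos (by simp; linarith)
  have hva : ((1 + E : ℝ):ℂ) + g * I - 1/2 - a = ((E + (1/2 - a.re) : ℝ) : ℂ) := by
    apply Complex.ext
    · simp; ring
    · simp [hg]
  rw [Complex.div_ofNat_re, Complex.add_re, hva, ← Complex.ofReal_one, ← Complex.ofReal_div, Complex.ofReal_re] at x1
  rw [← Complex.ofReal_one] at hp
  have im1 : (((1 + E : ℝ):ℂ) + g * I).im = g := by simp
  have re1 : (((1 + E : ℝ):ℂ) + g * I).re = 1 + E := by simp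
  have im2 : (((1 + E : ℝ):ℂ) + 2 * g * I).im = 2 * g := by simp
  have re2 : (((1 + E : ℝ):ℂ) + 2 * g * I).re = 1 + E := by simp
  rw [im1, re1] at z1
  rw [im2, re2] at z2
  have r1 : (1 / (((1 + E : ℝ):ℂ) + g * I - 1)).re ≤ 0.0149 := by
    rw [one_div, Complex.inv_re, Complex.normSq_apply]
    simp only [Complex.sub_re, re1, Complex.sub_im, im1, Complex.one_re, Complex.one_im]
    rw [div_le_iff₀ (by nlinarith)]
    nlinarith
  have r2 : (1 / (((1 + E : ℝ):ℂ) + 2 * g * I - 1)).re ≤ 0.0038 := by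
    rw [one_div, Complex.inv_re, Complex.normSq_apply]
    simp only [Complex.sub_re, re2, Complex.sub_im, im2, Complex.one_re, Complex.one_im]
    rw [div_le_iff₀ (by nlinarith)]
    nlinarith
  have habs : 6 ≤ |g| := by
    rw [← Real.sqrt_sq_eq_abs]
    exact Real.le_sqrt_of_sq_le (by linarith)
  have q1 : 1 / (1 + |g|/2) ≤ 1/4 := by
    apply one_div_le_one_div_of_le (by norm_num); linarith
  have q2 : 1 / (1 + |2 * g|/2) ≤ 1/7 := by
    rw [abs_mul, abs_of_pos (by norm_num : (0:ℝ) < 2)]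
    apply one_div_le_one_div_of_le (by norm_num); linarith
  have l1 : Real.log (((1+E)/2+1)^2 + (g/2)^2) ≤ Real.log (g^2+35) - 2 * Real.log 2 := by
    have : Real.log ((g^2+35)/2^2) = Real.log (g^2+35) - 2 * Real.log 2 := by
      rw [Real.log_div (by positivity) (by norm_num), Real.log_pow]; push_cast; ring
    rw [← this]
    apply Real.log_le_log (by positivity)
    nlinarith
  have l2 : Real.log (((1+E)/2+1)^2 + (2*g/2)^2) ≤ Real.log (g^2+35) := by
    apply Real.log_le_log (by positivity)
    nlinarith
  have l0 : Real.log ((1+E)/2+1) ≤ 0.578 := by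
    have e : Real.log ((1+E)/2+1) = Real.log 2 + Real.log (((1+E)/2+1)/2) := by
      rw [← Real.log_mul (by norm_num) (by positivity)]; congr 1; ring
    have := Real.log_le_sub_one_of_pos (x := ((1+E)/2+1)/2) (by positivity)
    have := Real.log_two_lt_d9
    rw [e]; linarith
  have l34 : lam a = Real.log (g^2+35) - Real.log 34 := by
    unfold lam
    rw [← Real.log_div (by positivity) (by norm_num)]; congr 1; rw [← hg]; ring
  have h34 : Real.log 34 ≤ 3.5284 := by
    have e : Real.log 34 = 5 * Real.log 2 + Real.log (17/16) := by
      rw [show (34:ℝ) = 2^5 * (17/16) by norm_num, Real.log_mul (by norm_num) (by norm_num), Real.log_pow]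
      push_cast; ring
    have := Real.log_le_sub_one_of_pos (x := 17/16) (by norm_num)
    have := Real.log_two_lt_d9
    rw [e]; linarith
  have hpi := log_pi_bounds.1
  have hl2 := Real.log_two_gt_d9
  have eE : 1 + E - 1 = E := by ring
  rw [eE] at z0
  have main : 4 * (1/(E + (1/2 - a.re))) ≤ 3 * (1/E) + D := by
    rw [hD, l34]
    push_cast at *
    linarith
  have hden : 0 < E + (1/2 - a.re) := by linarith
  have e1 : 1/E = D/0.464 := by rw [hE]; field_simp
  rw [e1, mul_one_div, div_le_iff₀ hden] at main
  have hED : E * D = 0.464 := by rw [hE]; field_simp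
  have : 17.45 * lam a = 13.96 * D := by rw [hD]; ring
  rw [this]
  have : (3 * (D/0.464) + D) * (E + (1/2 - a.re)) = (3/0.464+1) * (E * D + D * (1/2-a.re)) := by ring
  rw [this, hED] at main
  norm_num at main ⊢
  linarith

theorem zfr {a : ℂ} (h : mm a ≠ 0) : 1 ≤ 17.45 * lam a * (1/2 - |a.re|) := by
  rcases abs_choice a.re with h1 | h1
  · rw [h1]; exact zfr_aux h
  · rw [h1]
    have := zfr_aux (a := -a) (by rw [mm_neg]; exact h)
    unfold lam at this ⊢
    simpa using this

end PR



namespace PR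
open Complex Filter Topology Metric MeasureTheory ArithmeticFunction

noncomputable def Gf (v : ℝ) : ℝ :=
  1.0074 * ((Real.log v - Real.log (2*π) + 1) / v + 2.265 / v^2)

theorem Gf_deriv {v : ℝ} (hv : 0 < v) :
    HasDerivAt Gf (-(1.0074 * ((Real.log v - Real.log (2*π) + 4.53/v) / v^2))) v := by
  have h1 : HasDerivAt (fun v : ℝ => Real.log v - Real.log (2*π) + 1) (v⁻¹) v :=
    ((Real.hasDerivAt_log hv.ne').sub_const _).add_const _
  have h2 := h1.div (hasDerivAt_id v) hv.ne'
  have h3 := (hasDerivAt_const v (2.265:ℝ)).div ((hasDerivAt_id v).pow 2) (by simp; exact hv.ne')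
  have h4 := (h2.add h3).const_mul 1.0074
  refine h4.congr_deriv ?_
  simp only [id, Pi.pow_apply]
  field_simp
  push_cast
  ring

theorem Gf_bound {v : ℝ} (hv : 34.25 ≤ v^2) (hv0 : 0 < v) :
    (2 / (v^2 - 1/4)) * (logDeriv xi ((1/2 + v : ℝ):ℂ)).re ≤
      1.0074 * ((Real.log v - Real.log (2*π) + 4.53/v) / v^2) := by
  have hv5 : 5.85 ≤ v := by nlinarith
  have h := xi_real_le (s := 1/2 + v) (by linarith)
  have hl : Real.log (1/2 + v) ≤ Real.log v + 1/(2*v) := by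
    have e : 1/2 + v = v * (1 + 1/(2*v)) := by field_simp; ring
    rw [e, Real.log_mul (by positivity) (by positivity)]
    have := Real.log_le_sub_one_of_pos (x := 1 + 1/(2*v)) (by positivity)
    linarith
  have hp : 0 < v^2 - 1/4 := by linarith
  have e1 : 1/(1/2 + v - 1) + 1/(1/2+v) = 2*v/(v^2-1/4) := by
    have a1 : 1/2 + v - 1 ≠ 0 := by linarith
    have a2 : 1/2 + v ≠ 0 := by linarith
    rw [div_add_div _ _ a1 a2, div_eq_div_iff (mul_ne_zero a1 a2) hp.ne']
    ring
  have h1 : 1/(v^2-1/4) ≤ 1.0074/v^2 := by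
    rw [div_le_div_iff₀ hp (by positivity)]; linarith
  have e2 : 2*v/(v^2-1/4) ≤ 2.0148/v := by
    calc 2*v/(v^2-1/4) = 2*v*(1/(v^2-1/4)) := by ring
      _ ≤ 2*v*(1.0074/v^2) := by gcongr
      _ = 2.0148/v := by field_simp; norm_num
  have h2 : 2 * (logDeriv xi ((1/2 + v : ℝ):ℂ)).re ≤ Real.log v - Real.log (2*π) + 4.53/v := by
    have : (1:ℝ)/(2*v) = 0.5/v := by field_simp; norm_num
    have e4 : (4.53:ℝ)/v = 0.5/v + 2*(2.0148/v) + 0.0004/v := by field_simp; norm_num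
    have : 0 ≤ 0.0004/v := by positivity
    linarith
  have hnn : 0 ≤ (logDeriv xi ((1/2 + v : ℝ):ℂ)).re :=
    (xi_hasSum_re _ (by simp; norm_num; linarith)).nonneg (fun b => xi_term_nonneg _ (by simp; norm_num; linarith) b)
  calc (2 / (v^2 - 1/4)) * (logDeriv xi ((1/2 + v : ℝ):ℂ)).re
      = (1/(v^2-1/4)) * (2 * (logDeriv xi ((1/2 + v : ℝ):ℂ)).re) := by ring
    _ ≤ (1.0074/v^2) * (2 * (logDeriv xi ((1/2 + v : ℝ):ℂ)).re) := by gcongr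
    _ ≤ (1.0074/v^2) * (Real.log v - Real.log (2*π) + 4.53/v) := by gcongr
    _ = _ := by ring

noncomputable def Lf (B v : ℝ) : ℝ := Real.log (B + (v^2 - 1/4)) - Real.log (v^2-1/4)

theorem Lf_deriv {B v : ℝ} (hB : 0 < B) (hv : 1/4 < v^2) :
    HasDerivAt (Lf B) (-((2*v/(v^2-1/4)) * (B * (1/(B + (v^2-1/4)))))) v := by
  have hp : 0 < v^2 - 1/4 := by linarith
  have h0 : HasDerivAt (fun v : ℝ => v^2 - 1/4) (2*v) v := by
    simpa using ((hasDerivAt_id v).pow 2).sub_const (1/4)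
  have h1 : HasDerivAt (fun v : ℝ => B + (v^2 - 1/4)) (2*v) v := h0.const_add B
  have h2 := (h1.log (by positivity)).sub (h0.log hp.ne')
  refine h2.congr_deriv ?_
  have : B + (v^2-1/4) ≠ 0 := by positivity
  have := hp.ne'
  rw [div_sub_div _ _ (by assumption) (by assumption)]
  rw [← neg_eq_iff_eq_neg]
  rw [mul_one_div, div_mul_div_comm, ← neg_div, mul_comm (v^2-1/4)]
  congr 1
  ring

theorem Lf_tendsto {B : ℝ} (hB : 0 < B) : Tendsto (Lf B) atTop (𝓝 0) := by
  have h1 : Tendsto (fun v : ℝ => v^2 - 1/4) atTop atTop :=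
    tendsto_atTop_add_const_right _ _ (tendsto_pow_atTop (by norm_num))
  have h2 : Tendsto (fun u : ℝ => Real.log (B + u) - Real.log u) atTop (𝓝 0) := by
    have h3 : Tendsto (fun u : ℝ => 1 + B / u) atTop (𝓝 (1 + 0)) :=
      (tendsto_const_nhds.div_atTop tendsto_id).const_add 1
    rw [add_zero] at h3
    have h4 := h3.log (by norm_num)
    rw [Real.log_one] at h4
    refine h4.congr' ?_
    filter_upwards [eventually_gt_atTop 0] with u hu
    rw [← Real.log_div (by positivity) hu.ne']
    congr 1; field_simp
    ring
  exact h2.comp h1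

theorem Gf_tendsto : Tendsto Gf atTop (𝓝 0) := by
  have h1 : Tendsto (fun v : ℝ => Real.log v / v) atTop (𝓝 0) := by
    simpa using Real.tendsto_pow_log_div_mul_add_atTop 1 0 1 one_ne_zero
  have h2 : Tendsto (fun v : ℝ => (-Real.log (2*π) + 1) / v) atTop (𝓝 0) :=
    tendsto_const_nhds.div_atTop tendsto_id
  have h3 : Tendsto (fun v : ℝ => 2.265 / v^2) atTop (𝓝 0) :=
    tendsto_const_nhds.div_atTop (tendsto_pow_atTop (by norm_num))
  have h4 := ((h1.add h2).add h3).const_mul 1.0074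
  simp only [add_zero, mul_zero] at h4
  refine h4.congr (fun v => ?_)
  unfold Gf
  ring

theorem lam_sum (S : Finset ℂ) : ∑ a ∈ S, (mm a : ℝ) * (lam a / (a.im^2+1)) ≤ 0.23 := by
  set v0 : ℝ := √34.25 with hv0
  have hv0s : v0^2 = 34.25 := Real.sq_sqrt (by norm_num)
  have hv0p : 0 < v0 := Real.sqrt_pos.2 (by norm_num)
  have hv1 : 5.852 ≤ v0 := Real.le_sqrt_of_sq_le (by norm_num)
  set Ph : ℝ → ℝ := fun v => ∑ a ∈ S, (mm a : ℝ) * (Lf (a.im^2+1) v / (a.im^2+1)) - Gf v with hPh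
  have hder : ∀ v : ℝ, v0 ≤ v → HasDerivAt Ph (∑ a ∈ S, (mm a : ℝ) * (-((2*v/(v^2-1/4)) * ((a.im^2+1) * (1/((a.im^2+1) + (v^2-1/4))))) / (a.im^2+1)) - -(1.0074 * ((Real.log v - Real.log (2*π) + 4.53/v) / v^2))) v := by
    intro v hv
    have hvp : 0 < v := by linarith
    have hv2 : 34.25 ≤ v^2 := by rw [← hv0s]; gcongr
    have h1 : HasDerivAt (fun v => ∑ a ∈ S, (mm a : ℝ) * (Lf (a.im^2+1) v / (a.im^2+1))) _ v :=
      HasDerivAt.fun_sum (fun a _ => ((Lf_deriv (B := a.im^2+1) (by positivity) (by linarith)).div_const (a.im^2+1)).const_mul (mm a : ℝ))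
    exact h1.sub (Gf_deriv hvp)
  have hmono : MonotoneOn Ph (Set.Ici v0) := by
    apply monotoneOn_of_deriv_nonneg (convex_Ici v0)
    · intro v hv
      exact (hder v hv).continuousAt.continuousWithinAt
    · intro v hv
      rw [interior_Ici] at hv
      exact (hder v (le_of_lt hv)).differentiableAt.differentiableWithinAt
    · intro v hv
      rw [interior_Ici] at hv
      have hv : v0 < v := hv
      rw [(hder v hv.le).deriv]
      have hvp : 0 < v := by linarith
      have hv2 : 34.25 ≤ v^2 := by rw [← hv0s]; gcongr
      have hb := Gf_bound hv2 hvp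
      have hk := kernel_sum (v := v) (by linarith) S
      rw [le_div_iff₀ hvp] at hk
      have e : ∑ a ∈ S, (mm a : ℝ) * (-((2*v/(v^2-1/4)) * ((a.im^2+1) * (1/((a.im^2+1) + (v^2-1/4))))) / (a.im^2+1)) =
          -((2/(v^2-1/4)) * ((∑ a ∈ S, (mm a : ℝ) * (1 / (a.im^2 + v^2 + 3/4))) * v)) := by
        rw [sum_mul, mul_sum, ← sum_neg_distrib]
        apply sum_congr rfl
        intro a _
        have e1 : (a.im^2+1) + (v^2-1/4) = a.im^2 + v^2 + 3/4 := by ring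
        rw [e1]
        have : a.im^2+1 ≠ 0 := by positivity
        field_simp
      rw [e]
      have hp : 0 ≤ 2/(v^2-1/4) := by apply div_nonneg <;> linarith
      have := mul_le_mul_of_nonneg_left hk hp
      linarith
  have hlim : Tendsto Ph atTop (𝓝 0) := by
    have h1 : Tendsto (fun v => ∑ a ∈ S, (mm a : ℝ) * (Lf (a.im^2+1) v / (a.im^2+1))) atTop (𝓝 (∑ a ∈ S, (mm a : ℝ) * (0 / (a.im^2+1)))) :=
      tendsto_finsetSum _ (fun a _ => ((Lf_tendsto (B := a.im^2+1) (by positivity)).div_const _).const_mul _)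
    have := h1.sub Gf_tendsto
    simpa using this
  have hle : Ph v0 ≤ 0 := by
    apply ge_of_tendsto hlim
    filter_upwards [eventually_ge_atTop v0] with v hv
    exact hmono (Set.mem_Ici.2 le_rfl) hv hv
  have e1 : ∑ a ∈ S, (mm a : ℝ) * (Lf (a.im^2+1) v0 / (a.im^2+1)) = ∑ a ∈ S, (mm a : ℝ) * (lam a / (a.im^2+1)) := by
    apply sum_congr rfl
    intro a _
    congr 2
    unfold Lf lam
    rw [hv0s, ← Real.log_div (by positivity) (by norm_num)]
    congr 1; norm_num; ring
  simp only [hPh] at hle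
  rw [e1] at hle
  have hlog : Real.log v0 ≤ 1.76803 := by
    have e : 2 * Real.log v0 = 5 * Real.log 2 + Real.log (137/128) := by
      have : 2 * Real.log v0 = Real.log (v0^2) := by rw [Real.log_pow]; push_cast; ring
      rw [this, hv0s, show (34.25:ℝ) = 2^5 * (137/128) by norm_num, Real.log_mul (by norm_num) (by norm_num), Real.log_pow]
      push_cast; ring
    have := Real.log_le_sub_one_of_pos (x := 137/128) (by norm_num)
    have := Real.log_two_lt_d9
    linarith
  have hG : Gf v0 ≤ 0.23 := by
    unfold Gf
    rw [hv0s, Real.log_mul (by norm_num) Real.pi_ne_zero]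
    have := log_pi_bounds.1
    have := Real.log_two_gt_d9
    have h5 : (Real.log v0 - (Real.log 2 + Real.log π) + 1) / v0 ≤ 0.9303 / 5.852 := by
      apply div_le_div₀ (by norm_num) (by linarith) (by norm_num) hv1
    have : (1.0074:ℝ) * (0.9303/5.852 + 2.265/34.25) ≤ 0.23 := by norm_num
    linarith
  linarith

theorem summable_lam : Summable (fun a : ℂ => (mm a : ℝ) * (lam a / (a.im^2+1))) := by
  refine summable_of_sum_le (fun a => ?_) lam_sum
  have : 0 ≤ lam a := Real.log_nonneg (by have := sq_nonneg a.im; linarith [div_nonneg (by positivity : 0 ≤ a.im^2+1) (by norm_num : (0:ℝ) ≤ 34)])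
  positivity

/-- weighted sum over zeros controlling the error term -/
theorem tsum_eta (S : Finset ℂ) : ∑ a ∈ S, (mm a : ℝ) * ‖cc a‖ * (1/(1/2-|a.re|) + 2) ≤ 4.23 := by
  have h : ∀ a ∈ S, (mm a : ℝ) * ‖cc a‖ * (1/(1/2-|a.re|) + 2) ≤
      (37/36) * 17.45 * ((mm a : ℝ) * (lam a / (a.im^2+1))) + (37/36) * 2 * ((mm a : ℝ) * (1 / (a.im^2+1))) := by
    intro a _
    by_cases h : mm a = 0
    · simp [h]
    have h1 := zfr h
    have h2 := mm_strip h
    have h3 := cc_norm h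
    have hp : 0 < 1/2 - |a.re| := by linarith
    have h4 : 1/(1/2-|a.re|) ≤ 17.45 * lam a := by
      rw [div_le_iff₀ hp]; exact h1
    have h5 : 0 ≤ 1/(1/2-|a.re|) := by positivity
    calc (mm a : ℝ) * ‖cc a‖ * (1/(1/2-|a.re|) + 2) ≤ (mm a : ℝ) * ((37/36) * (1 / (a.im^2 + 1))) * (17.45 * lam a + 2) := by
          gcongr
      _ = _ := by ring
  refine (sum_le_sum h).trans ?_
  rw [sum_add_distrib, ← mul_sum, ← mul_sum]
  have := lam_sum S
  have := cc_sum S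
  linarith

end PR



namespace PR
open Complex Filter Topology Metric MeasureTheory ArithmeticFunction

theorem int_exp_Ioi (b : ℝ) (hb : 0 < b) : IntegrableOn (fun u : ℝ => Real.exp (-b*u)) (Set.Ioi 0) :=
  integrableOn_exp_mul_Ioi (by linarith) 0

theorem int_mul_bdd {h : ℝ → ℝ} (hc : Continuous h) {B : ℝ} (hB : ∀ u, 0 ≤ u → |h u| ≤ B)
    (b : ℝ) (hb : 0 < b) : IntegrableOn (fun u : ℝ => Real.exp (-b*u) * h u) (Set.Ioi 0) := by
  refine Integrable.mono' ((int_exp_Ioi b hb).mul_const B) ?_ ?_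
  · exact (Continuous.aestronglyMeasurable (by fun_prop))
  · filter_upwards [ae_restrict_mem measurableSet_Ioi] with u hu
    rw [norm_mul, Real.norm_eq_abs, Real.norm_eq_abs, abs_of_pos (Real.exp_pos _)]
    exact mul_le_mul_of_nonneg_left (hB u (le_of_lt hu)) (Real.exp_pos _).le

theorem laplace_uniq {h : ℝ → ℝ} (hc : Continuous h) {B : ℝ} (hB : ∀ u, 0 ≤ u → |h u| ≤ B)
    (h0 : ∀ n : ℕ, ∫ u in Set.Ioi (0:ℝ), Real.exp (-((n:ℝ)+1)*u) * h u = 0) :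
    ∀ u, 0 < u → h u = 0 := by
  have hB0 : 0 ≤ B := (abs_nonneg _).trans (hB 0 le_rfl)
  set q : ℝ → ℝ := fun x => x * h (-Real.log x) with hq
  have hqc : ContinuousOn q (Set.Icc 0 1) := by
    intro x hx
    rcases eq_or_lt_of_le hx.1 with h1 | h1
    · subst h1
      have : q 0 = 0 := by simp [hq]
      rw [ContinuousWithinAt, this]
      refine squeeze_zero_norm' (a := fun x => |x| * B) ?_ ?_
      · filter_upwards [self_mem_nhdsWithin] with y hy
        simp only [hq, norm_mul, Real.norm_eq_abs]
        refine mul_le_mul_of_nonneg_left (hB _ ?_) (abs_nonneg _)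
        have := Real.log_nonpos hy.1 hy.2
        linarith
      · have : Tendsto (fun x : ℝ => |x| * B) (𝓝 0) (𝓝 (|0| * B)) :=
          (Continuous.tendsto (by fun_prop) 0)
        simp only [abs_zero, zero_mul] at this
        exact this.mono_left nhdsWithin_le_nhds
    · have : ContinuousAt q x := by
        have h2 : ContinuousAt (fun x => h (-Real.log x)) x :=
          hc.continuousAt.comp (Real.continuousAt_log h1.ne').neg
        exact continuousAt_id.mul h2
      exact this.continuousWithinAt
  have hi2 : IntegrableOn (fun u : ℝ => Real.exp (-2*u) * (h u)^2) (Set.Ioi 0) := by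
    refine int_mul_bdd (h := fun u => (h u)^2) (by fun_prop) (B := B^2) ?_ 2 (by norm_num)
    intro u hu
    rw [abs_pow]
    exact pow_le_pow_left₀ (abs_nonneg _) (hB u hu) 2
  have key : ∀ ε > 0, ∫ u in Set.Ioi (0:ℝ), Real.exp (-2*u) * (h u)^2 ≤ ε * B := by
    intro ε hε
    obtain ⟨p, hp⟩ := exists_polynomial_near_of_continuousOn 0 1 q hqc ε hε
    have e0 : ∀ u : ℝ, p.eval (Real.exp (-u)) * (Real.exp (-1*u) * h u)
        = ∑ k ∈ p.support, p.coeff k * (Real.exp (-((k:ℝ)+1)*u) * h u) := by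
      intro u
      rw [Polynomial.eval_eq_sum, Polynomial.sum, Finset.sum_mul]
      refine Finset.sum_congr rfl fun k _ => ?_
      rw [← Real.exp_nat_mul, show -((k:ℝ)+1)*u = k * (-u) + (-1*u) by ring, Real.exp_add]
      ring
    have hik : ∀ k : ℕ, IntegrableOn (fun u : ℝ => p.coeff k * (Real.exp (-((k:ℝ)+1)*u) * h u)) (Set.Ioi 0) :=
      fun k => (int_mul_bdd hc hB ((k:ℝ)+1) (by positivity)).const_mul _
    have e1 : ∫ u in Set.Ioi (0:ℝ), p.eval (Real.exp (-u)) * (Real.exp (-1*u) * h u) = 0 := by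
      simp_rw [e0]
      rw [integral_finset_sum _ (fun k _ => hik k)]
      refine Finset.sum_eq_zero fun k _ => ?_
      rw [integral_const_mul, h0, mul_zero]
    have i1 : IntegrableOn (fun u : ℝ => p.eval (Real.exp (-u)) * (Real.exp (-1*u) * h u)) (Set.Ioi 0) := by
      simp_rw [e0]
      exact integrable_finset_sum _ (fun k _ => hik k)
    have e2 : ∫ u in Set.Ioi (0:ℝ), (Real.exp (-2*u) * (h u)^2
        - p.eval (Real.exp (-u)) * (Real.exp (-1*u) * h u)) ≤
        ∫ u in Set.Ioi (0:ℝ), ε * B * Real.exp (-1*u) := by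
      refine setIntegral_mono_on (hi2.sub i1) ((int_exp_Ioi 1 one_pos).const_mul _) measurableSet_Ioi ?_
      intro u hu
      have hu' : (0:ℝ) < u := hu
      have h3 := hp (Real.exp (-u)) ⟨(Real.exp_pos _).le, by rw [Real.exp_le_one_iff]; linarith⟩
      simp only [hq, Real.log_exp, neg_neg] at h3
      have h4 : Real.exp (-2*u) * (h u)^2 - p.eval (Real.exp (-u)) * (Real.exp (-1*u) * h u)
         = Real.exp (-1*u) * (-(p.eval (Real.exp (-u)) - Real.exp (-u) * h u) * h u) := by
        rw [show -2*u = -1*u + -u by ring, Real.exp_add]; ring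
      rw [h4, mul_comm (ε*B)]
      refine mul_le_mul_of_nonneg_left ?_ (Real.exp_pos _).le
      refine (le_abs_self _).trans ?_
      rw [abs_mul, abs_neg]
      exact mul_le_mul h3.le (hB u hu'.le) (abs_nonneg _) hε.le
    rw [integral_sub hi2 i1, e1, integral_const_mul, integral_exp_mul_Ioi (by norm_num)] at e2
    simpa using e2
  have hz : ∫ u in Set.Ioi (0:ℝ), Real.exp (-2*u) * (h u)^2 = 0 := by
    refine le_antisymm ?_ (integral_nonneg fun u => by positivity)
    by_contra hcon
    push Not at hcon
    set I := ∫ u in Set.Ioi (0:ℝ), Real.exp (-2*u) * (h u)^2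
    have := key (I / (2*(B+1))) (by positivity)
    rw [div_mul_eq_mul_div, le_div_iff₀ (by positivity)] at this
    nlinarith
  have hae := (integral_eq_zero_iff_of_nonneg (fun u => by positivity) hi2).1 hz
  have := Measure.eqOn_open_of_ae_eq (μ := volume) (U := Set.Ioi (0:ℝ)) hae isOpen_Ioi
    (Continuous.continuousOn (by fun_prop)) continuousOn_const
  intro u hu
  have h5 := this hu
  simp only [Pi.zero_apply, mul_eq_zero, Real.exp_ne_zero, false_or] at h5
  exact pow_eq_zero_iff (two_ne_zero) |>.1 h5

end PR



namespace PR
open Complex Filter Topology Metric MeasureTheory ArithmeticFunction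

theorem tsum_laplace {ι : Type*} {f : ι → ℝ → ℝ} {b : ι → ℝ} (hf : ∀ i, Continuous (f i))
    (hb : Summable b) (hfb : ∀ i u, |f i u| ≤ b i) :
    Continuous (fun u => ∑' i, f i u) ∧ (∀ u, |∑' i, f i u| ≤ ∑' i, b i) ∧
    ∀ β : ℝ, 0 < β → HasSum (fun i => ∫ u in Set.Ioi (0:ℝ), Real.exp (-β*u) * f i u)
      (∫ u in Set.Ioi (0:ℝ), Real.exp (-β*u) * ∑' i, f i u) := by
  refine ⟨continuous_tsum hf hb hfb, fun u => ?_, ?_⟩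
  · have := tsum_of_norm_bounded (f := fun i => f i u) hb.hasSum (fun i => hfb i u)
    simpa using this
  intro β hβ
  have hz : ∀ i, b i = 0 → ∀ u, f i u = 0 := fun i hi u => by
    have := hfb i u; rw [hi] at this; exact abs_nonpos_iff.1 this
  set s := Function.support b with hs
  haveI : Countable s := hb.countable_support.to_subtype
  have hb0 : ∀ i, 0 ≤ b i := fun i => (abs_nonneg _).trans (hfb i 0)
  have h1 := hasSum_integral_of_summable_integral_norm (μ := volume.restrict (Set.Ioi (0:ℝ)))
    (F := fun (i : s) u => Real.exp (-β*u) * f i u)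
    (fun i => int_mul_bdd (hf i) (fun u _ => hfb i u) β hβ) ?_
  · have e1 : ∀ u, ∑' i : s, Real.exp (-β*u) * f i u = Real.exp (-β*u) * ∑' i, f i u := by
      intro u
      rw [tsum_mul_left]
      congr 1
      refine tsum_subtype_eq_of_support_subset (f := fun i => f i u) ?_
      intro i hi
      simp only [Function.mem_support, hs] at hi ⊢
      exact fun h => hi (hz i h u)
    simp_rw [e1] at h1
    refine (hasSum_subtype_iff_of_support_subset (f := fun i => ∫ u in Set.Ioi (0:ℝ), Real.exp (-β*u) * f i u) ?_).1 h1
    intro i hi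
    simp only [Function.mem_support, hs] at hi ⊢
    intro h
    apply hi
    simp [hz i h]
  · refine Summable.of_nonneg_of_le (fun i => integral_nonneg fun u => norm_nonneg _) (fun i => ?_)
      ((hb.subtype s).mul_left (∫ u in Set.Ioi (0:ℝ), Real.exp (-β*u)))
    rw [mul_comm, Function.comp_apply, ← integral_const_mul]
    refine setIntegral_mono_on (int_mul_bdd (hf i) (fun u _ => hfb i u) β hβ).norm
      ((int_exp_Ioi β hβ).const_mul _) measurableSet_Ioi fun u _ => ?_
    rw [norm_mul, Real.norm_eq_abs, Real.norm_eq_abs, abs_of_pos (Real.exp_pos _), mul_comm]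
    exact mul_le_mul_of_nonneg_right (hfb i u) (Real.exp_pos _).le

noncomputable def fL (n : ℕ) (u : ℝ) : ℝ :=
  vonMangoldt n * (Real.exp (-|u|) * max (1/(n:ℝ) - Real.exp (-|u|)) 0)

theorem fL_cont (n : ℕ) : Continuous (fL n) := by unfold fL; fun_prop

theorem fL_bound (n : ℕ) (u : ℝ) : |fL n u| ≤ vonMangoldt n * (n:ℝ)^(-(2:ℝ)) := by
  rw [fL, abs_mul, abs_of_nonneg vonMangoldt_nonneg]
  refine mul_le_mul_of_nonneg_left ?_ vonMangoldt_nonneg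
  rw [Real.rpow_neg (Nat.cast_nonneg n), abs_of_nonneg (by positivity)]
  have e := Real.exp_pos (-|u|)
  have hn : (0:ℝ) ≤ 1/(n:ℝ) := by positivity
  have e2 : ((n:ℝ)^(2:ℝ))⁻¹ = (1/(n:ℝ))^2 := by rw [Real.rpow_two]; simp
  rw [e2]
  rcases le_total (1/(n:ℝ)) (Real.exp (-|u|)) with h | h
  · rw [max_eq_right (by linarith)]; simp
  · rw [max_eq_left (by linarith)]
    nlinarith

theorem summable_L2 : Summable (fun n : ℕ => vonMangoldt n * (n:ℝ)^(-(2:ℝ))) := by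
  have h := (Zt_hasSum (s := ((2:ℝ):ℂ)) (by simp)).summable
  simp_rw [term_real] at h
  exact Complex.summable_ofReal.1 h

theorem int_exp (b c : ℝ) (hb : 0 < b) : ∫ u in Set.Ioi c, Real.exp (-b*u) = Real.exp (-b*c)/b := by
  rw [integral_exp_mul_Ioi (by linarith)]
  field_simp

theorem fL_int (n : ℕ) (β : ℝ) (hβ : 0 < β) : ∫ u in Set.Ioi (0:ℝ), Real.exp (-β*u) * fL n u
    = vonMangoldt n * (n:ℝ)^(-(β+2)) / ((β+1)*(β+2)) := by
  rcases Nat.eq_zero_or_pos n with rfl | hn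
  · simp [fL]
  have hn' : (1:ℝ) ≤ n := by exact_mod_cast hn
  have hl : 0 ≤ Real.log n := Real.log_nonneg hn'
  rw [setIntegral_eq_of_subset_of_forall_sdiff_eq_zero (s := Set.Ioi (Real.log n)) measurableSet_Ioi
    (Set.Ioi_subset_Ioi hl)]
  · have e : ∀ u ∈ Set.Ioi (Real.log n), Real.exp (-β*u) * fL n u =
        (vonMangoldt n * (1/n)) * Real.exp (-(β+1)*u) - vonMangoldt n * Real.exp (-(β+2)*u) := by
      intro u hu
      have hu' : Real.log n < u := hu
      have hlt : Real.exp (-u) ≤ 1/n := by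
        rw [Real.exp_neg, one_div]
        apply inv_anti₀ (by linarith)
        rw [← Real.log_le_iff_le_exp (by linarith)]
        exact hu'.le
      rw [fL, abs_of_nonneg (by linarith), max_eq_left (by linarith),
        show -(β+2)*u = -β*u + (-u) + (-u) by ring, show -(β+1)*u = -β*u + (-u) by ring]
      simp only [Real.exp_add]
      ring
    rw [setIntegral_congr_fun measurableSet_Ioi e, integral_sub, integral_const_mul, integral_const_mul,
      int_exp _ _ (by linarith), int_exp _ _ (by linarith)]
    · have h1 : ∀ b : ℝ, Real.exp (-b * Real.log n) = (n:ℝ)^(-b) := fun b => by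
        rw [Real.rpow_def_of_pos (by linarith)]; ring_nf
      rw [h1, h1]
      have h2 : (n:ℝ)^(-(β+1)) = n * (n:ℝ)^(-(β+2)) := by
        rw [show -(β+1) = 1 + -(β+2) by ring, Real.rpow_add (by linarith), Real.rpow_one]
      rw [h2]
      field_simp
      ring
    · exact (integrableOn_exp_mul_Ioi (by linarith) _).const_mul _
    · exact (integrableOn_exp_mul_Ioi (by linarith) _).const_mul _
  · intro u hu
    have h1 : 0 < u := hu.1
    have h2 : u ≤ Real.log n := by simpa using hu.2
    have hlt : 1/n ≤ Real.exp (-u) := by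
      rw [Real.exp_neg, one_div]
      apply inv_anti₀ (Real.exp_pos _)
      rwa [← Real.le_log_iff_exp_le (by linarith)]
    rw [fL, abs_of_pos h1, max_eq_right (by linarith)]
    simp

noncomputable def fK (k : ℕ) (u : ℝ) : ℝ :=
  Real.exp (-|u|) * (1 - Real.exp (-(2*k+3)*|u|)) * (1/ ((2*k+2)*(2*k+3)))

theorem fK_cont (n : ℕ) : Continuous (fK n) := by unfold fK; fun_prop

theorem fK_bound (k : ℕ) (u : ℝ) : |fK k u| ≤ 1/ ((k:ℝ)+1)^2 := by
  have e1 : Real.exp (-|u|) ≤ 1 := by rw [Real.exp_le_one_iff]; simp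
  have e2 : Real.exp (-(2*k+3)*|u|) ≤ 1 := by
    rw [Real.exp_le_one_iff]; have := abs_nonneg u
    have : 0 ≤ (2*(k:ℝ)+3)*|u| := by positivity
    linarith
  have e3 := Real.exp_pos (-(2*k+3)*|u|)
  have e4 := Real.exp_pos (-|u|)
  rw [fK, abs_of_nonneg (by apply mul_nonneg _ (by positivity); apply mul_nonneg e4.le; linarith)]
  have h1 : Real.exp (-|u|) * (1 - Real.exp (-(2*k+3)*|u|)) ≤ 1 := by nlinarith
  refine (mul_le_mul_of_nonneg_right h1 (by positivity)).trans ?_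
  rw [one_mul]
  apply one_div_le_one_div_of_le (by positivity)
  nlinarith [(Nat.cast_nonneg k : (0:ℝ) ≤ k)]

theorem summable_sqk : Summable (fun k : ℕ => 1/((k:ℝ)+1)^2) := by
  have := (summable_nat_add_iff 1).2 (Real.summable_one_div_nat_pow (p := 2) |>.2 (by norm_num))
  simpa using this

theorem fK_int (k : ℕ) (β : ℝ) (hβ : 0 < β) : ∫ u in Set.Ioi (0:ℝ), Real.exp (-β*u) * fK k u
    = 1 / ((2*k+2)*(β+1)*(β+2*k+4)) := by
  have hk : (0:ℝ) ≤ k := Nat.cast_nonneg k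
  have e : ∀ u ∈ Set.Ioi (0:ℝ), Real.exp (-β*u) * fK k u =
        (1/ ((2*(k:ℝ)+2)*(2*k+3))) * (Real.exp (-(β+1)*u) - Real.exp (-(β+2*k+4)*u)) := by
      intro u hu
      rw [fK, abs_of_pos hu,
        show -(β+2*k+4)*u = -β*u + (-u) + (-(2*k+3)*u) by ring, show -(β+1)*u = -β*u + (-u) by ring]
      simp only [Real.exp_add]
      ring
  rw [setIntegral_congr_fun measurableSet_Ioi e, integral_const_mul, integral_sub,
      int_exp _ _ (by linarith), int_exp _ _ (by linarith)]
  · simp only [mul_zero, Real.exp_zero]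
    have : β + 2*k + 4 ≠ 0 := by positivity
    have : β + 1 ≠ 0 := by positivity
    field_simp
    ring
  · exact int_exp_Ioi _ (by linarith)
  · exact int_exp_Ioi _ (by linarith)

end PR



namespace PR
open Complex Filter Topology Metric MeasureTheory ArithmeticFunction

noncomputable def gA (a : ℂ) (u : ℝ) : ℂ :=
  cc a * ((1 + cexp (-1*(|u|:ℝ)))/2 - (cexp (-(1/2-a)*(|u|:ℝ)) + cexp (-(1/2+a)*(|u|:ℝ)))/2)

noncomputable def fA (a : ℂ) (u : ℝ) : ℝ := (mm a : ℝ) * (Real.exp (-|u|) * (gA a u).re)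

theorem fA_cont (a : ℂ) : Continuous (fA a) := by
  have : Continuous (gA a) := by unfold gA; fun_prop
  unfold fA
  have := Complex.continuous_re.comp this
  simp only [Function.comp_def] at this
  fun_prop

theorem norm_cexp_le {z : ℂ} (hz : 0 ≤ z.re) (u : ℝ) : ‖cexp (-z*(|u|:ℝ))‖ ≤ 1 := by
  rw [Complex.norm_exp, Real.exp_le_one_iff]
  simp
  positivity

theorem gA_bound {a : ℂ} (h : mm a ≠ 0) (u : ℝ) : ‖gA a u‖ ≤ 2 * ‖cc a‖ := by
  have hs := mm_strip h
  rw [abs_lt] at hs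
  have h1 := norm_cexp_le (z := 1) (by simp) u
  have h2 := norm_cexp_le (z := 1/2-a) (by simp; linarith) u
  have h3 := norm_cexp_le (z := 1/2+a) (by simp; linarith) u
  rw [gA, norm_mul, mul_comm]
  refine mul_le_mul_of_nonneg_right ?_ (norm_nonneg _)
  refine (norm_sub_le _ _).trans ?_
  rw [norm_div, norm_div]
  have h4 := norm_add_le (1:ℂ) (cexp (-1*(|u|:ℝ)))
  have h5 := norm_add_le (cexp (-(1/2-a)*(|u|:ℝ))) (cexp (-(1/2+a)*(|u|:ℝ)))
  rw [norm_one] at h4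
  have : ‖(2:ℂ)‖ = 2 := by simp
  rw [this]
  linarith

theorem fA_bound (a : ℂ) (u : ℝ) : |fA a u| ≤ 2 * ((mm a:ℝ) * ‖cc a‖) := by
  by_cases h : mm a = 0
  · simp [fA, h]
  · rw [fA, abs_mul, abs_mul, abs_of_pos (Real.exp_pos _), abs_of_nonneg (Nat.cast_nonneg (mm a))]
    have e1 : Real.exp (-|u|) ≤ 1 := by rw [Real.exp_le_one_iff]; simp
    have e2 := (Complex.abs_re_le_norm _).trans (gA_bound h u)
    have : Real.exp (-|u|) * |(gA a u).re| ≤ 1 * (2 * ‖cc a‖) :=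
      mul_le_mul e1 e2 (abs_nonneg _) zero_le_one
    have hm : (0:ℝ) ≤ mm a := Nat.cast_nonneg _
    nlinarith

theorem int_cexp {b : ℂ} (hb : 0 < b.re) : ∫ u in Set.Ioi (0:ℝ), cexp (-b*u) = 1/b := by
  have hb' : b ≠ 0 := by rintro rfl; simp at hb
  rw [integral_exp_mul_complex_Ioi (by simpa using hb)]
  simp

theorem fA_int (a : ℂ) (β : ℝ) (hβ : 0 < β) : ∫ u in Set.Ioi (0:ℝ), Real.exp (-β*u) * fA a u
    = (((mm a:ℂ) * ((((β+2:ℝ):ℂ)-1/2)/((((β+2:ℝ):ℂ)-1/2)^2-a^2))).re) / ((β+1)*(β+2)) := by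
  by_cases h : mm a = 0
  · simp [fA, h]
  have hs := mm_strip h
  rw [abs_lt] at hs
  have e : ∀ u ∈ Set.Ioi (0:ℝ), Real.exp (-β*u) * fA a u = (mm a:ℝ) *
      (RCLike.re ((cc a/2) * ((cexp (-(β+1:ℂ)*u) + cexp (-(β+2:ℂ)*u)) - (cexp (-(β+3/2-a:ℂ)*u) + cexp (-(β+3/2+a:ℂ)*u))))) := by
    intro u hu
    have hu' : 0 < u := hu
    rw [fA, gA, abs_of_pos hu']
    have e2 : (cc a/2) * ((cexp (-(β+1:ℂ)*u) + cexp (-(β+2:ℂ)*u)) - (cexp (-(β+3/2-a:ℂ)*u) + cexp (-(β+3/2+a:ℂ)*u)))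
       = ((Real.exp (-β*u) * Real.exp (-u) : ℝ):ℂ) * (cc a * ((1 + cexp (-1*(u:ℝ)))/2 - (cexp (-(1/2-a)*(u:ℝ)) + cexp (-(1/2+a)*(u:ℝ)))/2)) := by
      push_cast
      rw [show -(β+1:ℂ)*u = -β*u + -u by ring, show -(β+2:ℂ)*u = -β*u + -u + (-1*u) by ring,
        show -(β+3/2-a:ℂ)*u = -β*u + -u + (-(1/2-a)*u) by ring,
        show -(β+3/2+a:ℂ)*u = -β*u + -u + (-(1/2+a)*u) by ring]
      simp only [Complex.exp_add]
      ring
    rw [e2]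
    simp only [RCLike.re_eq_complex_re]
    rw [Complex.re_ofReal_mul]
    ring
  have i1 : IntegrableOn (fun u:ℝ => cexp (-(β+1:ℂ)*u)) (Set.Ioi 0) :=
    integrableOn_exp_mul_complex_Ioi (by simp; linarith) _
  have i2 : IntegrableOn (fun u:ℝ => cexp (-(β+2:ℂ)*u)) (Set.Ioi 0) :=
    integrableOn_exp_mul_complex_Ioi (by simp; linarith) _
  have i3 : IntegrableOn (fun u:ℝ => cexp (-(β+3/2-a:ℂ)*u)) (Set.Ioi 0) :=
    integrableOn_exp_mul_complex_Ioi (by simp; linarith) _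
  have i4 : IntegrableOn (fun u:ℝ => cexp (-(β+3/2+a:ℂ)*u)) (Set.Ioi 0) :=
    integrableOn_exp_mul_complex_Ioi (by simp; linarith) _
  rw [setIntegral_congr_fun measurableSet_Ioi e, integral_const_mul, integral_re, integral_const_mul,
    integral_sub, integral_add i1 i2, integral_add i3 i4, int_cexp, int_cexp, int_cexp, int_cexp]
  rotate_left
  · simp; linarith
  · simp; linarith
  · simp; linarith
  · simp; linarith
  · exact i1.add i2
  · exact i3.add i4
  · exact ((i1.add i2).sub (i3.add i4)).const_mul _
  have n1 : (β+1:ℂ) ≠ 0 := fun h => by have := congrArg Complex.re h; simp at this; linarith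
  have n2 : (β+2:ℂ) ≠ 0 := fun h => by have := congrArg Complex.re h; simp at this; linarith
  have n3 : (β+3/2-a:ℂ) ≠ 0 := fun h => by have := congrArg Complex.re h; simp at this; linarith
  have n4 : (β+3/2+a:ℂ) ≠ 0 := fun h => by have := congrArg Complex.re h; simp at this; linarith
  have n5 : (1/2-a:ℂ) ≠ 0 := fun h => by have := congrArg Complex.re h; simp at this; linarith
  have n6 : (1/2+a:ℂ) ≠ 0 := fun h => by have := congrArg Complex.re h; simp at this; linarith
  have key : (cc a/2) * ((1/(β+1:ℂ) + 1/(β+2:ℂ)) - (1/(β+3/2-a:ℂ) + 1/(β+3/2+a:ℂ)))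
     = ((1/((β+1)*(β+2)) : ℝ):ℂ) * ((((β+2:ℝ):ℂ)-1/2)/((((β+2:ℝ):ℂ)-1/2)^2-a^2)) := by
    push_cast
    rw [cc, show (1/4 - a^2 : ℂ) = (1/2-a)*(1/2+a) by ring,
      show ((β:ℂ)+2-1/2)^2-a^2 = (β+3/2-a)*(β+3/2+a) by ring]
    rw [show (β+3/2-a:ℂ) = (2*β+3-2*a)/2 by ring, show (β+3/2+a:ℂ) = (2*β+3+2*a)/2 by ring] at *
    have n3' : (2*β+3-2*a:ℂ) ≠ 0 := fun h => n3 (by rw [h]; simp)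
    have n4' : (2*β+3+2*a:ℂ) ≠ 0 := fun h => n4 (by rw [h]; simp)
    rw [show (1/2-a:ℂ) = (1-2*a)/2 by ring, show (1/2+a:ℂ) = (1+2*a)/2 by ring] at *
    have n5' : (1-2*a:ℂ) ≠ 0 := fun h => n5 (by rw [h]; simp)
    have n6' : (1+2*a:ℂ) ≠ 0 := fun h => n6 (by rw [h]; simp)
    field_simp
    ring
  rw [key]
  simp only [RCLike.re_eq_complex_re]
  rw [Complex.re_ofReal_mul, show ((mm a:ℕ):ℂ) = ((mm a:ℝ):ℂ) by simp, Complex.re_ofReal_mul]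
  ring

end PR



namespace PR
open Complex Filter Topology Metric MeasureTheory ArithmeticFunction

noncomputable def Cst : ℝ := 1 + Real.log π / 2 + eulerMascheroniConstant / 2

noncomputable def hX (u : ℝ) : ℝ := ∑' n, fL n u - |u| * Real.exp (-|u|)
  + Cst * (Real.exp (-|u|) * (1 - Real.exp (-|u|))) - ∑' k, fK k u + ∑' a, fA a u

theorem hX_cont : Continuous hX := by
  have h1 := (tsum_laplace fL_cont summable_L2 fL_bound).1
  have h2 := (tsum_laplace fK_cont summable_sqk fK_bound).1
  have h3 := (tsum_laplace fA_cont (summable_cc.mul_left 2) fA_bound).1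
  unfold hX
  fun_prop

theorem abs_exp_le (u : ℝ) : |u| * Real.exp (-|u|) ≤ 1 := by
  have h := Real.add_one_le_exp |u|
  rw [Real.exp_neg, ← div_eq_mul_inv, div_le_one (Real.exp_pos _)]
  linarith

theorem hX_bdd : ∃ B, ∀ u, |hX u| ≤ B := by
  have h1 := (tsum_laplace fL_cont summable_L2 fL_bound).2.1
  have h2 := (tsum_laplace fK_cont summable_sqk fK_bound).2.1
  have h3 := (tsum_laplace fA_cont (summable_cc.mul_left 2) fA_bound).2.1
  refine ⟨∑' n : ℕ, vonMangoldt n * (n:ℝ)^(-(2:ℝ)) + 1 + |Cst| + ∑' k : ℕ, 1/((k:ℝ)+1)^2 + ∑' a, 2 * ((mm a:ℝ) * ‖cc a‖), fun u => ?_⟩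
  · unfold hX
    refine (abs_add_le _ _).trans (add_le_add ((abs_sub _ _).trans (add_le_add ((abs_add_le _ _).trans
      (add_le_add ((abs_sub _ _).trans (add_le_add (h1 u) ?_)) ?_)) (h2 u))) (h3 u))
    · rw [abs_of_nonneg (by positivity)]; exact abs_exp_le u
    · rw [abs_mul]
      have e := Real.exp_pos (-|u|)
      have e1 : Real.exp (-|u|) ≤ 1 := by rw [Real.exp_le_one_iff]; simp
      refine mul_le_of_le_one_right (abs_nonneg _) ?_
      rw [abs_of_nonneg (mul_nonneg e.le (by linarith))]
      nlinarith

theorem int_u (β : ℝ) (hβ : 0 < β) :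
    ∫ u in Set.Ioi (0:ℝ), Real.exp (-β*u) * (|u| * Real.exp (-|u|)) = 1/(β+1)^2 := by
  have h := Real.integral_rpow_mul_exp_neg_mul_Ioi (a := 2) (r := β+1) (by norm_num) (by linarith)
  rw [show (2:ℝ) = 1 + 1 by norm_num, Real.Gamma_add_one one_ne_zero, Real.Gamma_one] at h
  norm_num at h
  rw [← one_div] at h
  rw [← h]
  refine setIntegral_congr_fun measurableSet_Ioi fun u hu => ?_
  change Real.exp (-β*u) * (|u| * Real.exp (-|u|)) = _
  rw [abs_of_pos hu, show -((β+1)*u) = -β*u + -u by ring, Real.exp_add]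
  ring

theorem int_c (β : ℝ) (hβ : 0 < β) :
    ∫ u in Set.Ioi (0:ℝ), Real.exp (-β*u) * (Cst * (Real.exp (-|u|) * (1 - Real.exp (-|u|)))) = Cst/((β+1)*(β+2)) := by
  have e : ∀ u ∈ Set.Ioi (0:ℝ), Real.exp (-β*u) * (Cst * (Real.exp (-|u|) * (1 - Real.exp (-|u|)))) =
      Cst * (Real.exp (-(β+1)*u) - Real.exp (-(β+2)*u)) := by
    intro u hu
    rw [abs_of_pos hu, show -(β+2)*u = -β*u + -u + -u by ring, show -(β+1)*u = -β*u + -u by ring]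
    simp only [Real.exp_add]
    ring
  rw [setIntegral_congr_fun measurableSet_Ioi e, integral_const_mul, integral_sub
    (int_exp_Ioi _ (by linarith)) (int_exp_Ioi _ (by linarith)), int_exp _ _ (by linarith), int_exp _ _ (by linarith)]
  simp only [mul_zero, Real.exp_zero]
  field_simp
  ring

theorem int_five {μ : Measure ℝ} {A B C D E : ℝ → ℝ} (hA : Integrable A μ) (hB : Integrable B μ) (hC : Integrable C μ)
    (hD : Integrable D μ) (hE : Integrable E μ) : ∫ u, (A u - B u + C u - D u + E u) ∂μ =
    ∫ u, A u ∂μ - ∫ u, B u ∂μ + ∫ u, C u ∂μ - ∫ u, D u ∂μ + ∫ u, E u ∂μ := by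
  have h1 : Integrable (fun u => A u - B u) μ := hA.sub hB
  have h2 : Integrable (fun u => A u - B u + C u) μ := h1.add hC
  have h3 : Integrable (fun u => A u - B u + C u - D u) μ := h2.sub hD
  rw [integral_add h3 hE, integral_sub h2 hD, integral_add h1 hC, integral_sub hA hB]

theorem hX_int (β : ℝ) (hβ : 0 < β) : ∫ u in Set.Ioi (0:ℝ), Real.exp (-β*u) * hX u = 0 := by
  obtain ⟨c1, b1, h1⟩ := (tsum_laplace fL_cont summable_L2 fL_bound)
  obtain ⟨c2, b2, h2⟩ := (tsum_laplace fK_cont summable_sqk fK_bound)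
  obtain ⟨c3, b3, h3⟩ := (tsum_laplace fA_cont (summable_cc.mul_left 2) fA_bound)
  have i1 := int_mul_bdd c1 (fun u _ => b1 u) β hβ
  have i2 := int_mul_bdd c2 (fun u _ => b2 u) β hβ
  have i3 := int_mul_bdd c3 (fun u _ => b3 u) β hβ
  have i4 := int_mul_bdd (h := fun u => |u| * Real.exp (-|u|)) (by fun_prop) (B := 1)
    (fun u _ => by rw [abs_of_nonneg (by positivity)]; exact abs_exp_le u) β hβ
  have i5 := int_mul_bdd (h := fun u => Cst * (Real.exp (-|u|) * (1 - Real.exp (-|u|)))) (by fun_prop) (B := |Cst|)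
    (fun u _ => by
      rw [abs_mul]
      have e := Real.exp_pos (-|u|)
      have e1 : Real.exp (-|u|) ≤ 1 := by rw [Real.exp_le_one_iff]; simp
      refine mul_le_of_le_one_right (abs_nonneg _) ?_
      rw [abs_of_nonneg (mul_nonneg e.le (by linarith))]
      nlinarith) β hβ
  have hs : (1:ℝ) < ((β+2:ℝ):ℂ).re := by simp; linarith
  have z1 := Complex.hasSum_re (Zt_hasSum hs)
  simp_rw [term_real, Complex.ofReal_re] at z1
  have v1 : ∫ u in Set.Ioi (0:ℝ), Real.exp (-β*u) * ∑' n, fL n u = (Zt ((β+2:ℝ):ℂ)).re / ((β+1)*(β+2)) := by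
    have h := h1 β hβ
    simp_rw [fL_int _ β hβ] at h
    exact h.unique (z1.div_const _)
  have v2 : ∫ u in Set.Ioi (0:ℝ), Real.exp (-β*u) * ∑' n, fK n u =
      (dg ((β+2)/2+1) + eulerMascheroniConstant) / (2*(β+1)*(β+2)) := by
    have h := h2 β hβ
    simp_rw [fK_int _ β hβ] at h
    refine h.unique (((dg_hasSum (x := (β+2)/2) (by linarith)).div_const _).congr_fun ?_)
    intro k
    have hk : (0:ℝ) ≤ k := Nat.cast_nonneg k
    have : β + 2*k + 4 ≠ 0 := by positivity
    have : β + 1 ≠ 0 := by positivity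
    have : (β+2)/2 + (k+1) ≠ 0 := by positivity
    field_simp
    ring
  have v3 : ∫ u in Set.Ioi (0:ℝ), Real.exp (-β*u) * ∑' a, fA a u = (logDeriv xi ((β+2:ℝ):ℂ)).re / ((β+1)*(β+2)) := by
    have h := h3 β hβ
    simp_rw [fA_int _ β hβ] at h
    have h4 := Complex.hasSum_re (xi_hasSum ((β+2:ℝ):ℂ) (xi_ne_zero _ hs.le))
    exact h.unique (h4.div_const _)
  have e : ∀ u, Real.exp (-β*u) * hX u = Real.exp (-β*u) * ∑' n, fL n u - Real.exp (-β*u) * (|u| * Real.exp (-|u|))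
     + Real.exp (-β*u) * (Cst * (Real.exp (-|u|) * (1 - Real.exp (-|u|)))) - Real.exp (-β*u) * ∑' k, fK k u
     + Real.exp (-β*u) * ∑' a, fA a u := fun u => by rw [hX]; ring
  simp_rw [e]
  rw [int_five i1 i4 i5 i2 i3, v1, v2, v3, int_u β hβ, int_c β hβ, Zt_re hs]
  have e2 : (1/(((β+2:ℝ):ℂ)-1)).re = 1/(β+1) := by
    rw [show 1/(((β+2:ℝ):ℂ)-1) = ((1/(β+1) : ℝ):ℂ) by push_cast; ring_nf, Complex.ofReal_re]
  have e3 : (((β+2:ℝ):ℂ)/2+1) = (((β+2)/2+1 : ℝ) : ℂ) := by push_cast; ring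
  rw [e2, e3, digamma_re_real (by positivity), Cst]
  field_simp
  ring

theorem hX_zero {u : ℝ} (hu : 0 < u) : hX u = 0 := by
  obtain ⟨B, hB⟩ := hX_bdd
  exact laplace_uniq hX_cont (fun u _ => hB u) (fun n => hX_int _ (by positivity)) u hu

end PR



namespace PR
open Complex Filter Topology Metric MeasureTheory ArithmeticFunction

/-- zero part -/
noncomputable def zc (a : ℂ) (u : ℝ) : ℂ := cc a * ((cexp (-1*(u:ℝ)))/2 - (cexp (-(1/2-a)*(u:ℝ)) + cexp (-(1/2+a)*(u:ℝ)))/2)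

noncomputable def Tinf : ℝ := -Cst + ∑' k : ℕ, 1/((2*(k:ℝ)+2)*(2*k+3)) - ∑' a : ℂ, (mm a:ℝ) * (cc a/2).re

noncomputable def JM (M : ℕ) (u : ℝ) : ℝ :=
  Tinf + u - ∑ n ∈ range M, vonMangoldt n * max (1/(n:ℝ) - Real.exp (-u)) 0

theorem fL_tsum {M : ℕ} {u : ℝ} (hu : 0 < u) (hM : Real.exp u ≤ M) :
    ∑' n, fL n u = Real.exp (-u) * ∑ n ∈ range M, vonMangoldt n * max (1/(n:ℝ) - Real.exp (-u)) 0 := by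
  rw [tsum_eq_sum (s := range M), Finset.mul_sum]
  · refine Finset.sum_congr rfl fun n _ => ?_
    rw [fL, abs_of_pos hu]; ring
  · intro n hn
    simp only [Finset.mem_range, not_lt] at hn
    have h1 : Real.exp u ≤ n := hM.trans (by exact_mod_cast hn)
    have : 1/(n:ℝ) ≤ Real.exp (-u) := by
      rw [Real.exp_neg, one_div]; exact inv_anti₀ (Real.exp_pos _) h1
    rw [fL, abs_of_pos hu, max_eq_right (by linarith)]; simp

theorem summable_k : Summable (fun k : ℕ => 1/((2*(k:ℝ)+2)*(2*k+3))) := by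
  refine Summable.of_nonneg_of_le (fun k => by positivity) (fun k => ?_) summable_sqk
  apply one_div_le_one_div_of_le (by positivity)
  nlinarith [(Nat.cast_nonneg k : (0:ℝ) ≤ k)]

theorem summable_re {f : ℂ → ℂ} {C : ℝ} (hf : ∀ a, mm a ≠ 0 → ‖f a‖ ≤ C * ‖cc a‖) :
    Summable (fun a => (mm a:ℝ) * (f a).re) := by
  refine Summable.of_norm_bounded (summable_cc.mul_left C) fun a => ?_
  by_cases h : mm a = 0
  · simp [h]
  · rw [norm_mul, Real.norm_eq_abs, Real.norm_eq_abs, abs_of_nonneg (Nat.cast_nonneg (mm a))]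
    have := (Complex.abs_re_le_norm (f a)).trans (hf a h)
    have hm : (0:ℝ) ≤ mm a := Nat.cast_nonneg _
    nlinarith

theorem zc_bound {a : ℂ} (h : mm a ≠ 0) {u : ℝ} (hu : 0 < u) : ‖zc a u‖ ≤ ‖cc a‖ * (Real.exp (-u)/2
    + (Real.exp (-(1/2-|a.re|)*u) + Real.exp (-(1/2+|a.re|)*u))/2) := by
  rw [zc, norm_mul]
  refine mul_le_mul_of_nonneg_left ?_ (norm_nonneg _)
  refine (norm_sub_le _ _).trans ?_
  rw [norm_div, norm_div]
  have h5 := norm_add_le (cexp (-(1/2-a)*(u:ℝ))) (cexp (-(1/2+a)*(u:ℝ)))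
  have : ‖(2:ℂ)‖ = 2 := by simp
  rw [this]
  have e1 : ‖cexp (-1*(u:ℝ))‖ = Real.exp (-u) := by rw [Complex.norm_exp]; simp
  have e2 : ‖cexp (-(1/2-a)*(u:ℝ))‖ = Real.exp (-(1/2-a.re)*u) := by rw [Complex.norm_exp]; simp
  have e3 : ‖cexp (-(1/2+a)*(u:ℝ))‖ = Real.exp (-(1/2+a.re)*u) := by rw [Complex.norm_exp]; simp
  rw [e2, e3] at h5
  rw [e1]
  rcases abs_cases a.re with ⟨h6, _⟩ | ⟨h6, _⟩
  · rw [h6]; linarith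
  · rw [h6]
    rw [show (1/2 - -a.re) = 1/2+a.re by ring, show (1/2 + -a.re) = 1/2-a.re by ring]; linarith

theorem expsum_le {b u : ℝ} (hb : |b| < 1/2) (hu : 0 < u) :
    Real.exp (-(1/2-b)*u) + Real.exp (-(1/2+b)*u) ≤ 1 + Real.exp (-u) := by
  rw [abs_lt] at hb
  have h1 : Real.exp (-(1/2-b)*u) ≤ 1 := by rw [Real.exp_le_one_iff]; nlinarith
  have h2 : Real.exp (-(1/2+b)*u) ≤ 1 := by rw [Real.exp_le_one_iff]; nlinarith
  have h3 : Real.exp (-u) = Real.exp (-(1/2-b)*u) * Real.exp (-(1/2+b)*u) := by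
    rw [← Real.exp_add]; ring_nf
  rw [h3]
  nlinarith

theorem JM_eq {M : ℕ} {u : ℝ} (hu : 0 < u) (hM : Real.exp u ≤ M) :
    JM M u = -Cst * Real.exp (-u) + ∑' k : ℕ, Real.exp (-(2*k+3)*u) * (1/((2*(k:ℝ)+2)*(2*k+3)))
      + ∑' a : ℂ, (mm a:ℝ) * (zc a u).re := by
  have h := hX_zero hu
  rw [hX, fL_tsum hu hM, abs_of_pos hu] at h
  have e1 : ∑' k, fK k u = Real.exp (-u) * (∑' k : ℕ, 1/((2*(k:ℝ)+2)*(2*k+3))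
     - ∑' k : ℕ, Real.exp (-(2*k+3)*u) * (1/((2*(k:ℝ)+2)*(2*k+3)))) := by
    rw [← Summable.tsum_sub summable_k, ← tsum_mul_left]
    · refine tsum_congr fun k => ?_
      rw [fK, abs_of_pos hu]; ring
    · refine Summable.of_nonneg_of_le (fun k => by positivity) (fun k => ?_) summable_k
      refine mul_le_of_le_one_left (by positivity) ?_
      rw [Real.exp_le_one_iff]
      have : 0 ≤ (2*(k:ℝ)+3)*u := by positivity
      linarith
  have e2 : ∑' a, fA a u = Real.exp (-u) * (∑' a : ℂ, (mm a:ℝ) * (cc a/2).re + ∑' a : ℂ, (mm a:ℝ) * (zc a u).re) := by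
    rw [← Summable.tsum_add, ← tsum_mul_left]
    · refine tsum_congr fun a => ?_
      rw [fA, gA, abs_of_pos hu]
      have : cc a * ((1 + cexp (-1*(u:ℝ)))/2 - (cexp (-(1/2-a)*(u:ℝ)) + cexp (-(1/2+a)*(u:ℝ)))/2) = cc a/2 + zc a u := by
        rw [zc]; ring
      rw [this, Complex.add_re]; ring
    · refine summable_re (C := 1/2) fun a _ => ?_
      rw [norm_div]; simp; linarith
    · refine summable_re (C := 2) fun a ha => ?_
      refine (zc_bound ha hu).trans ?_
      have := expsum_le (b := |a.re|) (by rw [abs_abs]; exact mm_strip ha) hu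
      have e1 : Real.exp (-u) ≤ 1 := by rw [Real.exp_le_one_iff]; linarith
      have := norm_nonneg (cc a)
      nlinarith
  rw [e1, e2] at h
  have hp := Real.exp_pos (-u)
  have h3 : Real.exp (-u) * (JM M u - (-Cst * Real.exp (-u) + ∑' k : ℕ, Real.exp (-(2*k+3)*u) * (1/((2*(k:ℝ)+2)*(2*k+3)))
      + ∑' a : ℂ, (mm a:ℝ) * (zc a u).re)) = 0 := by
    rw [JM, Tinf]
    linear_combination -h
  rcases mul_eq_zero.1 h3 with h4 | h4
  · exact absurd h4 hp.ne'
  · linarith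

theorem JM_bound {M : ℕ} {u : ℝ} (hu : 0 < u) (hM : Real.exp u ≤ M) {D : ℝ}
    (hD : ∀ S : Finset ℂ, ∑ a ∈ S, (mm a:ℝ) * ‖cc a‖ * ((Real.exp (-(1/2-|a.re|)*u) + Real.exp (-(1/2+|a.re|)*u))/2) ≤ D) :
    |JM M u| ≤ 2 * Real.exp (-u) + D := by
  rw [JM_eq hu hM]
  have hp := Real.exp_pos (-u)
  have h1 : |∑' a : ℂ, (mm a:ℝ) * (zc a u).re| ≤ 0.0238 * Real.exp (-u) + D := by
    have hsD : Summable (fun a => (mm a:ℝ) * ‖cc a‖ * ((Real.exp (-(1/2-|a.re|)*u) + Real.exp (-(1/2+|a.re|)*u))/2)) :=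
      summable_of_sum_le (fun a => by positivity) hD
    have hs : Summable (fun a => (Real.exp (-u)/2) * ((mm a:ℝ) * ‖cc a‖) +
      (mm a:ℝ) * ‖cc a‖ * ((Real.exp (-(1/2-|a.re|)*u) + Real.exp (-(1/2+|a.re|)*u))/2)) :=
      (summable_cc.mul_left _).add hsD
    have h2 := tsum_of_norm_bounded (f := fun a : ℂ => (mm a:ℝ) * (zc a u).re) hs.hasSum (fun a => by
      by_cases h : mm a = 0
      · simp [h]
      · rw [norm_mul, Real.norm_eq_abs, Real.norm_eq_abs, abs_of_nonneg (Nat.cast_nonneg (mm a))]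
        have h3 := (Complex.abs_re_le_norm (zc a u)).trans (zc_bound h hu)
        have hm : (0:ℝ) ≤ mm a := Nat.cast_nonneg _
        have := mul_le_mul_of_nonneg_left h3 hm
        linarith)
    rw [(summable_cc.mul_left _).tsum_add hsD, tsum_mul_left, Real.norm_eq_abs] at h2
    have h3 := hsD.tsum_le_of_sum_le hD
    have h4 := tsum_cc
    nlinarith
  have h2 : 0 ≤ ∑' k : ℕ, Real.exp (-(2*k+3)*u) * (1/((2*(k:ℝ)+2)*(2*k+3))) := tsum_nonneg fun k => by positivity
  have h3 : ∑' k : ℕ, Real.exp (-(2*k+3)*u) * (1/((2*(k:ℝ)+2)*(2*k+3))) ≤ Real.exp (-u) * ∑' k : ℕ, 1/((2*(k:ℝ)+2)*(2*k+3)) := by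
    rw [← tsum_mul_left]
    have hle : ∀ k : ℕ, Real.exp (-(2*k+3)*u) * (1/((2*(k:ℝ)+2)*(2*k+3))) ≤ Real.exp (-u) * (1/((2*(k:ℝ)+2)*(2*k+3))) := by
      intro k
      refine mul_le_mul_of_nonneg_right (Real.exp_le_exp.2 ?_) (by positivity)
      have : 0 ≤ (2*(k:ℝ)+2)*u := by positivity
      linarith
    exact Summable.tsum_le_tsum hle (Summable.of_nonneg_of_le (fun k => by positivity) hle (summable_k.mul_left _)) (summable_k.mul_left _)
  have h4 : ∑' k : ℕ, 1/((2*(k:ℝ)+2)*(2*k+3)) ≤ 1/2 := by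
    refine Real.tsum_le_of_sum_range_le (fun k => by positivity) fun n => ?_
    have : ∀ n : ℕ, ∑ k ∈ range n, 1/((2*(k:ℝ)+2)*(2*k+3)) ≤ 1/2 - 1/(4*(n:ℝ)+2) := by
      intro n
      induction n with
      | zero => norm_num
      | succ n ih =>
        rw [Finset.sum_range_succ]
        have : 1/((2*(n:ℝ)+2)*(2*n+3)) ≤ 1/(4*(n:ℝ)+2) - 1/(4*((n+1:ℕ):ℝ)+2) := by
          push_cast
          rw [div_sub_div _ _ (by positivity) (by positivity), div_le_div_iff₀ (by positivity) (by positivity)]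
          nlinarith [(Nat.cast_nonneg n : (0:ℝ) ≤ n)]
        linarith
    have := this n
    have h5 : (0:ℝ) ≤ 1/(4*(n:ℝ)+2) := by positivity
    linarith
  have hC : 0 ≤ Cst ∧ Cst ≤ 1.9 := by
    have := gamma_bounds; have := log_pi_bounds
    constructor <;> unfold Cst <;> linarith
  rw [abs_le] at h1 ⊢
  have := hC.1; have := hC.2
  constructor <;> nlinarith

theorem JM_const {M : ℕ} {u : ℝ} (hu : 0 < u) (hM : Real.exp u ≤ M) :
    |JM M u| ≤ 0.0238 + 2.0238 * Real.exp (-u) := by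
  have hp := Real.exp_pos (-u)
  have := JM_bound hu hM (D := 0.0238 * (1 + Real.exp (-u))) (fun S => by
    have h1 : ∑ a ∈ S, (mm a:ℝ) * ‖cc a‖ ≤ 0.0476 :=
      (summable_cc.sum_le_tsum S (fun a _ => by positivity)).trans tsum_cc
    have h2 : ∑ a ∈ S, (mm a:ℝ) * ‖cc a‖ * ((Real.exp (-(1/2-|a.re|)*u) + Real.exp (-(1/2+|a.re|)*u))/2) ≤
       ∑ a ∈ S, (mm a:ℝ) * ‖cc a‖ * ((1 + Real.exp (-u))/2) := by
      refine Finset.sum_le_sum fun a _ => ?_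
      by_cases h : mm a = 0
      · simp [h]
      · have := expsum_le (b := |a.re|) (by rw [abs_abs]; exact mm_strip h) hu
        exact mul_le_mul_of_nonneg_left (by linarith) (by positivity)
    rw [← Finset.sum_mul] at h2
    nlinarith)
  linarith

theorem u_exp_le {η u : ℝ} (hη : 0 < η) : u * Real.exp (-η*u) ≤ 1/η * Real.exp (-1) := by
  have h := Real.add_one_le_exp (η*u - 1)
  have e : Real.exp (-η*u) = Real.exp (-1) * (Real.exp (η*u-1))⁻¹ := by
    rw [← Real.exp_neg, ← Real.exp_add]; ring_nf
  rw [e]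
  have h2 : u ≤ 1/η * Real.exp (η*u-1) := by
    rw [one_div, inv_mul_eq_div, le_div_iff₀ hη]; linarith
  calc u * (Real.exp (-1) * (Real.exp (η*u-1))⁻¹) = (u * (Real.exp (η*u-1))⁻¹) * Real.exp (-1) := by ring
    _ ≤ _ := by
      refine mul_le_mul_of_nonneg_right ?_ (Real.exp_pos _).le
      rw [← div_eq_mul_inv, div_le_iff₀ (Real.exp_pos _)]; exact h2

theorem JM_zfr {M : ℕ} {u : ℝ} (hu : 0 < u) (hM : Real.exp u ≤ M) :
    u * |JM M u| ≤ 0.7783 + 2 * (u * Real.exp (-u)) := by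
  have he : Real.exp (-1) ≤ 0.36788 := by
    have := Real.exp_one_gt_d9
    rw [Real.exp_neg]
    refine inv_le_of_inv_le₀ (by norm_num) ?_
    refine le_trans ?_ this.le
    norm_num
  have := JM_bound hu hM (D := 0.7783/u) (fun S => by
    have h2 : ∑ a ∈ S, (mm a:ℝ) * ‖cc a‖ * ((Real.exp (-(1/2-|a.re|)*u) + Real.exp (-(1/2+|a.re|)*u))/2) ≤
       ∑ a ∈ S, (mm a:ℝ) * ‖cc a‖ * (1/(1/2-|a.re|)+2) * (Real.exp (-1)/2/u) := by
      refine Finset.sum_le_sum fun a _ => ?_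
      by_cases h : mm a = 0
      · simp [h]
      · rw [mul_assoc ((mm a:ℝ) * ‖cc a‖) (1/(1/2-|a.re|)+2)]
        refine mul_le_mul_of_nonneg_left ?_ (by positivity)
        have hs := mm_strip h
        have h3 := u_exp_le (u := u) (η := 1/2-|a.re|) (by linarith)
        have h4 := u_exp_le (u := u) (η := 1/2+|a.re|) (by positivity)
        have h5 : 1/(1/2+|a.re|) ≤ 2 := by
          rw [div_le_iff₀ (by positivity)]; have := abs_nonneg a.re; linarith
        have h6 := Real.exp_pos (-1)
        rw [div_div, ← mul_div_assoc, le_div_iff₀ (by positivity)]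
        nlinarith
    rw [← Finset.sum_mul] at h2
    refine h2.trans ((mul_le_mul_of_nonneg_right (tsum_eta S) (by positivity)).trans ?_)
    rw [← mul_div_assoc]
    refine div_le_div_of_nonneg_right ?_ hu.le
    linarith)
  have h7 := mul_le_mul_of_nonneg_left this hu.le
  refine h7.trans (le_of_eq ?_)
  field_simp
  ring

end PR



namespace PR
open Complex Filter Topology Metric MeasureTheory ArithmeticFunction

noncomputable def ww (u : ℝ) : ℝ := 1/u + 1/u^2
noncomputable def dw (u : ℝ) : ℝ := -(1/u^2) - 2/u^3

theorem ww_deriv {u : ℝ} (hu : 0 < u) : HasDerivAt ww (dw u) u := by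
  have h1 : HasDerivAt (fun u : ℝ => u⁻¹) (-(u^2)⁻¹) u := hasDerivAt_inv hu.ne'
  have h2 := h1.add (h1.mul h1)
  refine (h2.congr_deriv ?_).congr_of_eventuallyEq ?_
  · rw [dw]; field_simp; ring
  · filter_upwards with t
    simp [ww, sq]

noncomputable def phi (n : ℕ) (u : ℝ) : ℝ :=
  if u ≤ Real.log n then 0 else 1/(n * Real.log n) - Real.exp (-u)/u - (1/n - Real.exp (-u)) * ww u

theorem phi_deriv {n : ℕ} (hn : 2 ≤ n) {u : ℝ} (hu : 0 < u) :
    HasDerivAt (phi n) (-(max (1/(n:ℝ) - Real.exp (-u)) 0 * dw u)) u := by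
  have hn' : (2:ℝ) ≤ n := by exact_mod_cast hn
  have hl : 0 < Real.log n := Real.log_pos (by linarith)
  set f : ℝ → ℝ := fun u => 1/(n * Real.log n) - Real.exp (-u)/u - (1/n - Real.exp (-u)) * ww u with hf
  have hfd : HasDerivAt f (-((1/(n:ℝ) - Real.exp (-u)) * dw u)) u := by
    have h1 : HasDerivAt (fun u : ℝ => Real.exp (-u)) (Real.exp (-u) * (-1)) u := (hasDerivAt_neg u).exp
    have h2 := ((h1.div (hasDerivAt_id u) hu.ne').const_sub (1/(n * Real.log n))).sub
      ((h1.const_sub (1/(n:ℝ))).mul (ww_deriv hu))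
    refine h2.congr_deriv ?_
    simp only [id]
    rw [ww]
    field_simp
    ring
  have hexp : Real.exp (-Real.log n) = 1/n := by
    rw [Real.exp_neg, Real.exp_log (by linarith), one_div]
  rcases lt_trichotomy u (Real.log n) with h | h | h
  · have : Real.exp (-u) ≥ 1/n := by rw [← hexp]; exact Real.exp_le_exp.2 (by linarith)
    rw [max_eq_right (by linarith)]
    simp only [zero_mul, neg_zero]
    refine (hasDerivAt_const u (0:ℝ)).congr_of_eventuallyEq ?_
    filter_upwards [Iio_mem_nhds h] with t ht
    simp only [phi, if_pos (le_of_lt (Set.mem_Iio.1 ht))]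
  · have h0 : 1/(n:ℝ) - Real.exp (-u) = 0 := by rw [h, hexp]; ring
    rw [h0] at hfd ⊢
    simp only [max_self, zero_mul, neg_zero] at hfd ⊢
    have hfu : f u = 0 := by
      simp only [hf, h0]; rw [h, hexp]; field_simp; ring
    have hz : phi n u = 0 := by simp [phi, h]
    rw [← hasDerivWithinAt_univ, ← Set.Iic_union_Ici (a := u)]
    refine HasDerivWithinAt.union ?_ ?_
    · refine (hasDerivWithinAt_const u _ (0:ℝ)).congr (fun t ht => ?_) hz
      have : t ≤ u := ht
      simp [phi, this.trans h.le]
    · refine hfd.hasDerivWithinAt.congr (fun t ht => ?_) (by rw [hz, hfu])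
      have ht' : u ≤ t := ht
      rcases eq_or_lt_of_le ht' with h1 | h1
      · rw [← h1, hz, hfu]
      · simp only [phi, hf, if_neg (not_le.2 (h ▸ h1))]
  · have : Real.exp (-u) ≤ 1/n := by rw [← hexp]; exact Real.exp_le_exp.2 (by linarith)
    rw [max_eq_left (by linarith)]
    refine hfd.congr_of_eventuallyEq ?_
    filter_upwards [Ioi_mem_nhds h] with t ht
    simp only [phi, hf, if_neg (not_le.2 (Set.mem_Ioi.1 ht))]

noncomputable def Th (M : ℕ) (u : ℝ) : ℝ :=
  ∑ n ∈ range M, vonMangoldt n * phi n u + 1/u - Real.log u + (Tinf + u) * ww u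

theorem Th_deriv (M : ℕ) {u : ℝ} (hu : 0 < u) : HasDerivAt (Th M) (JM M u * dw u) u := by
  have h1 : HasDerivAt (fun u => ∑ n ∈ range M, vonMangoldt n * phi n u)
     (∑ n ∈ range M, vonMangoldt n * (-(max (1/(n:ℝ) - Real.exp (-u)) 0 * dw u))) u := by
    refine HasDerivAt.fun_sum fun n _ => ?_
    rcases Nat.lt_or_ge n 2 with h | h
    · have : vonMangoldt n = 0 := by interval_cases n <;> simp
      simp only [this, zero_mul]
      exact hasDerivAt_const _ _
    · exact (phi_deriv h hu).const_mul _
  have h2 : HasDerivAt (fun u : ℝ => 1/u) (-(u^2)⁻¹) u := by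
    simpa only [one_div] using hasDerivAt_inv hu.ne'
  have h3 := ((h1.add h2).sub (Real.hasDerivAt_log hu.ne')).add (((hasDerivAt_id u).const_add Tinf).mul (ww_deriv hu))
  refine h3.congr_deriv ?_
  have h4 : ∑ n ∈ range M, vonMangoldt n * (-(max (1/(n:ℝ) - Real.exp (-u)) 0 * dw u)) =
      -(∑ n ∈ range M, vonMangoldt n * max (1/(n:ℝ) - Real.exp (-u)) 0) * dw u := by
    rw [← Finset.sum_neg_distrib, Finset.sum_mul]
    exact Finset.sum_congr rfl fun n _ => by ring
  rw [h4, JM]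
  simp only [id]
  rw [ww]
  field_simp
  ring

noncomputable def PP (x : ℝ) : ℝ := ∑ n ∈ Finset.Ioc 0 ⌊x⌋₊, vonMangoldt n / (n * Real.log n)

noncomputable def VV (u : ℝ) : ℝ :=
  PP (Real.exp u) - Real.exp (-u)/u * (Chebyshev.psi (Real.exp u) - Real.exp u) - Real.log u

theorem VV_eq {M : ℕ} {u : ℝ} (hu : 0 < u) (hM : Real.exp u < M) : VV u = Th M u - JM M u * ww u := by
  have hsub : Finset.Ioc 0 ⌊Real.exp u⌋₊ ⊆ range M := by
    intro n hn
    simp only [Finset.mem_Ioc, Finset.mem_range] at hn ⊢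
    have h1 := (Nat.le_floor_iff (Real.exp_pos u).le).1 hn.2
    exact_mod_cast h1.trans_lt hM
  have h1 : ∑ n ∈ range M, vonMangoldt n * (phi n u + max (1/(n:ℝ) - Real.exp (-u)) 0 * ww u)
     = ∑ n ∈ Finset.Ioc 0 ⌊Real.exp u⌋₊, vonMangoldt n * (1/(n * Real.log n) - Real.exp (-u)/u) := by
    symm
    rw [← Finset.sum_subset hsub]
    · refine Finset.sum_congr rfl fun n hn => ?_
      rcases Nat.lt_or_ge n 2 with h | h
      · have : vonMangoldt n = 0 := by interval_cases n <;> simp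
        simp [this]
      · congr 1
        have hn' : (2:ℝ) ≤ n := by exact_mod_cast h
        have h2 := (Nat.le_floor_iff (Real.exp_pos u).le).1 (Finset.mem_Ioc.1 hn).2
        have h3 : Real.exp (-u) ≤ 1/n := by
          rw [Real.exp_neg, one_div]; exact inv_anti₀ (by linarith) h2
        rw [max_eq_left (by linarith), phi]
        split_ifs with h4
        · have h5 : u = Real.log n := le_antisymm h4 ((Real.log_le_iff_le_exp (by linarith)).2 h2)
          have h6 : Real.exp (-u) = 1/n := by rw [h5, Real.exp_neg, Real.exp_log (by linarith), one_div]
          have : 0 < Real.log n := h5 ▸ hu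
          rw [h6, h5]; field_simp; ring
        · ring
    · intro n hn hn2
      simp only [Finset.mem_Ioc, not_and, not_le] at hn2
      rcases Nat.lt_or_ge n 2 with h | h
      · have : vonMangoldt n = 0 := by interval_cases n <;> simp
        simp [this]
      · have hn' : (2:ℝ) ≤ n := by exact_mod_cast h
        have h2 := (Nat.floor_lt (Real.exp_pos u).le).1 (hn2 (by omega))
        have h3 : 1/n ≤ Real.exp (-u) := by
          rw [Real.exp_neg, one_div]; exact inv_anti₀ (Real.exp_pos u) h2.le
        rw [max_eq_right (by linarith), phi, if_pos ((Real.lt_log_iff_exp_lt (by linarith)).2 h2).le]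
        simp
  have h2 : ∑ n ∈ range M, vonMangoldt n * (phi n u + max (1/(n:ℝ) - Real.exp (-u)) 0 * ww u)
    = ∑ n ∈ range M, vonMangoldt n * phi n u + (∑ n ∈ range M, vonMangoldt n * max (1/(n:ℝ) - Real.exp (-u)) 0) * ww u := by
    rw [Finset.sum_mul, ← Finset.sum_add_distrib]
    exact Finset.sum_congr rfl fun n _ => by ring
  have h3 : ∑ n ∈ Finset.Ioc 0 ⌊Real.exp u⌋₊, vonMangoldt n * (1/(n * Real.log n) - Real.exp (-u)/u)
     = PP (Real.exp u) - Real.exp (-u)/u * Chebyshev.psi (Real.exp u) := by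
    rw [PP, Chebyshev.psi, Finset.mul_sum, ← Finset.sum_sub_distrib]
    exact Finset.sum_congr rfl fun n _ => by ring
  rw [h2, h3] at h1
  rw [VV, Th, JM]
  have e : Real.exp (-u)/u * Real.exp u = 1/u := by
    rw [div_mul_eq_mul_div, ← Real.exp_add]; simp
  rw [mul_sub, e]
  linear_combination -h1

theorem Th_diff {M : ℕ} {u1 u2 : ℝ} (h1 : 0 < u1) (h12 : u1 ≤ u2) {Q Q' : ℝ → ℝ}
    (hQ : ∀ t, 0 < t → HasDerivAt Q (Q' t) t)
    (hb : ∀ t, u1 ≤ t → t ≤ u2 → |JM M t * dw t| ≤ -Q' t) :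
    |Th M u2 - Th M u1| ≤ Q u1 - Q u2 := by
  have key : ∀ σ : ℝ, (σ = 1 ∨ σ = -1) → Q u2 + σ * Th M u2 ≤ Q u1 + σ * Th M u1 := by
    intro σ hσ
    have hd : ∀ t, 0 < t → HasDerivAt (fun t => Q t + σ * Th M t) (Q' t + σ * (JM M t * dw t)) t :=
      fun t ht => (hQ t ht).add ((Th_deriv M ht).const_mul σ)
    have := antitoneOn_of_deriv_nonpos (f := fun t => Q t + σ * Th M t) (convex_Icc u1 u2)
      (fun t ht => (hd t (h1.trans_le ht.1)).continuousAt.continuousWithinAt)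
      (fun t ht => by
        rw [interior_Icc] at ht
        exact (hd t (h1.trans ht.1)).differentiableAt.differentiableWithinAt)
      (fun t ht => by
        rw [interior_Icc] at ht
        rw [(hd t (h1.trans ht.1)).deriv]
        have h3 := abs_le.1 (hb t ht.1.le ht.2.le)
        rcases hσ with rfl | rfl <;> linarith [h3.1, h3.2])
    exact this ⟨le_rfl, h12⟩ ⟨h12, le_rfl⟩ h12
  have k1 := key 1 (Or.inl rfl)
  have k2 := key (-1) (Or.inr rfl)
  rw [abs_le]; constructor <;> linarith

theorem dw_abs {t : ℝ} (ht : 0 < t) : |dw t| = 1/t^2 + 2/t^3 := by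
  rw [dw, abs_of_nonpos]
  · ring
  · have : 0 < 1/t^2 := by positivity
    have : 0 < 2/t^3 := by positivity
    linarith

theorem exp_neg_ten : Real.exp (-10) ≤ 0.00005 := by
  have h := Real.exp_one_gt_d9
  have h2 : Real.exp (-10) = (Real.exp 1 ^ 10)⁻¹ := by rw [Real.exp_neg, ← Real.exp_nat_mul]; norm_num
  rw [h2]
  refine inv_le_of_inv_le₀ (by norm_num) ?_
  calc ((0.00005:ℝ))⁻¹ ≤ 2.7^10 := by norm_num
    _ ≤ _ := pow_le_pow_left₀ (by norm_num) (by linarith) 10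

theorem JM_c {M : ℕ} {u : ℝ} (hu : 10 ≤ u) (hM : Real.exp u ≤ M) : |JM M u| ≤ 0.02391 := by
  have h := JM_const (by linarith) hM
  have : Real.exp (-u) ≤ Real.exp (-10) := Real.exp_le_exp.2 (by linarith)
  have := exp_neg_ten
  linarith

theorem JM_z {M : ℕ} {u : ℝ} (hu : 20 ≤ u) (hM : Real.exp u ≤ M) : |JM M u| ≤ 0.7784 / u := by
  have h := JM_zfr (by linarith) hM
  have h1 : Real.exp (-u) = Real.exp (-(u/2)) * Real.exp (-(u/2)) := by rw [← Real.exp_add]; ring_nf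
  have h2 : Real.exp (-(u/2)) ≤ Real.exp (-10) := Real.exp_le_exp.2 (by linarith)
  have h3 := exp_neg_ten
  have h4 := u_exp_le (u := u) (η := 1/2) (by norm_num)
  have h5 : Real.exp (-1) ≤ 1 := by rw [Real.exp_le_one_iff]; norm_num
  rw [show -(1/2)*u = -(u/2) by ring] at h4
  have h6 : u * Real.exp (-u) ≤ 0.00005*2 * (Real.exp (-1)) := by
    rw [h1, ← mul_assoc]
    have := Real.exp_pos (-(u/2))
    have := Real.exp_pos (-1)
    have h8 : u * Real.exp (-(u/2)) ≤ 2 * Real.exp (-1) := by linarith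
    nlinarith
  have h7 : Real.exp (-1) ≤ 0.4 := by
    have h := Real.exp_one_gt_d9
    rw [Real.exp_neg]
    refine inv_le_of_inv_le₀ (by norm_num) ?_
    norm_num; linarith
  rw [le_div_iff₀ (by linarith)]
  linarith

noncomputable def Qz (u : ℝ) : ℝ := 0.7784 * (1/(2*u^2) + 2/(3*u^3))

theorem Qz_deriv {u : ℝ} (hu : 0 < u) : HasDerivAt Qz (-(0.7784/u * (1/u^2+2/u^3))) u := by
  have h1 : HasDerivAt (fun u : ℝ => u⁻¹) (-(u^2)⁻¹) u := hasDerivAt_inv hu.ne'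
  have h2 := (((h1.pow 2).const_mul (1/2)).add ((h1.pow 3).const_mul (2/3))).const_mul (0.7784:ℝ)
  refine (h2.congr_deriv ?_).congr_of_eventuallyEq ?_
  · norm_num; field_simp; ring
  · filter_upwards with t
    simp [Qz]; left; ring

theorem Th_c {M : ℕ} {u1 u2 : ℝ} (h1 : 10 ≤ u1) (h12 : u1 ≤ u2) (hM : Real.exp u2 ≤ M) :
    |Th M u2 - Th M u1| ≤ 0.02391 * ww u1 - 0.02391 * ww u2 := by
  refine Th_diff (Q := fun u => 0.02391 * ww u) (by linarith) h12 (fun t ht => (ww_deriv ht).const_mul _) ?_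
  intro t h3 h4
  have := JM_c (h1.trans h3) ((Real.exp_le_exp.2 h4).trans hM)
  rw [abs_mul, dw_abs (by linarith)]
  have : 0 < 1/t^2 + 2/t^3 := by have : 0 < t := by linarith
                                 positivity
  rw [dw]
  nlinarith

theorem Th_z {M : ℕ} {u1 u2 : ℝ} (h1 : 20 ≤ u1) (h12 : u1 ≤ u2) (hM : Real.exp u2 ≤ M) :
    |Th M u2 - Th M u1| ≤ Qz u1 - Qz u2 := by
  refine Th_diff (by linarith) h12 (fun t ht => Qz_deriv ht) ?_
  intro t h3 h4
  have := JM_z (h1.trans h3) ((Real.exp_le_exp.2 h4).trans hM)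
  rw [abs_mul, dw_abs (by linarith)]
  have : 0 < 1/t^2 + 2/t^3 := by have : 0 < t := by linarith
                                 positivity
  nlinarith

end PR



namespace PR
open Complex Filter Topology Metric MeasureTheory ArithmeticFunction

theorem ww_pos {u : ℝ} (hu : 0 < u) : 0 < ww u := by unfold ww; positivity

theorem exists_M (u : ℝ) : ∃ M : ℕ, Real.exp u < M := exists_nat_gt _

theorem VV_diff_c {u1 u2 : ℝ} (h1 : 10 ≤ u1) (h12 : u1 ≤ u2) : |VV u2 - VV u1| ≤ 0.04782 * ww u1 := by
  obtain ⟨M, hM⟩ := exists_M u2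
  have hM1 : Real.exp u1 < M := (Real.exp_le_exp.2 h12).trans_lt hM
  rw [VV_eq (by linarith) hM, VV_eq (by linarith) hM1]
  have a := Th_c h1 h12 hM.le
  have b1 := JM_c h1 hM1.le
  have b2 := JM_c (h1.trans h12) hM.le
  have w1 := ww_pos (u := u1) (by linarith)
  have w2 := ww_pos (u := u2) (by linarith)
  have c1 : |JM M u1 * ww u1| ≤ 0.02391 * ww u1 := by
    rw [abs_mul, abs_of_pos w1]; exact mul_le_mul_of_nonneg_right b1 w1.le
  have c2 : |JM M u2 * ww u2| ≤ 0.02391 * ww u2 := by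
    rw [abs_mul, abs_of_pos w2]; exact mul_le_mul_of_nonneg_right b2 w2.le
  rw [abs_le] at *
  constructor <;> linarith [a.1, a.2, c1.1, c1.2, c2.1, c2.2]

theorem VV_diff_z {u1 u2 : ℝ} (h1 : 20 ≤ u1) (h12 : u1 ≤ u2) :
    |VV u2 - VV u1| ≤ Qz u1 + 0.7784/u1 * ww u1 + 0.02391 * ww u2 := by
  obtain ⟨M, hM⟩ := exists_M u2
  have hM1 : Real.exp u1 < M := (Real.exp_le_exp.2 h12).trans_lt hM
  rw [VV_eq (by linarith) hM, VV_eq (by linarith) hM1]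
  have a := Th_z h1 h12 hM.le
  have b1 := JM_z h1 hM1.le
  have b2 := JM_c (u := u2) (by linarith) hM.le
  have w1 := ww_pos (u := u1) (by linarith)
  have w2 := ww_pos (u := u2) (by linarith)
  have hq : 0 ≤ Qz u2 := by
    have : 0 < u2 := by linarith
    unfold Qz; positivity
  have c1 : |JM M u1 * ww u1| ≤ 0.7784/u1 * ww u1 := by
    rw [abs_mul, abs_of_pos w1]; exact mul_le_mul_of_nonneg_right b1 w1.le
  have c2 : |JM M u2 * ww u2| ≤ 0.02391 * ww u2 := by
    rw [abs_mul, abs_of_pos w2]; exact mul_le_mul_of_nonneg_right b2 w2.le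
  rw [abs_le] at *
  constructor <;> linarith [a.1, a.2, c1.1, c1.2, c2.1, c2.2]

theorem ww_tendsto : Tendsto ww atTop (𝓝 0) := by
  have h1 : Tendsto (fun u : ℝ => u⁻¹) atTop (𝓝 0) := tendsto_inv_atTop_zero
  have := h1.add (h1.mul h1)
  simp only [mul_zero, add_zero] at this
  refine this.congr fun u => ?_
  simp [ww, sq]

theorem VV_tendsto : ∃ V, Tendsto VV atTop (𝓝 V) := by
  have hc : CauchySeq (fun u => VV (max u 10)) := by
    refine cauchySeq_of_le_tendsto_0 (fun N => 2*0.04782 * ww (max N 10)) ?_ ?_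
    · intro n m N hn hm
      have a := VV_diff_c (u1 := max N 10) (u2 := max n 10) (le_max_right _ _) (max_le_max_right _ hn)
      have b := VV_diff_c (u1 := max N 10) (u2 := max m 10) (le_max_right _ _) (max_le_max_right _ hm)
      rw [Real.dist_eq]
      rw [abs_le] at *
      constructor <;> linarith [a.1, a.2, b.1, b.2]
    · have : Tendsto (fun N => ww (max N 10)) atTop (𝓝 0) :=
        ww_tendsto.comp (tendsto_atTop_mono (fun N => le_max_left N 10) tendsto_id)
      simpa using this.const_mul (2*0.04782)
  obtain ⟨V, hV⟩ := cauchySeq_tendsto_of_complete hc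
  refine ⟨V, hV.congr' ?_⟩
  filter_upwards [eventually_ge_atTop 10] with u hu
  rw [max_eq_left hu]

theorem VV_c {V : ℝ} (hV : Tendsto VV atTop (𝓝 V)) {u : ℝ} (hu : 10 ≤ u) : |V - VV u| ≤ 0.04782 * ww u := by
  have h1 : Tendsto (fun t => |VV t - VV u|) atTop (𝓝 |V - VV u|) := (hV.sub_const _).abs
  refine le_of_tendsto h1 ?_
  filter_upwards [eventually_ge_atTop u] with t ht
  exact VV_diff_c hu ht

theorem VV_z {V : ℝ} (hV : Tendsto VV atTop (𝓝 V)) {u : ℝ} (hu : 20 ≤ u) :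
    |V - VV u| ≤ Qz u + 0.7784/u * ww u := by
  have h1 : Tendsto (fun t => |VV t - VV u|) atTop (𝓝 |V - VV u|) := (hV.sub_const _).abs
  have h2 : Tendsto (fun t => Qz u + 0.7784/u * ww u + 0.02391 * ww t) atTop (𝓝 (Qz u + 0.7784/u * ww u + 0.02391 * 0)) :=
    (ww_tendsto.const_mul _).const_add _
  rw [mul_zero, add_zero] at h2
  refine le_of_tendsto_of_tendsto h1 h2 ?_
  filter_upwards [eventually_ge_atTop u] with t ht
  exact VV_diff_z hu ht

theorem PP_tendsto {V : ℝ} (hV : Tendsto VV atTop (𝓝 V)) :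
    Tendsto (fun u => PP (Real.exp u) - Real.log u) atTop (𝓝 V) := by
  have h : Tendsto (fun u => Real.exp (-u)/u * (Chebyshev.psi (Real.exp u) - Real.exp u)) atTop (𝓝 0) := by
    have h1 : Tendsto (fun u : ℝ => (Real.log 4 + 5) * u⁻¹) atTop (𝓝 0) := by
      simpa using tendsto_inv_atTop_zero.const_mul (Real.log 4 + 5)
    refine squeeze_zero_norm' ?_ h1
    filter_upwards [eventually_gt_atTop 0] with u hu
    have h2 := Chebyshev.psi_le_const_mul_self (Real.exp_pos u).le
    have h3 := Chebyshev.psi_nonneg (Real.exp u)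
    have h4 := Real.exp_pos u
    have h5 : 0 ≤ Real.log 4 := Real.log_nonneg (by norm_num)
    rw [norm_mul, Real.norm_eq_abs, Real.norm_eq_abs, abs_of_pos (by positivity)]
    have h6 : |Chebyshev.psi (Real.exp u) - Real.exp u| ≤ (Real.log 4 + 5) * Real.exp u := by
      rw [abs_le]; constructor <;> nlinarith
    calc Real.exp (-u)/u * |Chebyshev.psi (Real.exp u) - Real.exp u| ≤ Real.exp (-u)/u * ((Real.log 4 + 5) * Real.exp u) :=
          mul_le_mul_of_nonneg_left h6 (by positivity)
      _ = _ := by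
        rw [Real.exp_neg]; field_simp
  have := hV.add h
  rw [add_zero] at this
  refine this.congr fun u => ?_
  rw [VV]; ring

/-- Abelian lemma -/
theorem abel_lim {f : ℝ → ℝ} {V : ℝ} (hm : Measurable f)
    (hf : ∀ δ > 0, ∃ K, ∀ u, 0 < u → |f u - V| ≤ δ + K * Real.exp (-u)) :
    Tendsto (fun ε : ℝ => ∫ u in Set.Ioi (0:ℝ), ε * Real.exp (-ε*u) * f u) (𝓝[>] 0) (𝓝 V) := by
  have key : ∀ δ > 0, ∃ K, 0 ≤ K ∧ ∀ ε > 0, |(∫ u in Set.Ioi (0:ℝ), ε * Real.exp (-ε*u) * f u) - V| ≤ δ + K * ε := by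
    intro δ hδ
    obtain ⟨K, hK⟩ := hf δ hδ
    have hK' : ∀ u, 0 < u → |f u - V| ≤ δ + |K| * Real.exp (-1*u) := fun u hu => (hK u hu).trans (by
      have := mul_le_mul_of_nonneg_right (le_abs_self K) (Real.exp_pos (-u)).le
      rw [neg_one_mul]; linarith)
    refine ⟨|K|, abs_nonneg _, fun ε hε => ?_⟩
    have i0 := int_exp_Ioi ε hε
    have i1 := int_exp_Ioi (ε+1) (by linarith)
    have ib : IntegrableOn (fun u => ε * δ * Real.exp (-ε*u) + ε * |K| * Real.exp (-(ε+1)*u)) (Set.Ioi 0) :=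
      (i0.const_mul _).add (i1.const_mul _)
    have hb : ∀ᵐ u ∂(volume.restrict (Set.Ioi (0:ℝ))), ‖ε * Real.exp (-ε*u) * (f u - V)‖ ≤
        ε * δ * Real.exp (-ε*u) + ε * |K| * Real.exp (-(ε+1)*u) := by
      filter_upwards [ae_restrict_mem measurableSet_Ioi] with u hu
      rw [norm_mul, Real.norm_eq_abs, Real.norm_eq_abs, abs_of_pos (by positivity)]
      refine (mul_le_mul_of_nonneg_left (hK' u hu) (by positivity)).trans (le_of_eq ?_)
      rw [show -(ε+1)*u = -ε*u + -1*u by ring, Real.exp_add]; ring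
    have ii : IntegrableOn (fun u => ε * Real.exp (-ε*u) * (f u - V)) (Set.Ioi 0) := by
      refine Integrable.mono' ib ?_ hb
      exact (Measurable.aestronglyMeasurable (by fun_prop))
    have e1 : ∫ u in Set.Ioi (0:ℝ), ε * Real.exp (-ε*u) * f u = (∫ u in Set.Ioi (0:ℝ), ε * Real.exp (-ε*u) * (f u - V)) + V := by
      have : ∀ u, ε * Real.exp (-ε*u) * f u = ε * Real.exp (-ε*u) * (f u - V) + (ε * V) * Real.exp (-ε*u) := fun u => by ring
      simp_rw [this]
      rw [integral_add ii (i0.const_mul _), integral_const_mul, int_exp _ _ hε]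
      congr 1
      simp; field_simp
    rw [e1, add_sub_cancel_right, ← Real.norm_eq_abs]
    refine (norm_integral_le_of_norm_le ib hb).trans ?_
    rw [integral_add (i0.const_mul _) (i1.const_mul _), integral_const_mul, integral_const_mul, int_exp _ _ hε, int_exp _ _ (by linarith)]
    simp only [mul_zero, Real.exp_zero]
    have h1 : ε * δ * (1/ε) = δ := by field_simp
    have h2 : ε * |K| * (1/(ε+1)) ≤ |K| * ε := by
      rw [mul_one_div, div_le_iff₀ (by linarith)]
      have : 0 ≤ |K| * ε * ε := by positivity
      linarith
    linarith
  rw [Metric.tendsto_nhdsWithin_nhds]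
  intro δ hδ
  obtain ⟨K, hK0, hK⟩ := key (δ/2) (by positivity)
  refine ⟨δ/(2*(K+1)), by positivity, fun {ε} hε hd => ?_⟩
  have hε' : 0 < ε := hε
  rw [Real.dist_eq, sub_zero, abs_of_pos hε', lt_div_iff₀ (by positivity)] at hd
  rw [Real.dist_eq]
  have := hK ε hε'
  nlinarith

/-- transform of a step function -/
theorem step_int {b lam : ℕ → ℝ} (hb : ∀ n, 0 ≤ b n) (hl : ∀ n, 0 ≤ lam n) {ε : ℝ} (hε : 0 < ε)
    (hs : Summable (fun n => b n * Real.exp (-ε * lam n))) :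
    ∫ u in Set.Ioi (0:ℝ), ε * Real.exp (-ε*u) * ∑' n, (if lam n ≤ u then b n else 0) = ∑' n, b n * Real.exp (-ε * lam n) := by
  have hi : ∀ n, ∫ u in Set.Ioi (0:ℝ), ε * Real.exp (-ε*u) * (if lam n ≤ u then b n else 0) = b n * Real.exp (-ε * lam n) := by
    intro n
    rw [← integral_Ici_eq_integral_Ioi, setIntegral_eq_of_subset_of_forall_sdiff_eq_zero (s := Set.Ici (lam n)) measurableSet_Ici
      (Set.Ici_subset_Ici.2 (hl n))]
    · have e : ∀ u ∈ Set.Ici (lam n), ε * Real.exp (-ε*u) * (if lam n ≤ u then b n else 0) = (ε * b n) * Real.exp (-ε*u) := by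
        intro u hu
        rw [if_pos (Set.mem_Ici.1 hu)]; ring
      rw [setIntegral_congr_fun measurableSet_Ici e, integral_Ici_eq_integral_Ioi, integral_const_mul, int_exp _ _ hε]
      field_simp
    · intro u hu
      have : ¬ lam n ≤ u := hu.2
      simp [this]
  have hnn : ∀ n u, 0 ≤ ε * Real.exp (-ε*u) * (if lam n ≤ u then b n else 0) := by
    intro n u
    have : 0 ≤ (if lam n ≤ u then b n else 0) := by split_ifs; exact hb n; exact le_rfl
    positivity
  have h := hasSum_integral_of_summable_integral_norm (μ := volume.restrict (Set.Ioi (0:ℝ)))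
    (F := fun n u => ε * Real.exp (-ε*u) * (if lam n ≤ u then b n else 0)) ?_ ?_
  · simp_rw [hi, tsum_mul_left] at h
    exact h.tsum_eq.symm
  · intro n
    refine Integrable.mono' ((int_exp_Ioi ε hε).const_mul (ε * b n)) ?_ ?_
    · refine Measurable.aestronglyMeasurable ?_
      exact (by fun_prop : Measurable fun u : ℝ => ε * Real.exp (-ε*u)).mul
        (Measurable.ite measurableSet_Ici measurable_const measurable_const)
    · filter_upwards with u
      rw [Real.norm_eq_abs, abs_of_nonneg (hnn n u)]
      have h1 : (if lam n ≤ u then b n else 0) ≤ b n := by split_ifs; exact le_rfl; exact hb n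
      have := mul_le_mul_of_nonneg_left h1 (by positivity : 0 ≤ ε * Real.exp (-ε*u))
      linarith
  · refine hs.congr fun n => ?_
    rw [← hi n]
    congr 1
    funext u
    rw [Real.norm_eq_abs, abs_of_nonneg (hnn n u)]

end PR


namespace PR
open Complex Filter Topology Metric MeasureTheory ArithmeticFunction

theorem mono_bound {F : ℝ → ℝ} {V : ℝ} (hF : Monotone F)
    (hV : Tendsto (fun u => F u - Real.log u) atTop (𝓝 V)) : ∃ C, 0 ≤ C ∧ ∀ u, 0 < u → F u ≤ C + u := by
  have h1 := (hV.eventually (gt_mem_nhds (lt_add_one V))).and (eventually_gt_atTop 0)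
  obtain ⟨U, hU⟩ := eventually_atTop.1 h1
  refine ⟨|V| + 1 + |F U|, by positivity, fun u hu => ?_⟩
  rcases le_total U u with h | h
  · have := (hU u h).1
    have h2 := Real.log_le_sub_one_of_pos hu
    have := le_abs_self V
    have := abs_nonneg (F U)
    linarith
  · have := hF h
    have := le_abs_self (F U)
    have := abs_nonneg V
    linarith

theorem lin_int {F : ℝ → ℝ} {C : ℝ} (hC : 0 ≤ C) (hF : Monotone F) (h0 : ∀ u, 0 ≤ F u) (hb : ∀ u, 0 < u → F u ≤ C + u)
    {ε : ℝ} (hε : 0 < ε) : IntegrableOn (fun u => ε * Real.exp (-ε*u) * F u) (Set.Ioi 0) := by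
  have i1 := int_exp_Ioi ε hε
  have i2 := int_exp_Ioi (ε/2) (by linarith)
  have hm := hF.measurable
  refine Integrable.mono' ((i1.const_mul (ε*C)).add (i2.const_mul 2)) ?_ ?_
  · exact (Measurable.aestronglyMeasurable (by fun_prop))
  · filter_upwards [ae_restrict_mem measurableSet_Ioi] with u hu
    have hu' : 0 < u := hu
    rw [Real.norm_eq_abs, abs_of_nonneg (by have := h0 u; positivity)]
    have h1 := mul_le_mul_of_nonneg_left (hb u hu) (by positivity : 0 ≤ ε * Real.exp (-ε*u))
    refine h1.trans ?_
    have h2 := Real.add_one_le_exp (ε/2*u)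
    have h3 : ε * u ≤ 2 * Real.exp (ε/2*u) := by linarith
    have h4 := mul_le_mul_of_nonneg_left h3 (Real.exp_pos (-ε*u)).le
    have h5 : Real.exp (-ε*u) * (2 * Real.exp (ε/2*u)) = 2 * Real.exp (-(ε/2)*u) := by
      rw [mul_left_comm, ← Real.exp_add]; congr 2; ring
    simp only [Pi.add_apply]
    nlinarith

theorem step_abel {F G : ℝ → ℝ} {V W : ℝ} (hF : Monotone F) (hG : Monotone G)
    (hF0 : ∀ u, 0 ≤ F u) (hG0 : ∀ u, 0 ≤ G u)
    (hV : Tendsto (fun u => F u - Real.log u) atTop (𝓝 V))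
    (hW : Tendsto (fun u => G u - Real.log u) atTop (𝓝 W)) :
    Tendsto (fun ε : ℝ => (∫ u in Set.Ioi (0:ℝ), ε * Real.exp (-ε*u) * F u) -
      ∫ u in Set.Ioi (0:ℝ), ε * Real.exp (-ε*u) * G u) (𝓝[>] 0) (𝓝 (V - W)) := by
  have hFm := hF.measurable
  have hGm := hG.measurable
  have hfg : Tendsto (fun u => F u - G u) atTop (𝓝 (V - W)) := by
    refine (hV.sub hW).congr fun u => by ring
  have h := abel_lim (f := fun u => F u - G u) (V := V - W) (by fun_prop) ?_
  · refine h.congr' ?_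
    filter_upwards [self_mem_nhdsWithin] with ε hε
    obtain ⟨C, hC0, hC⟩ := mono_bound hF hV
    obtain ⟨D, hD0, hD⟩ := mono_bound hG hW
    rw [← integral_sub (lin_int hC0 hF hF0 hC hε) (lin_int hD0 hG hG0 hD hε)]
    congr 1; funext u; ring
  · intro δ hδ
    have h1 := Metric.tendsto_nhds.1 hfg δ hδ
    obtain ⟨U, hU⟩ := eventually_atTop.1 h1
    set B := F U + G U + |V - W|
    have hB : 0 ≤ B := by have := hF0 U; have := hG0 U; positivity
    refine ⟨B * Real.exp U, fun u hu => ?_⟩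
    rcases le_total U u with h | h
    · have := (hU u h)
      rw [Real.dist_eq] at this
      have : 0 ≤ B * Real.exp U * Real.exp (-u) := by positivity
      linarith
    · have h2 : |F u - G u - (V - W)| ≤ B := by
        have a1 := hF h
        have a2 := hG h
        have a3 := hF0 u
        have a4 := hG0 u
        have a5 := abs_sub (F u - G u) (V - W)
        have a6 : |F u - G u| ≤ F U + G U := by rw [abs_le]; constructor <;> linarith
        linarith
      have h3 : B ≤ B * Real.exp U * Real.exp (-u) := by
        rw [mul_assoc, ← Real.exp_add]
        exact le_mul_of_one_le_right hB (Real.one_le_exp (by linarith))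
      linarith

noncomputable def fl (n : ℕ) : ℂ := ((vonMangoldt n / Real.log n : ℝ) : ℂ)

theorem fl_absc : LSeries.abscissaOfAbsConv fl ≤ 1 := by
  apply LSeries.abscissaOfAbsConv_le_of_le_const
  refine ⟨1, fun n hn => ?_⟩
  rw [fl, Complex.norm_real, Real.norm_eq_abs, abs_of_nonneg (div_nonneg vonMangoldt_nonneg (Real.log_natCast_nonneg n))]
  exact div_le_one_of_le₀ vonMangoldt_le_log (Real.log_natCast_nonneg n)

theorem absc_lt {s : ℂ} (hs : 1 < s.re) : LSeries.abscissaOfAbsConv fl < s.re :=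
  fl_absc.trans_lt (by exact_mod_cast hs)

theorem exp_fl {s : ℂ} (hs : 1 < s.re) : Complex.exp (LSeries fl s) = riemannZeta s := by
  have ho : IsOpen {s : ℂ | 1 < s.re} := isOpen_lt continuous_const Complex.continuous_re
  have hd : ∀ s ∈ {s : ℂ | 1 < s.re}, HasDerivAt (fun s => Complex.exp (-LSeries fl s) * riemannZeta s) 0 s := by
    intro s hs
    have hs' : 1 < s.re := hs
    have h1 := LSeries_hasDerivAt (absc_lt hs')
    have hl : LSeries (LSeries.logMul fl) s = -deriv riemannZeta s / riemannZeta s := by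
      rw [← LSeries_vonMangoldt_eq_deriv_riemannZeta_div hs']
      apply LSeries_congr
      intro n hn
      rw [LSeries.logMul, fl, ← Complex.natCast_log, ← Complex.ofReal_mul]
      congr 1
      by_cases h : Real.log n = 0
      · rw [h, zero_mul]
        refine (le_antisymm ?_ vonMangoldt_nonneg).symm
        exact vonMangoldt_le_log.trans h.le
      · field_simp
    have h2 : HasDerivAt riemannZeta (deriv riemannZeta s) s :=
      (differentiableAt_riemannZeta (by rintro rfl; simp at hs')).hasDerivAt
    have hz : riemannZeta s ≠ 0 := riemannZeta_ne_zero_of_one_lt_re hs'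
    have h3 := (h1.neg.cexp).mul h2
    have e : Complex.exp ((-LSeries fl) s) * - -LSeries (LSeries.logMul fl) s * riemannZeta s + Complex.exp ((-LSeries fl) s) * deriv riemannZeta s = 0 := by
      rw [hl]
      field_simp
      ring
    rw [e] at h3
    exact h3
  have hconst : ∀ x ∈ {s : ℂ | 1 < s.re}, ∀ y ∈ {s : ℂ | 1 < s.re}, Complex.exp (-LSeries fl x) * riemannZeta x = Complex.exp (-LSeries fl y) * riemannZeta y := by
    intro x hx y hy
    refine ho.is_const_of_deriv_eq_zero (convex_halfSpace_re_gt 1).isPreconnected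
      (fun s hs => (hd s hs).differentiableAt.differentiableWithinAt) (fun s hs => (hd s hs).deriv) hx hy
  have hlim : Tendsto (fun x : ℝ => Complex.exp (-LSeries fl x) * riemannZeta x) atTop (𝓝 1) := by
    have h1 : Tendsto (fun x : ℝ => LSeries fl x) atTop (𝓝 (fl 1)) :=
      LSeries.tendsto_atTop (fl_absc.trans_lt (by exact_mod_cast EReal.coe_lt_top 1))
    have h2 : Tendsto (fun x : ℝ => LSeries 1 (x:ℂ)) atTop (𝓝 ((1 : ℕ → ℂ) 1)) := by
      apply LSeries.tendsto_atTop
      refine lt_of_le_of_lt (LSeries.abscissaOfAbsConv_le_of_le_const ⟨1, fun n hn => by simp⟩) (by exact_mod_cast EReal.coe_lt_top 1)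
    have h3 := h1.neg.cexp.mul h2
    have e : fl 1 = 0 := by simp [fl]
    rw [e] at h3
    simp only [neg_zero, Complex.exp_zero, Pi.one_apply, mul_one] at h3
    refine h3.congr' ?_
    filter_upwards [eventually_gt_atTop 1] with x hx
    rw [LSeries_one_eq_riemannZeta (by simpa using hx)]
  have hone : Complex.exp (-LSeries fl s) * riemannZeta s = 1 := by
    refine tendsto_nhds_unique (tendsto_const_nhds.congr' ?_) hlim
    filter_upwards [eventually_gt_atTop 1] with x hx
    exact hconst s hs x (by simpa using hx)
  rw [Complex.exp_neg] at hone
  field_simp at hone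
  exact hone.symm

theorem fl_term (ε : ℝ) (n : ℕ) : LSeries.term fl ((1 + ε : ℝ) : ℂ) n =
    ((vonMangoldt n / (n * Real.log n) * Real.exp (-ε * Real.log n) : ℝ) : ℂ) := by
  rw [LSeries.term_def]
  split_ifs with h
  · simp [h]
  · have hn : (0:ℝ) < n := by positivity
    rw [fl, show ((n:ℂ)) = (((n:ℝ)) : ℂ) by simp, ← Complex.ofReal_cpow hn.le, ← Complex.ofReal_div]
    congr 1
    rw [Real.rpow_add hn, Real.rpow_one, Real.rpow_def_of_pos hn]
    rw [show -ε * Real.log n = -(Real.log n * ε) by ring, Real.exp_neg]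
    field_simp

theorem fl_sum {ε : ℝ} (hε : 0 < ε) :
    Summable (fun n : ℕ => vonMangoldt n / (n * Real.log n) * Real.exp (-ε * Real.log n)) ∧
    (Real.exp (∑' n : ℕ, vonMangoldt n / (n * Real.log n) * Real.exp (-ε * Real.log n)) : ℂ) = riemannZeta ((1 + ε : ℝ) : ℂ) := by
  have hre : 1 < (((1 + ε : ℝ) : ℂ)).re := by rw [Complex.ofReal_re]; linarith
  have h1 : Summable (LSeries.term fl ((1 + ε : ℝ) : ℂ)) := LSeriesSummable_of_abscissaOfAbsConv_lt_re (absc_lt hre)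
  have e : LSeries.term fl ((1 + ε : ℝ) : ℂ) = fun n => ((vonMangoldt n / (n * Real.log n) * Real.exp (-ε * Real.log n) : ℝ) : ℂ) :=
    funext (fl_term ε)
  rw [e] at h1
  refine ⟨Complex.summable_ofReal.1 h1, ?_⟩
  rw [← exp_fl hre, LSeries, e, ← Complex.ofReal_tsum]
  simp

theorem PP_mono : Monotone (fun u : ℝ => PP (Real.exp u)) := by
  intro a b hab
  apply Finset.sum_le_sum_of_subset_of_nonneg
  · apply Finset.Ioc_subset_Ioc_right
    exact Nat.floor_mono (Real.exp_le_exp.2 hab)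
  · intro n _ _
    exact div_nonneg vonMangoldt_nonneg (mul_nonneg (by positivity) (Real.log_natCast_nonneg n))

theorem PP_step (u : ℝ) (hu : 0 < u) : ∑' n : ℕ, (if Real.log n ≤ u then vonMangoldt n / (n * Real.log n) else 0) = PP (Real.exp u) := by
  rw [tsum_eq_sum (s := Finset.Ioc 0 ⌊Real.exp u⌋₊), PP]
  · refine Finset.sum_congr rfl fun n hn => ?_
    rw [Finset.mem_Ioc] at hn
    have hn0 : (0:ℝ) < n := by exact_mod_cast hn.1
    rw [if_pos]
    rw [Real.log_le_iff_le_exp hn0]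
    exact (Nat.le_floor_iff (Real.exp_pos u).le).1 hn.2
  · intro n hn
    rcases Nat.eq_zero_or_pos n with rfl | h
    · simp
    · rw [if_neg]
      intro hl
      apply hn
      rw [Finset.mem_Ioc]
      refine ⟨h, Nat.le_floor ?_⟩
      rwa [← Real.log_le_iff_le_exp (by exact_mod_cast h)]

theorem harm_step (u : ℝ) (hu : 0 < u) : ∑' n : ℕ, (if ((n:ℝ)+1) ≤ u then 1/((n:ℝ)+1) else 0) = (harmonic ⌊u⌋₊ : ℝ) := by
  rw [tsum_eq_sum (s := Finset.range ⌊u⌋₊), harmonic]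
  · push_cast
    refine Finset.sum_congr rfl fun n hn => ?_
    rw [Finset.mem_range] at hn
    rw [if_pos, one_div]
    have := (Nat.le_floor_iff hu.le).1 (Nat.succ_le_of_lt hn)
    push_cast at this
    exact this
  · intro n hn
    rw [if_neg]
    intro hl
    apply hn
    rw [Finset.mem_range]
    apply Nat.lt_of_succ_le
    apply Nat.le_floor
    push_cast
    exact hl

theorem harm_tendsto : Tendsto (fun u : ℝ => (harmonic ⌊u⌋₊ : ℝ) - Real.log u) atTop (𝓝 Real.eulerMascheroniConstant) := by
  have h1 := Real.tendsto_harmonic_sub_log.comp (tendsto_nat_floor_atTop (α := ℝ))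
  have h2 : Tendsto (fun u : ℝ => Real.log ((⌊u⌋₊ : ℝ) / u)) atTop (𝓝 (Real.log 1)) :=
    (Real.continuousAt_log one_ne_zero).tendsto.comp tendsto_nat_floor_div_atTop
  rw [Real.log_one] at h2
  have h3 := h1.add h2
  rw [add_zero] at h3
  refine h3.congr' ?_
  filter_upwards [eventually_ge_atTop 1] with u hu
  have : (0:ℝ) < ⌊u⌋₊ := by exact_mod_cast Nat.floor_pos.2 hu
  rw [Real.log_div this.ne' (by linarith)]
  simp

theorem harm_mono : Monotone (fun u : ℝ => (harmonic ⌊u⌋₊ : ℝ)) := by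
  intro a b hab
  simp only [harmonic]
  push_cast
  apply Finset.sum_le_sum_of_subset_of_nonneg
  · exact Finset.range_mono (Nat.floor_mono hab)
  · intro n _ _
    positivity

theorem V_eq_gamma {V : ℝ} (hV : Tendsto VV atTop (𝓝 V)) : V = Real.eulerMascheroniConstant := by
  have h := step_abel PP_mono harm_mono
    (fun u => Finset.sum_nonneg fun n _ => div_nonneg vonMangoldt_nonneg (mul_nonneg (by positivity) (Real.log_natCast_nonneg n)))
    (fun u => by simp only [harmonic]; push_cast; positivity) (PP_tendsto hV) harm_tendsto
  have h2 := (Real.continuous_exp.tendsto _).comp h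
  have h3 : Tendsto (fun ε : ℝ => (ε * Real.exp (∑' n : ℕ, vonMangoldt n / (n * Real.log n) * Real.exp (-ε * Real.log n))) * ((1 - Real.exp (-ε))/ε)) (𝓝[>] 0) (𝓝 (1 * 1)) := by
    refine Tendsto.mul ?_ ?_
    · have hz : Tendsto (fun ε : ℝ => ((1 + ε : ℝ) : ℂ)) (𝓝[>] 0) (𝓝[≠] 1) := by
        rw [tendsto_nhdsWithin_iff]
        constructor
        · have : Tendsto (fun ε : ℝ => ((1 + ε : ℝ) : ℂ)) (𝓝 0) (𝓝 ((1 + 0 : ℝ) : ℂ)) :=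
            Continuous.tendsto (by fun_prop) 0
          simp only [add_zero, Complex.ofReal_one] at this
          exact this.mono_left nhdsWithin_le_nhds
        · filter_upwards [self_mem_nhdsWithin] with ε hε
          have : ε ≠ 0 := (Set.mem_Ioi.1 hε).ne'
          simpa using this
      have h4 := (Complex.continuous_re.tendsto _).comp (riemannZeta_residue_one.comp hz)
      rw [Complex.one_re] at h4
      refine h4.congr' ?_
      filter_upwards [self_mem_nhdsWithin] with ε hε
      simp only [Function.comp]
      rw [← (fl_sum hε).2]
      rw [show (((1 + ε : ℝ) : ℂ) - 1) = ((ε : ℝ) : ℂ) by push_cast; ring, ← Complex.ofReal_mul, Complex.ofReal_re]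
    · have hd : HasDerivAt (fun ε : ℝ => 1 - Real.exp (-ε)) 1 0 := by
        have := ((hasDerivAt_neg (0:ℝ)).exp).const_sub 1
        simpa using this
      have := hd.tendsto_slope_zero_right
      refine this.congr' ?_
      filter_upwards with ε
      simp; ring
  have h5 : Tendsto (fun ε : ℝ => (ε * Real.exp (∑' n : ℕ, vonMangoldt n / (n * Real.log n) * Real.exp (-ε * Real.log n))) * ((1 - Real.exp (-ε))/ε)) (𝓝[>] 0) (𝓝 (Real.exp (V - Real.eulerMascheroniConstant))) := by
    refine h2.congr' ?_
    filter_upwards [self_mem_nhdsWithin] with ε hε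
    have hε' : 0 < ε := hε
    simp only [Function.comp]
    have e1 : ∫ u in Set.Ioi (0:ℝ), ε * Real.exp (-ε*u) * PP (Real.exp u) = ∑' n : ℕ, vonMangoldt n / (n * Real.log n) * Real.exp (-ε * Real.log n) := by
      rw [← step_int (b := fun n : ℕ => vonMangoldt n / (n * Real.log n)) (lam := fun n : ℕ => Real.log n)
        (fun n => div_nonneg vonMangoldt_nonneg (mul_nonneg (by positivity) (Real.log_natCast_nonneg n)))
        (fun n => Real.log_natCast_nonneg n) hε' (fl_sum hε').1]
      refine setIntegral_congr_fun measurableSet_Ioi fun u hu => ?_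
      rw [PP_step u hu]
    have hx : |Real.exp (-ε)| < 1 := by
      rw [abs_of_pos (Real.exp_pos _), Real.exp_lt_one_iff]; linarith
    have hs := Real.hasSum_pow_div_log_of_abs_lt_one hx
    have ht : (fun n : ℕ => Real.exp (-ε) ^ (n+1) / ((n:ℝ)+1)) = fun n : ℕ => 1/((n:ℝ)+1) * Real.exp (-ε * ((n:ℝ)+1)) := by
      funext n
      rw [← Real.exp_nat_mul]
      push_cast
      rw [show ((n:ℝ)+1) * -ε = -ε * ((n:ℝ)+1) by ring]; ring
    rw [ht] at hs
    have e2 : ∫ u in Set.Ioi (0:ℝ), ε * Real.exp (-ε*u) * (harmonic ⌊u⌋₊ : ℝ) = - Real.log (1 - Real.exp (-ε)) := by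
      rw [← hs.tsum_eq, ← step_int (b := fun n : ℕ => 1/((n:ℝ)+1)) (lam := fun n : ℕ => (n:ℝ)+1)
        (fun n => by positivity) (fun n => by positivity) hε' hs.summable]
      refine setIntegral_congr_fun measurableSet_Ioi fun u hu => ?_
      rw [harm_step u hu]
    have hp : 0 < 1 - Real.exp (-ε) := by
      rw [abs_of_pos (Real.exp_pos _)] at hx; linarith
    rw [e1, e2, sub_neg_eq_add, Real.exp_add, Real.exp_log hp]
    generalize Real.exp (∑' n : ℕ, _) = E
    field_simp
  have := tendsto_nhds_unique h5 h3
  rw [mul_one, Real.exp_eq_one_iff] at this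
  linarith

end PR


namespace PR

/-- product of the primes below 529 -/
def QQ : ℕ := 8709668761379269784034173446876636639594408083936553641753483991897255703964943107588335040121154680170867105541177741204814011615930342030904704147856733048115934632145172739949220591246493529224396454328521288726490

/-- prime test, correct below 529 ^ 2 -/
def isP (n : ℕ) : Bool :=
  bif Nat.ble 529 n then Nat.beq (Nat.gcd n QQ) 1
  else bif Nat.ble 23 n then Nat.beq (Nat.gcd n 9699690) 1
  else Nat.beq (Nat.land (Nat.shiftRight 665772 n) 1) 1

def leafN (n : ℕ) : ℕ := bif isP n then n else 1
def leafF (n : ℕ) : ℕ := bif isP n then Nat.sub n 1 else 1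

/-- product of f over a dyadic segment -/
def prodR (f : ℕ → ℕ) (k : ℕ) : ℕ → ℕ :=
  Nat.rec (motive := fun _ => ℕ → ℕ) f (fun j ih lo => Nat.mul (ih lo) (ih (Nat.add lo (Nat.pow 2 j)))) k

/-- call-by-value application -/
def fc {α : Type} (n : ℕ) (g : ℕ → α) : α := Nat.rec (motive := fun _ => α) (g 0) (fun m _ => g (Nat.succ m)) n

/-- certified lower bounds for `log` and `log log` of `Na` -/
def chkL (m Na t j : ℕ) : Bool :=
  bif Nat.ble (Nat.pow 2 t) (Nat.pow Na m) then
    Nat.ble (Nat.mul (Nat.pow 2 j) (Nat.pow (Nat.mul m 1000000) 4096)) (Nat.pow (Nat.mul t 693147) 4096) else false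

def chkR (A N1 F1 : ℕ) : Bool :=
  bif Nat.ble (Nat.mul 119 4096000000) (Nat.mul 100 A) then
    Nat.ble (Nat.mul N1 (Nat.mul A 409600000000000))
      (Nat.mul F1 (Nat.add (Nat.mul 178105 (Nat.mul A A)) (Nat.mul 251000 16777216000000000000))) else false

def finc (t N : ℕ) : Bool := Nat.ble (Nat.pow 2 t) N

def run (l : List (ℕ × ℕ × ℕ)) : ℕ → ℕ → ℕ → Bool :=
  List.rec (motive := fun _ => ℕ → ℕ → ℕ → Bool)
    (fun a N _ => bif Nat.beq a 208023 then finc 299363 N else false)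
    (fun k _ ih a N F =>
      fc (Nat.mul N (prodR leafN k.1 a)) fun N1 =>
      fc (Nat.mul F (prodR leafF k.1 a)) fun F1 =>
      fc (Nat.add a (Nat.pow 2 k.1)) fun a1 =>
      bif chkL (bif Nat.ble a 500 then 256 else 1) (Nat.mul N (leafN a)) k.2.1 k.2.2 then
        bif chkR (Nat.mul k.2.2 693147) N1 F1 then ih a1 N1 F1 else false else false) l

def blks : List (ℕ × ℕ × ℕ) :=
  [(0, 1256, 7232), (0, 1256, 7232), (2, 1974, 9904), (1, 2860, 12095), (2, 3807, 13785), (1, 4854, 15221),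
   (2, 5941, 16415), (2, 7099, 17467), (1, 7099, 17467), (1, 8343, 18422), (2, 9611, 19258), (1, 9611, 19258),
   (2, 10945, 20026), (1, 12316, 20723), (2, 13705, 21355), (2, 15127, 21938), (1, 15127, 21938), (2, 16594, 22485),
   (1, 16594, 22485), (1, 18100, 22998), (2, 19618, 23474), (1, 19618, 23474), (2, 21171, 23924), (3, 22745, 24348),
   (3, 25944, 25126), (3, 27576, 25486), (2, 29233, 25831), (2, 30923, 26163), (2, 34339, 26782), (2, 36065, 27072),
   (4, 37798, 27350), (3, 41333, 27878), (3, 43133, 28130), (3, 46773, 28609), (4, 50474, 29059), (4, 56113, 29684),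
   (4, 61852, 30260), (5, 69642, 30961), (4, 77626, 31602), (4, 83687, 32046), (4, 89835, 32465), (5, 96048, 32860),
   (5, 106548, 33474), (5, 115090, 33929), (5, 128120, 34563), (5, 139136, 35050), (5, 152549, 35594), (6, 166119, 36098),
   (6, 720, 36712), (6, 812, 37423), (6, 923, 38180), (6, 999, 38648), (6, 1085, 39136), (6, 1172, 39591),
   (7, 1270, 40066), (7, 1449, 40845), (7, 1631, 41544), (7, 1837, 42247), (7, 1972, 42666), (7, 2183, 43267),
   (8, 2364, 43738), (8, 2710, 44545), (8, 3063, 45268), (8, 3465, 45997), (8, 3828, 46586), (8, 4195, 47127),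
   (8, 4532, 47583), (8, 4895, 48039), (9, 5297, 48505), (9, 6026, 49267), (9, 6742, 49931), (9, 7443, 50515),
   (9, 8201, 51088), (9, 8942, 51599), (9, 9677, 52066), (10, 10393, 52488), (10, 11855, 53266), (10, 13336, 53961),
   (10, 14862, 54602), (10, 16257, 55132), (10, 17720, 55641), (10, 19236, 56126), (10, 20627, 56539), (11, 22208, 56975),
   (11, 25109, 57700), (11, 28030, 58351), (11, 30997, 58945), (11, 33978, 59488), (11, 36867, 59970), (11, 39809, 60424),
   (11, 42727, 60842), (12, 45620, 61229), (12, 51579, 61954), (12, 57482, 62595), (12, 63443, 63178), (12, 69176, 63689),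
   (12, 75174, 64180), (12, 81026, 64623), (12, 87043, 65047), (12, 92827, 65427), (13, 98708, 65790), (13, 110499, 66457),
   (13, 122353, 67059), (13, 134276, 67608), (13, 145992, 68103), (13, 157758, 68561), (13, 169499, 68985), (13, 181377, 69385),
   (13, 193151, 69757), (14, 205089, 70111), (14, 228619, 70753), (14, 251850, 71325), (14, 275768, 71861)]

theorem run_ok : run blks 5 6 2 = true := by decide +kernel
end PR


namespace PR
open Complex Filter Topology Metric MeasureTheory ArithmeticFunction

/-- product of the primes below a -/
noncomputable def NN (a : ℕ) : ℕ := ∏ n ∈ Finset.range a, if n.Prime then n else 1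
/-- product of p - 1 over the primes below a -/
noncomputable def FF (a : ℕ) : ℕ := ∏ n ∈ Finset.range a, if n.Prime then n - 1 else 1

theorem isP_small : ∀ n < 529, isP n = decide (n.Prime) := by decide +kernel

theorem QQ_eq : QQ = ∏ p ∈ Finset.range 529 with p.Prime, p := by decide +kernel

theorem isP_eq {n : ℕ} (hn : n < 279841) : isP n = decide (n.Prime) := by
  rcases lt_or_ge n 529 with h | h
  · exact isP_small n h
  · have h1 : isP n = Nat.beq (Nat.gcd n QQ) 1 := by
      have : Nat.ble 529 n = true := Nat.ble_eq_true_of_le h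
      rw [isP, this]; rfl
    rw [h1, Bool.eq_iff_iff, Nat.beq_eq, decide_eq_true_iff]
    constructor
    · intro hg
      by_contra hp
      have h2 := Nat.minFac_sq_le_self (by omega) hp
      have h3 : n.minFac < 529 := by nlinarith
      have h4 : n.minFac.Prime := Nat.minFac_prime (by omega)
      have h5 : n.minFac ∣ QQ := by
        rw [QQ_eq]
        exact Finset.dvd_prod_of_mem (fun p => p) (Finset.mem_filter.2 ⟨Finset.mem_range.2 h3, h4⟩)
      have h6 := Nat.dvd_gcd (Nat.minFac_dvd n) h5
      rw [hg] at h6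
      exact h4.one_lt.ne' (Nat.dvd_one.1 h6)
    · intro hp
      change Nat.Coprime n QQ
      rw [QQ_eq]
      apply Nat.Coprime.prod_right
      intro p hpm
      rw [Finset.mem_filter, Finset.mem_range] at hpm
      rw [Nat.coprime_primes hp hpm.2]
      omega

theorem prodR_eq (f : ℕ → ℕ) (k : ℕ) : ∀ a, prodR f k a = ∏ n ∈ Finset.Ico a (a + 2^k), f n := by
  induction k with
  | zero => intro a; simp [prodR]
  | succ k ih =>
    intro a
    have : prodR f (k+1) a = prodR f k a * prodR f k (a + 2^k) := rfl
    rw [this, ih, ih, Finset.prod_Ico_consecutive _ (Nat.le_add_right _ _) (Nat.le_add_right _ _)]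
    congr 2
    rw [pow_succ]; ring

theorem fc_eq {α : Type} (n : ℕ) (g : ℕ → α) : fc n g = g n := by
  cases n <;> rfl

theorem leafN_eq {n : ℕ} (hn : n < 279841) : leafN n = if n.Prime then n else 1 := by
  rw [leafN, isP_eq hn]; by_cases h : n.Prime <;> simp [h]

theorem leafF_eq {n : ℕ} (hn : n < 279841) : leafF n = if n.Prime then n - 1 else 1 := by
  rw [leafF, isP_eq hn]; by_cases h : n.Prime <;> simp [h]

theorem NN_seg {a k : ℕ} (h : a + 2^k ≤ 279841) : NN a * prodR leafN k a = NN (a + 2^k) := by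
  rw [prodR_eq, NN, NN, ← Finset.prod_range_mul_prod_Ico _ (Nat.le_add_right _ _ : a ≤ a + 2^k)]
  congr 1
  exact Finset.prod_congr rfl fun n hn => leafN_eq (by rw [Finset.mem_Ico] at hn; omega)

theorem FF_seg {a k : ℕ} (h : a + 2^k ≤ 279841) : FF a * prodR leafF k a = FF (a + 2^k) := by
  rw [prodR_eq, FF, FF, ← Finset.prod_range_mul_prod_Ico _ (Nat.le_add_right _ _ : a ≤ a + 2^k)]
  congr 1
  exact Finset.prod_congr rfl fun n hn => leafF_eq (by rw [Finset.mem_Ico] at hn; omega)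

theorem NN_pos (a : ℕ) : 0 < NN a := Finset.prod_pos fun n _ => by
  split_ifs with h
  exacts [h.pos, one_pos]

theorem FF_pos (a : ℕ) : 0 < FF a := Finset.prod_pos fun n _ => by
  split_ifs with h
  exacts [by have := h.two_le; omega, one_pos]

theorem NN_mono : Monotone NN := by
  refine monotone_nat_of_le_succ fun n => ?_
  rw [NN, NN, Finset.prod_range_succ]
  refine Nat.le_mul_of_pos_right _ ?_
  split_ifs with h
  exacts [h.pos, one_pos]

theorem ratio_mono : Monotone (fun a => (NN a : ℝ) / FF a) := by
  refine monotone_nat_of_le_succ fun n => ?_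
  have h1 : NN (n+1) = NN n * (if n.Prime then n else 1) := by rw [NN, NN, Finset.prod_range_succ]
  have h2 : FF (n+1) = FF n * (if n.Prime then n - 1 else 1) := by rw [FF, FF, Finset.prod_range_succ]
  have h3 : (0:ℝ) < FF n := by exact_mod_cast FF_pos n
  have h3' : (0:ℝ) < NN n := by exact_mod_cast NN_pos n
  rw [h1, h2]
  split_ifs with h
  · have h4 := h.two_le
    rw [div_le_div_iff₀ h3 (by push_cast [Nat.cast_sub (by omega : 1 ≤ n)]; have : (2:ℝ) ≤ n := by exact_mod_cast h4
                               exact mul_pos h3 (by linarith))]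
    push_cast [Nat.cast_sub (by omega : 1 ≤ n)]
    have := mul_pos h3 h3'
    nlinarith
  · simp

/-- the bound at all primes below a -/
def Good (a : ℕ) : Prop := (NN a : ℝ) / FF a ≤ Real.exp Real.eulerMascheroniConstant * Real.log (Real.log (NN a)) + 2.51 / Real.log (Real.log (NN a))

theorem exp_gamma_lower : 1.78105 ≤ Real.exp Real.eulerMascheroniConstant := by
  have h := gamma_bounds.1
  have h1 : Real.exp 0.57721 ≤ Real.exp Real.eulerMascheroniConstant := Real.exp_le_exp.2 h.le
  refine le_trans ?_ h1
  have h2 := Real.sum_le_exp_of_nonneg (x := 0.57721) (by norm_num) 9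
  refine le_trans ?_ h2
  norm_num [Finset.sum_range_succ, Nat.factorial]

theorem chkL_spec {m Na t j : ℕ} (h : chkL m Na t j = true) (c : ℕ) (hc : c = 4096) :
    2^t ≤ Na^m ∧ 2^j * (m*1000000)^c ≤ (t*693147)^c := by
  subst hc
  unfold chkL at h
  rw [Bool.cond_false_right, Bool.and_eq_true, Nat.ble_eq, Nat.ble_eq] at h
  exact h

theorem chkR_spec {A N1 F1 : ℕ} (h : chkR A N1 F1 = true) :
    119 * 4096000000 ≤ 100 * A ∧ N1 * (A * 409600000000000) ≤ F1 * (178105 * (A*A) + 251000 * 16777216000000000000) := by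
  unfold chkR at h
  rw [Bool.cond_false_right, Bool.and_eq_true, Nat.ble_eq, Nat.ble_eq] at h
  simp only [Nat.mul_eq, Nat.add_eq] at h ⊢
  exact h

theorem finc_spec {t N : ℕ} (h : finc t N = true) : 2^t ≤ N := Nat.le_of_ble_eq_true h

theorem log_low {m Na t j : ℕ} (hm : 0 < m) (ht0 : 0 < Na) (h : chkL m Na t j = true) (hj : 0 < j) :
    (j * 693147 : ℕ) / (4096000000 : ℝ) ≤ Real.log (Real.log Na) := by
  have hl2 : (0.693147:ℝ) ≤ Real.log 2 := by have := Real.log_two_gt_d9; linarith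
  obtain ⟨c, hc⟩ : ∃ c : ℕ, c = 4096 := ⟨_, rfl⟩
  obtain ⟨h1, h2⟩ := chkL_spec h c hc
  have hc0 : c ≠ 0 := by omega
  have hcr : (c:ℝ) = 4096 := by rw [hc]; norm_num
  have hNa : (0:ℝ) < Na := by exact_mod_cast ht0
  have hm' : (0:ℝ) < m := by exact_mod_cast hm
  have h3 : (t:ℝ) * Real.log 2 ≤ m * Real.log Na := by
    rw [← Real.log_pow, ← Real.log_pow]
    exact Real.log_le_log (by positivity) (by exact_mod_cast h1)
  have ht : 0 < t := by
    rcases Nat.eq_zero_or_pos t with rfl | h0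
    · exfalso
      rw [zero_mul, zero_pow hc0] at h2
      have : 0 < 2^j * (m*1000000)^c := by positivity
      omega
    · exact h0
  have ht' : (0:ℝ) < t := by exact_mod_cast ht
  set v : ℝ := t * 693147 / (m * 1000000) with hv
  have hv0 : 0 < v := by positivity
  have h4 : v ≤ Real.log Na := by
    rw [hv, div_le_iff₀ (by positivity)]
    nlinarith
  have h5 : (2:ℝ)^j ≤ v^c := by
    rw [hv, div_pow, le_div_iff₀ (by positivity)]
    exact_mod_cast h2
  have h6 : (j:ℝ) * Real.log 2 ≤ c * Real.log v := by
    rw [← Real.log_pow, ← Real.log_pow]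
    exact Real.log_le_log (by positivity) h5
  have h7 := Real.log_le_log hv0 h4
  have hj' : (0:ℝ) < j := by exact_mod_cast hj
  rw [hcr] at h6
  push_cast
  rw [div_le_iff₀ (by norm_num)]
  nlinarith

theorem good_block {a b x m t j : ℕ} (hm : 0 < m) (hax : a ≤ x) (hxb : x ≤ b)
    (h1 : chkL m (NN a) t j = true) (h2 : chkR (j * 693147) (NN b) (FF b) = true) : Good x := by
  obtain ⟨h3, h4⟩ := chkR_spec h2
  have hj : 0 < j := by omega
  have hL := log_low hm (NN_pos a) h1 hj
  set A := j * 693147 with hA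
  have hA0 : (0:ℝ) < A := by rw [hA]; positivity
  have hn1 : 1 < NN a := by
    by_contra hcon
    have : NN a = 1 := le_antisymm (not_lt.1 hcon) (NN_pos a)
    rw [this] at hL
    simp at hL
    have : (0:ℝ) < A / 4096000000 := by positivity
    linarith
  have hL2 : Real.log (Real.log (NN a)) ≤ Real.log (Real.log (NN x)) := by
    have h0 : (1:ℝ) < NN a := by exact_mod_cast hn1
    refine Real.log_le_log (Real.log_pos h0) (Real.log_le_log (by linarith) ?_)
    exact_mod_cast NN_mono hax
  have hR : (NN x : ℝ) / FF x ≤ NN b / FF b := ratio_mono hxb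
  set l : ℝ := A / 4096000000 with hl
  set L := Real.log (Real.log (NN x))
  have hlL : l ≤ L := hL.trans hL2
  have hl1 : 1.19 ≤ l := by
    rw [hl, le_div_iff₀ (by norm_num)]
    have : (119 * 4096000000 : ℝ) ≤ 100 * A := by exact_mod_cast h3
    linarith
  have h5 : (NN b : ℝ) / FF b ≤ 1.78105 * l + 2.51 / l := by
    have hFb : (0:ℝ) < FF b := by exact_mod_cast FF_pos b
    have h6 : (NN b : ℝ) * (A * 409600000000000) ≤ FF b * (178105 * (A*A) + 251000 * 16777216000000000000) := by exact_mod_cast h4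
    rw [div_le_iff₀ hFb, hl]
    have e : (1.78105 * ((A:ℝ) / 4096000000) + 2.51 / (A / 4096000000)) * FF b =
      (FF b * (178105 * (A*A) + 251000 * 16777216000000000000)) / (A * 409600000000000) := by
      field_simp
      ring
    rw [e, le_div_iff₀ (by positivity)]
    exact h6
  have h7 : 1.78105 * l + 2.51 / l ≤ 1.78105 * L + 2.51 / L := by
    have hL0 : 0 < L := by linarith
    have hl0 : 0 < l := by linarith
    have : 2.51 / l - 2.51 / L = 2.51 * (L - l) / (l * L) := by field_simp
    have h8 : 2.51 * (L - l) / (l * L) ≤ 1.78105 * (L - l) := by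
      rw [div_le_iff₀ (by positivity)]
      have : 1.19 * 1.19 ≤ l * L := by nlinarith
      have : 0 ≤ L - l := by linarith
      nlinarith
    linarith
  have h8 : 1.78105 * L ≤ Real.exp Real.eulerMascheroniConstant * L :=
    mul_le_mul_of_nonneg_right exp_gamma_lower (by linarith)
  unfold Good
  linarith

theorem run_cons (k : ℕ × ℕ × ℕ) (ks : List (ℕ × ℕ × ℕ)) (a N F : ℕ) (h : run (k :: ks) a N F = true) :
    chkL (bif Nat.ble a 500 then 256 else 1) (N * leafN a) k.2.1 k.2.2 = true ∧
    chkR (k.2.2 * 693147) (N * prodR leafN k.1 a) (F * prodR leafF k.1 a) = true ∧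
    run ks (a + 2^k.1) (N * prodR leafN k.1 a) (F * prodR leafF k.1 a) = true := by
  have e : run (k :: ks) a N F = fc (Nat.mul N (prodR leafN k.1 a)) fun N1 =>
      fc (Nat.mul F (prodR leafF k.1 a)) fun F1 =>
      fc (Nat.add a (Nat.pow 2 k.1)) fun a1 =>
      bif chkL (bif Nat.ble a 500 then 256 else 1) (Nat.mul N (leafN a)) k.2.1 k.2.2 then
        bif chkR (Nat.mul k.2.2 693147) N1 F1 then run ks a1 N1 F1 else false else false := rfl
  rw [e, fc_eq, fc_eq, fc_eq] at h
  simp only [Bool.cond_false_right, Bool.and_eq_true] at h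
  exact ⟨h.1, h.2.1, h.2.2⟩

theorem run_end : ∀ (l : List (ℕ × ℕ × ℕ)) (a N F : ℕ), run l a N F = true → a ≤ 208023 := by
  intro l
  induction l with
  | nil =>
    intro a N F h
    have e : run [] a N F = bif Nat.beq a 208023 then finc 299363 N else false := rfl
    rw [e] at h
    simp only [Bool.cond_false_right, Bool.and_eq_true] at h
    exact (Nat.beq_eq.mp h.1).le
  | cons k ks ih =>
    intro a N F h
    have := ih _ _ _ (run_cons k ks a N F h).2.2
    exact le_trans (Nat.le_add_right _ _) this

theorem run_good : ∀ (l : List (ℕ × ℕ × ℕ)) (a : ℕ), run l a (NN a) (FF a) = true →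
    (∀ x, a < x → x ≤ 208023 → Good x) ∧ finc 299363 (NN 208023) = true := by
  intro l
  induction l with
  | nil =>
    intro a h
    have e : run [] a (NN a) (FF a) = bif Nat.beq a 208023 then finc 299363 (NN a) else false := rfl
    rw [e] at h
    simp only [Bool.cond_false_right, Bool.and_eq_true] at h
    have ha : a = 208023 := Nat.beq_eq.mp h.1
    subst ha
    exact ⟨fun x h1 h2 => absurd h1 (by omega), h.2⟩
  | cons k ks ih =>
    intro a h
    obtain ⟨h1, h2, h3⟩ := run_cons k ks a _ _ h
    have hend := run_end _ _ _ _ h3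
    rw [NN_seg (by omega), FF_seg (by omega)] at h2 h3
    have hNa : NN a * leafN a = NN (a+1) := by
      rw [leafN_eq (by have := Nat.one_le_two_pow (n := k.1); omega), NN, NN, Finset.prod_range_succ]
    rw [hNa] at h1
    obtain ⟨i1, i2⟩ := ih _ h3
    refine ⟨fun x hx hx2 => ?_, i2⟩
    rcases lt_or_ge (a + 2^k.1) x with hc | hc
    · exact i1 x hc hx2
    · refine good_block ?_ hx hc h1 h2
      rcases Nat.ble a 500 <;> simp

theorem small_ok : (∀ x, 5 < x → x ≤ 208023 → Good x) ∧ finc 299363 (NN 208023) = true := by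
  apply run_good blks 5
  have h1 : NN 5 = 6 := by unfold NN; decide
  have h2 : FF 5 = 2 := by unfold FF; decide
  rw [h1, h2]
  exact run_ok

theorem theta_big : (207000:ℝ) ≤ Real.log (NN 208023) := by
  have h : (2:ℝ)^299363 ≤ NN 208023 := by
    have := finc_spec small_ok.2
    exact_mod_cast this
  have h1 := Real.log_le_log (by positivity) h
  rw [Real.log_pow] at h1
  have := Real.log_two_gt_d9
  rw [Nat.cast_ofNat] at h1
  linarith

end PR


namespace PR
open Complex Filter Topology Metric MeasureTheory ArithmeticFunction

theorem g_le {a b : ℝ} (ha : 1 < a) (hab : a ≤ b) : 1/(b * Real.log b) ≤ 1/(a * Real.log a) := by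
  have h1 := Real.log_pos ha
  have h2 := Real.log_le_log (by linarith) hab
  exact one_div_le_one_div_of_le (by positivity) (mul_le_mul hab h2 h1.le (by linarith))

theorem PP_le {x y : ℝ} (hy : 1 < y) : PP x ≤ PP y + 1/(y * Real.log y) * (Chebyshev.psi x - Chebyshev.psi y) := by
  unfold PP Chebyshev.psi
  rcases le_total ⌊y⌋₊ ⌊x⌋₊ with h | h
  · rw [← Finset.sum_Ioc_consecutive _ (Nat.zero_le _) h, ← Finset.sum_Ioc_consecutive (fun n => vonMangoldt n) (Nat.zero_le _) h,
      add_sub_cancel_left, Finset.mul_sum]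
    gcongr with n hn
    rw [Finset.mem_Ioc] at hn
    have hn1 : y ≤ n := (Nat.lt_of_floor_lt hn.1).le
    have := mul_le_mul_of_nonneg_right (g_le hy hn1) (vonMangoldt_nonneg (n := n))
    rw [one_div_mul_eq_div] at this
    exact this
  · rw [← Finset.sum_Ioc_consecutive (fun n => vonMangoldt n / (n * Real.log n)) (Nat.zero_le _) h, ← Finset.sum_Ioc_consecutive (fun n => vonMangoldt n) (Nat.zero_le _) h]
    have key : 1/(y * Real.log y) * ∑ n ∈ Finset.Ioc ⌊x⌋₊ ⌊y⌋₊, vonMangoldt n ≤ ∑ n ∈ Finset.Ioc ⌊x⌋₊ ⌊y⌋₊, vonMangoldt n / (n * Real.log n) := by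
      rw [Finset.mul_sum]
      refine Finset.sum_le_sum fun n hn => ?_
      rw [Finset.mem_Ioc] at hn
      have hn2 : (n:ℝ) ≤ y := (Nat.le_floor_iff (by linarith)).1 hn.2
      rcases Nat.lt_or_ge 1 n with h1 | h1
      · have := mul_le_mul_of_nonneg_right (g_le (by exact_mod_cast h1) hn2) (vonMangoldt_nonneg (n := n))
        rw [one_div_mul_eq_div (n * Real.log n)] at this
        exact this
      · have : n = 1 := by omega
        simp [this]
    linarith

theorem log_tail {z : ℝ} (hz0 : 0 < z) (hz : z < 1) (K : ℕ) :
    -Real.log (1 - z) ≤ ∑ k ∈ Finset.Icc 1 K, z^k/k + z^(K+1)/((K+1)*(1-z)) := by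
  have h := Real.hasSum_pow_div_log_of_abs_lt_one (x := z) (by rwa [abs_of_pos hz0])
  rw [← h.tsum_eq, ← h.summable.sum_add_tsum_nat_add K]
  have e : ∑ k ∈ Finset.Icc 1 K, z^k/k = ∑ k ∈ Finset.range K, z^(k+1)/((k:ℝ)+1) := by
    rw [← Finset.Ico_add_one_right_eq_Icc, Finset.sum_Ico_eq_sum_range]
    refine Finset.sum_congr (by simp) fun k _ => ?_
    rw [add_comm 1 k]; push_cast; rfl
  rw [e]
  gcongr
  have hg := (hasSum_geometric_of_lt_one hz0.le hz).mul_left (z^(K+1)/((K:ℝ)+1))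
  have e2 : z^(K+1)/((K+1)*(1-z)) = z^(K+1)/((K:ℝ)+1) * (1-z)⁻¹ := by
    have : 0 < 1 - z := by linarith
    field_simp
  rw [e2, ← hg.tsum_eq]
  refine Summable.tsum_le_tsum (fun n => ?_) ((summable_nat_add_iff K).2 h.summable) hg.summable
  rw [div_mul_eq_mul_div, ← pow_add, show n + K + 1 = K + 1 + n by ring]
  push_cast
  gcongr
  linarith [Nat.cast_nonneg (α := ℝ) n]

theorem PP_ge (X : ℕ) : ∑ p ∈ Finset.range (X+1) with p.Prime, ∑ k ∈ Finset.Icc 1 (Nat.log p X), (1/(p:ℝ))^k/k ≤ PP X := by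
  have h0 : ∀ n : ℕ, 0 ≤ vonMangoldt n / (n * Real.log n) := fun n =>
    div_nonneg vonMangoldt_nonneg (mul_nonneg (by positivity) (Real.log_natCast_nonneg n))
  rw [Finset.sum_sigma', PP, Nat.floor_natCast]
  have e : ∀ q ∈ ((Finset.range (X+1)).filter Nat.Prime).sigma (fun p => Finset.Icc 1 (Nat.log p X)),
      (1/(q.1:ℝ))^q.2/q.2 = (fun n : ℕ => vonMangoldt n / (n * Real.log n)) (q.1^q.2) := by
    rintro ⟨p, k⟩ hq
    simp only [Finset.mem_sigma, Finset.mem_filter, Finset.mem_Icc] at hq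
    have hp := hq.1.2
    have hl : 0 < Real.log p := Real.log_pos (by exact_mod_cast hp.one_lt)
    have hk : (0:ℝ) < k := by exact_mod_cast hq.2.1
    simp only
    rw [vonMangoldt_apply_pow (by omega), vonMangoldt_apply_prime hp]
    push_cast
    rw [Real.log_pow]
    have : (0:ℝ) < p := by exact_mod_cast hp.pos
    field_simp
    rw [← mul_pow, one_div_mul_cancel this.ne', one_pow]
  rw [Finset.sum_congr rfl e]
  rw [← Finset.sum_image (s := ((Finset.range (X+1)).filter Nat.Prime).sigma (fun p => Finset.Icc 1 (Nat.log p X)))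
    (g := fun q : (_ : ℕ) × ℕ => q.1^q.2) (f := fun n : ℕ => vonMangoldt n / (n * Real.log n))]
  · refine Finset.sum_le_sum_of_subset_of_nonneg ?_ fun n _ _ => h0 n
    intro n hn
    rw [Finset.mem_image] at hn
    obtain ⟨⟨p, k⟩, hq, rfl⟩ := hn
    simp only [Finset.mem_sigma, Finset.mem_filter, Finset.mem_Icc, Finset.mem_range] at hq
    have hX : X ≠ 0 := by
      rintro rfl
      have := hq.1.2.two_le
      omega
    rw [Finset.mem_Ioc]
    exact ⟨pow_pos hq.1.2.pos _, Nat.pow_le_of_le_log hX hq.2.2⟩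
  · rintro ⟨p, k⟩ hq ⟨p', k'⟩ hq' heq
    simp only [Finset.coe_sigma, Set.mem_sigma_iff, Finset.mem_coe, Finset.mem_filter, Finset.mem_Icc] at hq hq'
    simp only at heq
    have hpp : p = p' := by
      have h1 := hq.1.2.pow_minFac (k := k) (by omega)
      have h2 := hq'.1.2.pow_minFac (k := k') (by omega)
      rw [heq, h2] at h1
      exact h1.symm
    subst hpp
    have := Nat.pow_right_injective hq.1.2.two_le heq
    subst this
    rfl

theorem telescope (s : ℕ) (hs : 0 < s) : ∀ X, s ≤ X → ∑ n ∈ Finset.Ioc s X, 1/((n:ℝ)*(n-1)) = 1/(s:ℝ) - 1/X := by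
  intro X hX
  induction X, hX using Nat.le_induction with
  | base => simp
  | succ X hX ih =>
    rw [Finset.sum_Ioc_succ_top (by omega), ih]
    have h1 : (0:ℝ) < X := by exact_mod_cast (by omega : 0 < X)
    have h2 : (0:ℝ) < s := by exact_mod_cast hs
    push_cast
    rw [add_sub_cancel_right]
    field_simp
    ring

theorem tail_p {p X : ℕ} (hp : p.Prime) (hX : p ≤ X) (h2X : 0 < X) :
    (1/(p:ℝ))^(Nat.log p X + 1)/(((Nat.log p X : ℕ)+1)*(1-1/(p:ℝ))) ≤
      if p ≤ Nat.sqrt X then 2/(3*(X:ℝ)) else 1/2 * (1/((p:ℝ)*(p-1))) := by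
  have hp2 : (2:ℝ) ≤ p := by exact_mod_cast hp.two_le
  have hX0 : (0:ℝ) < X := by exact_mod_cast h2X
  have hpinv : 1/(p:ℝ) ≤ 1/2 := one_div_le_one_div_of_le (by norm_num) hp2
  set K := Nat.log p X with hK
  have hlt : X < p^(K+1) := Nat.lt_pow_succ_log_self hp.one_lt X
  split_ifs with h
  · have hK2 : 2 ≤ K := by
      apply Nat.le_log_of_pow_le hp.one_lt
      rw [Nat.le_sqrt'] at h
      exact h
    have hK2' : (2:ℝ) ≤ K := by exact_mod_cast hK2
    have h1 : (1/(p:ℝ))^(K+1) ≤ 1/X := by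
      rw [div_pow, one_pow]
      exact one_div_le_one_div_of_le hX0 (by exact_mod_cast hlt.le)
    have h2 : (3:ℝ)/2 ≤ (K+1)*(1-1/(p:ℝ)) := by nlinarith
    calc _ ≤ (1/(X:ℝ))/(3/2) := div_le_div₀ (by positivity) h1 (by norm_num) h2
      _ = _ := by field_simp
  · have hK1 : 1 ≤ K := Nat.log_pos hp.one_lt hX
    have hK1' : (1:ℝ) ≤ K := by exact_mod_cast hK1
    have h1 : (1/(p:ℝ))^(K+1) ≤ (1/(p:ℝ))^2 := pow_le_pow_of_le_one (by positivity) (by linarith) (by omega)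
    have h2 : 2*(1-1/(p:ℝ)) ≤ (K+1)*(1-1/(p:ℝ)) := by nlinarith
    calc _ ≤ (1/(p:ℝ))^2/(2*(1-1/(p:ℝ))) := div_le_div₀ (by positivity) h1 (by linarith) h2
      _ = _ := by
        have : (p:ℝ) - 1 ≠ 0 := by linarith
        have : (p:ℝ) ≠ 0 := by linarith
        have : 1 - 1/(p:ℝ) ≠ 0 := by linarith
        field_simp

theorem tails {X : ℕ} (hX : 1 ≤ X) : ∑ p ∈ Finset.range (X+1) with p.Prime,
    (if p ≤ Nat.sqrt X then 2/(3*(X:ℝ)) else 1/2 * (1/((p:ℝ)*(p-1)))) ≤ (Nat.sqrt X : ℝ) * (2/(3*(X:ℝ))) + 1/2 * (1/(Nat.sqrt X : ℝ)) := by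
  have hs : 0 < Nat.sqrt X := Nat.sqrt_pos.2 hX
  have hsX : Nat.sqrt X ≤ X := Nat.sqrt_le_self X
  have h0 : ∀ n : ℕ, 0 ≤ (if n ≤ Nat.sqrt X then 2/(3*(X:ℝ)) else 1/2 * (1/((n:ℝ)*(n-1)))) := by
    intro n
    split_ifs with h
    · positivity
    · have : (1:ℝ) ≤ n := by exact_mod_cast (by omega : 1 ≤ n)
      have : 0 ≤ (n:ℝ) - 1 := by linarith
      positivity
  have h1 : ∑ p ∈ Finset.range (X+1) with p.Prime,
      (if p ≤ Nat.sqrt X then 2/(3*(X:ℝ)) else 1/2 * (1/((p:ℝ)*(p-1)))) ≤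
      ∑ p ∈ Finset.Ioc 0 X, (if p ≤ Nat.sqrt X then 2/(3*(X:ℝ)) else 1/2 * (1/((p:ℝ)*(p-1)))) := by
    refine Finset.sum_le_sum_of_subset_of_nonneg ?_ fun n _ _ => h0 n
    intro p hp
    rw [Finset.mem_filter, Finset.mem_range] at hp
    rw [Finset.mem_Ioc]
    exact ⟨hp.2.pos, by omega⟩
  refine h1.trans ?_
  rw [← Finset.sum_Ioc_consecutive _ (Nat.zero_le _) hsX]
  have e1 : ∑ p ∈ Finset.Ioc 0 (Nat.sqrt X), (if p ≤ Nat.sqrt X then 2/(3*(X:ℝ)) else 1/2 * (1/((p:ℝ)*(p-1)))) = (Nat.sqrt X : ℝ) * (2/(3*(X:ℝ))) := by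
    rw [Finset.sum_congr rfl fun p hp => if_pos (Finset.mem_Ioc.1 hp).2]
    simp
  have e2 : ∑ p ∈ Finset.Ioc (Nat.sqrt X) X, (if p ≤ Nat.sqrt X then 2/(3*(X:ℝ)) else 1/2 * (1/((p:ℝ)*(p-1)))) = 1/2 * (1/(Nat.sqrt X : ℝ) - 1/X) := by
    rw [Finset.sum_congr rfl fun p hp => if_neg (not_le.2 (Finset.mem_Ioc.1 hp).1), ← Finset.mul_sum, telescope _ hs _ hsX]
  rw [e1, e2]
  have : 0 ≤ 1/(X:ℝ) := by positivity
  linarith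

theorem ratio_log (X : ℕ) : Real.log ((NN (X+1) : ℝ)/FF (X+1)) = ∑ p ∈ Finset.range (X+1) with p.Prime, -Real.log (1 - 1/(p:ℝ)) := by
  have e : (NN (X+1) : ℝ)/FF (X+1) = ∏ p ∈ Finset.range (X+1) with p.Prime, (1 - 1/(p:ℝ))⁻¹ := by
    rw [NN, FF, ← Finset.prod_filter, ← Finset.prod_filter]
    push_cast
    rw [← Finset.prod_div_distrib]
    refine Finset.prod_congr rfl fun p hp => ?_
    have hp' := (Finset.mem_filter.1 hp).2
    have hp2 : (2:ℝ) ≤ p := by exact_mod_cast hp'.two_le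
    rw [Nat.cast_sub hp'.one_le]
    have : (p:ℝ) - 1 ≠ 0 := by linarith
    push_cast
    rw [one_sub_div (by linarith), inv_div]
  rw [e, Real.log_prod]
  · refine Finset.sum_congr rfl fun p _ => Real.log_inv _
  · intro p hp
    have hp' := (Finset.mem_filter.1 hp).2
    have hp2 : (2:ℝ) ≤ p := by exact_mod_cast hp'.two_le
    have hpinv : 1/(p:ℝ) ≤ 1/2 := one_div_le_one_div_of_le (by norm_num) hp2
    exact inv_ne_zero (by linarith)

theorem ratio_le {X : ℕ} (hX : 1 ≤ X) : Real.log ((NN (X+1) : ℝ)/FF (X+1)) ≤ PP X +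
    ((Nat.sqrt X : ℝ) * (2/(3*(X:ℝ))) + 1/2 * (1/(Nat.sqrt X : ℝ))) := by
  rw [ratio_log]
  refine le_trans ?_ (add_le_add (PP_ge X) (tails hX))
  rw [← Finset.sum_add_distrib]
  refine Finset.sum_le_sum fun p hp => ?_
  rw [Finset.mem_filter, Finset.mem_range] at hp
  have hp2 : (2:ℝ) ≤ p := by exact_mod_cast hp.2.two_le
  have hpinv : 1/(p:ℝ) ≤ 1/2 := one_div_le_one_div_of_le (by norm_num) hp2
  have h1 := log_tail (z := 1/(p:ℝ)) (by positivity) (by linarith) (Nat.log p X)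
  have h2 := tail_p hp.2 (by omega) hX
  linarith

theorem theta_NN (X : ℕ) : Chebyshev.theta X = Real.log (NN (X+1)) := by
  rw [Chebyshev.theta_eq_log_primorial, Nat.floor_natCast, primorial, NN, Finset.prod_filter]

end PR


namespace PR
open Complex Filter Topology Metric MeasureTheory ArithmeticFunction

theorem exp_gamma_upper : Real.exp Real.eulerMascheroniConstant ≤ 1.7812 := by
  have h := gamma_bounds.2
  refine (Real.exp_le_exp.2 h.le).trans ?_
  have := Real.exp_bound' (x := 0.57725) (by norm_num) (by norm_num) (n := 8) (by norm_num)
  refine this.trans ?_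
  norm_num [Finset.sum_range_succ, Nat.factorial]

theorem sq_decay {a L : ℝ} (ha : 4 ≤ a) (h : a ≤ L) :
    L^2 * Real.exp (-L/2) ≤ a^2 * Real.exp (-a/2) := by
  have h1 : L ≤ a * Real.exp ((L-a)/4) := by
    have := Real.add_one_le_exp ((L-a)/4)
    nlinarith
  calc L^2 * Real.exp (-L/2) ≤ (a * Real.exp ((L-a)/4))^2 * Real.exp (-L/2) := by gcongr; linarith
    _ = a^2 * (Real.exp ((L-a)/4) * Real.exp ((L-a)/4) * Real.exp (-L/2)) := by ring
    _ = _ := by rw [← Real.exp_add, ← Real.exp_add]; ring_nf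

theorem lin_decay {a L : ℝ} (ha : 4 ≤ a) (h : a ≤ L) :
    L * Real.exp (-L/2) ≤ a * Real.exp (-a/2) := by
  have h1 := sq_decay ha h
  have h2 : a * (L * Real.exp (-L/2)) ≤ L^2 * Real.exp (-L/2) := by
    have : 0 ≤ L * Real.exp (-L/2) := by have := Real.exp_pos (-L/2); nlinarith
    nlinarith
  nlinarith

theorem decay {a L c : ℝ} (ha : 4 ≤ a) (h : a ≤ L) (hc : 0 < c) (he : c ≤ Real.exp (a/2)) :
    8.3 * (L * Real.exp (-L/2)) + 1.38 * (L^2 * Real.exp (-L/2)) ≤ (8.3 * a + 1.38 * a^2) / c := by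
  have h1 := sq_decay ha h
  have h2 := lin_decay ha h
  have h3 : Real.exp (-a/2) ≤ 1/c := by
    rw [show -a/2 = -(a/2) by ring, Real.exp_neg, ← one_div]
    exact one_div_le_one_div_of_le hc he
  have : (8.3 * a + 1.38 * a^2) / c = (8.3 * a + 1.38 * a^2) * (1/c) := by ring
  rw [this]
  nlinarith [mul_le_mul_of_nonneg_left h3 (show 0 ≤ 8.3 * a + 1.38 * a^2 by nlinarith)]

theorem exp_nat_ge (k : ℕ) : (2.71828:ℝ)^k ≤ Real.exp k := by
  rw [← Real.exp_one_pow]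
  exact pow_le_pow_left₀ (by norm_num) (by linarith [Real.exp_one_gt_d9]) k

theorem decay_all {L : ℝ} (hL : 12.2 ≤ L) {V : ℝ} (hV : Tendsto VV atTop (𝓝 V)) :
    |V - VV L| * L^2 + (8.3 * (L * Real.exp (-L/2)) + 1.38 * (L^2 * Real.exp (-L/2))) ≤ 1.395 := by
  have hL0 : 0 < L := by linarith
  have c1 : |V - VV L| * L^2 ≤ 0.04782 * (L + 1) := by
    have := VV_c hV (u := L) (by linarith)
    calc _ ≤ 0.04782 * ww L * L^2 := by gcongr
      _ = _ := by unfold ww; field_simp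
  rcases le_total L 13 with h | h
  · have := decay (a := 12.2) (c := 445) (by norm_num) hL (by norm_num) (by
      have h1 := exp_nat_ge 6
      have h2 := Real.quadratic_le_exp_of_nonneg (x := 0.1) (by norm_num)
      rw [show (12.2:ℝ)/2 = (6:ℕ) + 0.1 by norm_num, Real.exp_add]
      norm_num at h1 h2 ⊢
      nlinarith)
    norm_num at this ⊢
    linarith
  rcases le_total L 16 with h' | h'
  · have := decay (a := 13) (c := 655) (by norm_num) h (by norm_num) (by
      have h1 := exp_nat_ge 6
      have h2 := Real.quadratic_le_exp_of_nonneg (x := 0.5) (by norm_num)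
      rw [show (13:ℝ)/2 = (6:ℕ) + 0.5 by norm_num, Real.exp_add]
      norm_num at h1 h2 ⊢
      nlinarith)
    norm_num at this ⊢
    linarith
  rcases le_total L 22 with h'' | h''
  · have := decay (a := 16) (c := 2970) (by norm_num) h' (by norm_num) (by
      have h1 := exp_nat_ge 8
      rw [show (16:ℝ)/2 = (8:ℕ) by norm_num]
      norm_num at h1 ⊢
      linarith)
    norm_num at this ⊢
    linarith
  · have := decay (a := 22) (c := 59000) (by norm_num) h'' (by norm_num) (by
      have h1 := exp_nat_ge 11
      rw [show (22:ℝ)/2 = (11:ℕ) by norm_num]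
      norm_num at h1 ⊢
      linarith)
    have c2 : |V - VV L| * L^2 ≤ 0.7784 * (3/2 + (5/3) * (1/22)) := by
      have h1 := VV_z hV (u := L) (by linarith)
      have h2 : 1/L ≤ 1/22 := one_div_le_one_div_of_le (by norm_num) h''
      calc _ ≤ (Qz L + 0.7784/L * ww L) * L^2 := by gcongr
        _ = 0.7784 * (3/2 + (5/3) * (1/L)) := by unfold ww Qz; field_simp; ring
        _ ≤ _ := by gcongr
    norm_num at this c2 ⊢
    linarith

theorem psi_theta {x : ℝ} (hx : 208022 ≤ x) :
    Chebyshev.psi x - Chebyshev.theta x ≤ 6.83 * √x := by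
  have h := Chebyshev.psi_sub_theta_le_psi_add_psi_add_psi x
  have hx0 : 0 ≤ x := by linarith
  set t := x ^ ((6:ℝ)⁻¹) with ht
  have ht0 : 0 ≤ t := by positivity
  have t6 : t ^ 6 = x := by
    rw [ht, ← Real.rpow_natCast, ← Real.rpow_mul hx0]; norm_num
  have t2 : x ^ ((3:ℝ)⁻¹) = t^2 := by
    rw [ht, ← Real.rpow_natCast, ← Real.rpow_mul hx0]; norm_num
  have t3 : x ^ ((2:ℝ)⁻¹) = t^3 := by
    rw [ht, ← Real.rpow_natCast, ← Real.rpow_mul hx0]; norm_num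
  have t5 : x ^ ((5:ℝ)⁻¹) ≤ t^2 := by
    rw [← t2]
    exact Real.rpow_le_rpow_of_exponent_le (by linarith) (by norm_num)
  have hs : √x = t^3 := by rw [Real.sqrt_eq_rpow, ← t3]; norm_num
  have t75 : 7.5 ≤ t := by
    by_contra hc
    push Not at hc
    have : t^6 < 7.5^6 := pow_lt_pow_left₀ hc ht0 (by norm_num)
    norm_num at this
    linarith
  have a1 := Chebyshev.psi_le_const_mul_self (x := x ^ ((2:ℝ)⁻¹)) (by positivity)
  have a2 := Chebyshev.psi_le_const_mul_self (x := x ^ ((3:ℝ)⁻¹)) (by positivity)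
  have a3 := Chebyshev.psi_le_const_mul_self (x := x ^ ((5:ℝ)⁻¹)) (by positivity)
  have l4 : Real.log 4 ≤ 1.3863 := by
    rw [show (4:ℝ) = 2^2 by norm_num, Real.log_pow]
    push_cast
    linarith [Real.log_two_lt_d9]
  have l40 : 0 ≤ Real.log 4 := Real.log_nonneg (by norm_num)
  rw [t3] at a1 h
  rw [t2] at a2 h
  have b3 : t^2 ≤ t^3 / 7.5 := by
    rw [le_div_iff₀ (by norm_num)]
    nlinarith [sq_nonneg t]
  have k : (Real.log 4 + 4) * t^3 + (Real.log 4 + 4) * t^2 + (Real.log 4 + 4) * x ^ ((5:ℝ)⁻¹)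
      ≤ 5.3863 * (t^3 + t^3/7.5 + t^3/7.5) := by
    rw [← mul_add, ← mul_add]
    have : 0 ≤ x ^ ((5:ℝ)⁻¹) := by positivity
    gcongr
    · linarith
    · exact t5.trans b3
  rw [hs]
  have : 0 ≤ t^3 := by positivity
  norm_num at k ⊢
  linarith

theorem theta_lower {x : ℕ} (hx : 208022 ≤ x) : 0.678 * (x:ℝ) ≤ Chebyshev.theta x := by
  have hx' : (208022:ℝ) ≤ x := by exact_mod_cast hx
  have h1 := psi_theta hx'
  have h2 := Chebyshev.psi_ge x
  have h3 : Real.log (x+1) ≤ 0.00001 * (x+1) + 11 := by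
    have a := Real.log_le_sub_one_of_pos (x := (x+1) * Real.exp (-12)) (by positivity)
    rw [Real.log_mul (by positivity) (by positivity), Real.log_exp] at a
    have b : Real.exp (-12) ≤ 0.00001 := by
      rw [Real.exp_neg, ← one_div]
      have := exp_nat_ge 12
      have c := one_div_le_one_div_of_le (a := 100000) (b := Real.exp 12) (by norm_num) (by
        norm_num at this ⊢; linarith)
      norm_num at c ⊢
      linarith
    nlinarith
  have hr : √(x:ℝ) * 456 ≤ x := by
    have e := Real.mul_self_sqrt (show (0:ℝ) ≤ x by positivity)
    have : 456 ≤ √(x:ℝ) := by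
      apply Real.le_sqrt_of_sq_le
      norm_num; linarith
    nlinarith
  have h5 : (x:ℝ) * 0.6931471803 ≤ x * Real.log 2 := by
    have := Real.log_two_gt_d9
    gcongr
  norm_num at h1 h3 h5 ⊢
  linarith

theorem tail_le {x : ℕ} (hx : 208022 ≤ x) :
    (Nat.sqrt x:ℝ)*(2/(3*x)) + 1/2*(1/(Nat.sqrt x:ℝ)) ≤ 1.17 / √(x:ℝ) := by
  have hx' : (208022:ℝ) ≤ x := by exact_mod_cast hx
  set r := √(x:ℝ) with hr
  have e : (x:ℝ) = r * r := (Real.mul_self_sqrt (by positivity)).symm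
  have h456 : 456 ≤ r := by
    apply Real.le_sqrt_of_sq_le
    norm_num; linarith
  have s1 : (Nat.sqrt x:ℝ) ≤ r := Real.nat_sqrt_le_real_sqrt
  have s2 : r - 1 ≤ (Nat.sqrt x:ℝ) := by
    have := Real.real_sqrt_le_nat_sqrt_succ (a := x)
    push_cast at this
    linarith
  rw [e]
  have a : (Nat.sqrt x:ℝ)*(2/(3*(r*r))) ≤ r * (2/(3*(r*r))) := by gcongr
  have b : 1/(Nat.sqrt x:ℝ) ≤ 1.0024 / r := by
    rw [div_le_div_iff₀ (by linarith) (by linarith)]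
    norm_num
    linarith
  have c : r * (2/(3*(r*r))) = (2/3)/r := by field_simp
  have d : (1.17:ℝ)/r = (2/3)/r + 1/2 * (1.0024/r) + (1.17 - 2/3 - 0.5012)/r := by
    field_simp; norm_num
  have f : 0 ≤ (1.17 - 2/3 - 0.5012)/r := div_nonneg (by norm_num) (by linarith)
  rw [d]
  linarith

theorem final_ineq {L R : ℝ} (hL : 12.2 ≤ L) (hpos : 0 < R)
    (fin : Real.log R ≤ Real.eulerMascheroniConstant + Real.log L + 1.395 / L^2) :
    R ≤ Real.exp Real.eulerMascheroniConstant * L + 2.51 / L := by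
  have hL0 : 0 < L := by linarith
  have hz : ∃ z, z = 1.395 / L^2 := ⟨_, rfl⟩
  obtain ⟨z, hz⟩ := hz
  rw [← hz] at fin
  rw [Real.log_le_iff_le_exp hpos, Real.exp_add, Real.exp_add, Real.exp_log hL0] at fin
  refine fin.trans ?_
  have z0 : 0 ≤ z := by rw [hz]; positivity
  have z1 : z ≤ 0.0094 := by
    rw [hz, div_le_iff₀ (by positivity)]
    norm_num at hL ⊢
    nlinarith
  have ez : Real.exp z ≤ 1 + z + z^2 := by
    have := Real.abs_exp_sub_one_sub_id_le (x := z) (by rw [abs_of_nonneg z0]; norm_num at z1; linarith)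
    have := (abs_le.1 this).2
    linarith
  have eg := exp_gamma_upper
  have ep := Real.exp_pos Real.eulerMascheroniConstant
  have q1 : Real.exp Real.eulerMascheroniConstant * L * Real.exp z ≤ Real.exp Real.eulerMascheroniConstant * L * (1 + z + z^2) := by gcongr
  refine q1.trans ?_
  have q2 : Real.exp Real.eulerMascheroniConstant * L * (1 + z + z^2) = Real.exp Real.eulerMascheroniConstant * L + Real.exp Real.eulerMascheroniConstant * (1 + z) * 1.395 / L := by
    have : z = 1.395/L^2 := hz
    have h : L * z = 1.395 / L := by rw [this]; field_simp
    have : Real.exp Real.eulerMascheroniConstant * (1 + z) * 1.395 / L = Real.exp Real.eulerMascheroniConstant * (1 + z) * (1.395 / L) := by ring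
    rw [this, ← h]; ring
  rw [q2]
  gcongr
  calc Real.exp Real.eulerMascheroniConstant * (1 + z) * 1.395 ≤ 1.7812 * (1 + 0.0094) * 1.395 := by gcongr
    _ ≤ 2.51 := by norm_num

theorem large_ok {x : ℕ} (hx : 208022 ≤ x) : Good (x+1) := by
  have hx' : (208022:ℝ) ≤ x := by exact_mod_cast hx
  obtain ⟨V, hV⟩ := VV_tendsto
  have hVg := V_eq_gamma hV
  set r := √(x:ℝ) with hr
  have e : (x:ℝ) = r * r := (Real.mul_self_sqrt (by positivity)).symm
  have h456 : 456 ≤ r := by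
    apply Real.le_sqrt_of_sq_le
    norm_num; linarith
  unfold Good
  rw [← theta_NN x]
  set y := Chebyshev.theta x with hy
  have hy1 : 207000 ≤ y := by
    rw [hy, theta_NN]
    refine theta_big.trans (Real.log_le_log (by exact_mod_cast NN_pos _) ?_)
    exact_mod_cast NN_mono (by omega)
  have hy0 : 0 < y := by linarith
  set L := Real.log y with hLd
  have hL : 12.2 ≤ L := by
    rw [hLd, Real.le_log_iff_exp_le hy0]
    have h1 : Real.exp 12 ≤ 2.7182818286^12 := by
      have : Real.exp 12 = Real.exp 1 ^ 12 := by rw [Real.exp_one_pow]; norm_num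
      rw [this]
      exact pow_le_pow_left₀ (by positivity) Real.exp_one_lt_d9.le 12
    have h2 := Real.add_one_le_exp (-0.2:ℝ)
    have h3 : Real.exp 12 = Real.exp 12.2 * Real.exp (-0.2) := by
      rw [← Real.exp_add]; norm_num
    have := Real.exp_pos 12.2
    norm_num at h1 h2 h3 ⊢
    nlinarith
  have hL0 : 0 < L := by linarith
  have expL : Real.exp L = y := Real.exp_log hy0
  set w := Real.exp (-L/2) with hw
  have w0 : 0 < w := Real.exp_pos _
  have ww1 : w * w * y = 1 := by
    rw [hw, ← expL, ← Real.exp_add, ← Real.exp_add]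
    ring_nf; simp
  -- r w bounds
  have rw1 : r * w ≤ 1.2145 := by
    have := theta_lower hx
    rw [← hy, e] at this
    by_contra hc
    push Not at hc
    have q : 1.2145 * 1.2145 < (r*w)*(r*w) := by nlinarith
    have : 0.678 * (r * r) * (w*w) ≤ y * (w*w) := by gcongr
    norm_num at *
    nlinarith
  have l4 : Real.log 4 ≤ 1.3863 := by
    rw [show (4:ℝ) = 2^2 by norm_num, Real.log_pow]
    push_cast
    linarith [Real.log_two_lt_d9]
  have rw2 : 1 ≤ 1.1775 * (r * w) := by
    have := Chebyshev.theta_le_log4_mul_x (x := x) (by positivity)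
    rw [e] at this
    have h' : y ≤ 1.3863 * (r*r) := by
      rw [hy, e]; refine this.trans ?_; gcongr
    have h2 : y * (w*w) ≤ 1.3863 * (r*r) * (w*w) := by gcongr
    by_contra hc
    push Not at hc
    have hp : 0 ≤ r * w := by positivity
    norm_num at *
    nlinarith
  have p1 := PP_le (x := x) (y := y) (by linarith)
  have p2 := psi_theta hx'
  have p3 := tail_le hx
  have p4 := ratio_le (X := x) (by omega)
  have p5 := decay_all hL hV
  rw [← hw] at p5
  have p6 : VV L = PP y - 1/(y*L) * (Chebyshev.psi y - y) - Real.log L := by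
    unfold VV
    rw [Real.exp_neg, expL]
    congr 2
    field_simp
  have p7 : 1/(y*L) * (Chebyshev.psi x - y) ≤ 8.3 * (L * w) / L^2 := by
    have : 1/(y*L) * (Chebyshev.psi x - y) ≤ 1/(y*L) * (6.83 * r) := by gcongr
    refine this.trans ?_
    have k : 1/(y*L) * (6.83*r) = 6.83 * (r*w) * w / L := by
      have : y = 1/(w*w) := by field_simp; linarith
      rw [this]; field_simp
    have k2 : 8.3 * (L*w)/L^2 = 8.3 * w / L := by field_simp
    rw [k, k2]
    gcongr
    norm_num at rw1 ⊢
    linarith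
  have p8 : 1.17 / r ≤ 1.38 * (L^2*w)/L^2 := by
    have k2 : 1.38 * (L^2*w)/L^2 = 1.38 * w := by field_simp
    rw [k2, div_le_iff₀ (by linarith)]
    norm_num at rw2 ⊢
    nlinarith
  have p9 : V - VV L ≤ |V - VV L| ∧ VV L - V ≤ |V - VV L| := ⟨le_abs_self _, by rw [abs_sub_comm]; exact le_abs_self _⟩
  have p10 : |V - VV L| + 8.3 * (L * w) / L^2 + 1.38 * (L^2*w)/L^2 ≤ 1.395 / L^2 := by
    rw [le_div_iff₀ (by positivity)]
    refine le_trans (le_of_eq ?_) p5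
    field_simp
    ring
  have fin : Real.log ((NN (x+1):ℝ)/FF (x+1)) ≤ Real.eulerMascheroniConstant + Real.log L + 1.395 / L^2 := by
    rw [← hVg]
    have : 1/(y*L) * (Chebyshev.psi x - y) = 1/(y*L) * (Chebyshev.psi x - Chebyshev.psi y) + 1/(y*L) * (Chebyshev.psi y - y) := by ring
    linarith [p9.2]
  have hpos : 0 < (NN (x+1):ℝ)/FF (x+1) := div_pos (by exact_mod_cast NN_pos _) (by exact_mod_cast FF_pos _)
  exact final_ineq hL hpos fin

end PR


namespace PR

theorem prod_count {R : Type*} [CommMonoid R] (f : ℕ → R) (a : ℕ) :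
    ∏ q ∈ Finset.range a, (if q.Prime then f q else 1) =
      ∏ k ∈ Finset.range (Nat.count Nat.Prime a), f (Nat.nth Nat.Prime k) := by
  induction a with
  | zero => simp
  | succ a ih =>
    rw [Finset.prod_range_succ, ih, Nat.count_succ]
    by_cases h : a.Prime
    · rw [if_pos h, if_pos h, Finset.prod_range_succ, Nat.nth_count h]
    · rw [if_neg h, if_neg h]; simp

theorem prod_nth {R : Type*} [CommMonoid R] (f : ℕ → R) (n : ℕ) (hn : 1 ≤ n) :
    ∏ k ∈ Finset.range n, f (Nat.nth Nat.Prime k) =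
      ∏ q ∈ Finset.range (Nat.nth Nat.Prime (n-1) + 1), (if q.Prime then f q else 1) := by
  rw [prod_count, Nat.count_nth_succ_of_infinite Nat.infinite_setOf_prime, Nat.sub_add_cancel hn]

theorem good_all (x : ℕ) (hx : 5 ≤ x) : Good (x+1) := by
  rcases le_total 208022 x with h | h
  · exact large_ok h
  · exact small_ok.1 (x+1) (by omega) (by omega)

theorem nth0 : Nat.nth Nat.Prime 0 = 2 := Nat.nth_prime_zero_eq_two
theorem nth1 : Nat.nth Nat.Prime 1 = 3 := Nat.nth_prime_one_eq_three

theorem five_le_nth (n : ℕ) (hn : 3 ≤ n) : 5 ≤ Nat.nth Nat.Prime (n-1) := by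
  have h : Nat.nth Nat.Prime 1 < Nat.nth Nat.Prime (n-1) :=
    Nat.nth_strictMono Nat.infinite_setOf_prime (by omega)
  rw [nth1] at h
  have hp := Nat.prime_nth_prime (n-1)
  have : Nat.nth Nat.Prime (n-1) ≠ 4 := by
    intro h4; rw [h4] at hp; revert hp; norm_num
  omega

theorem prod_inv_eq (n : ℕ) (hn : 1 ≤ n) :
    ∏ k ∈ Finset.range n, ((Nat.nth Nat.Prime k : ℝ) / ((Nat.nth Nat.Prime k : ℝ) - 1)) =
      (NN (Nat.nth Nat.Prime (n-1) + 1) : ℝ) / FF (Nat.nth Nat.Prime (n-1) + 1) := by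
  rw [prod_nth (fun q : ℕ => (q:ℝ)/((q:ℝ)-1)) n hn]
  unfold NN FF
  push_cast
  rw [← Finset.prod_div_distrib]
  refine Finset.prod_congr rfl fun q _ => ?_
  by_cases h : q.Prime
  · simp only [h, if_true]
    rw [Nat.cast_sub h.one_lt.le]; simp
  · simp [h]

theorem Nk_eq (n : ℕ) (hn : 1 ≤ n) : Nk n = NN (Nat.nth Nat.Prime (n-1) + 1) := by
  unfold Nk NN
  exact prod_nth (fun q => q) n hn

theorem log_log_pos (n : ℕ) (hn : 2 ≤ n) : 0 < Real.log (Real.log (Nk n)) := by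
  have h6 : 6 ≤ Nk n := by
    have : Nk 2 ≤ Nk n := by
      unfold Nk
      exact Finset.prod_le_prod_of_subset_of_one_le' (by simpa using hn)
        fun i _ _ => (Nat.prime_nth_prime i).one_lt.le
    refine le_trans ?_ this
    simp [Nk, Finset.prod_range_succ, nth0, nth1]
  have h6' : (6:ℝ) ≤ Nk n := by exact_mod_cast h6
  apply Real.log_pos
  rw [Real.lt_log_iff_exp_lt (by linarith)]
  linarith [Real.exp_one_lt_d9]

theorem main_n (n : ℕ) (hn : 2 ≤ n) :
    ∏ k ∈ Finset.range n, ((Nat.nth Nat.Prime k : ℝ) / ((Nat.nth Nat.Prime k : ℝ) - 1)) ≤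
      Real.exp Real.eulerMascheroniConstant * Real.log (Real.log (Nk n)) +
          2.51 / Real.log (Real.log (Nk n)) := by
  rcases (show n = 2 ∨ 3 ≤ n by omega) with rfl | h
  · have hp := log_log_pos 2 le_rfl
    set L := Real.log (Real.log (Nk 2))
    have e := exp_gamma_lower
    rw [Finset.prod_range_succ, Finset.prod_range_one, nth0, nth1]
    have h1 : 1.78105 * L ≤ Real.exp Real.eulerMascheroniConstant * L := by gcongr
    have h2 : 3 - 1.78105 * L ≤ 2.51 / L := by
      rw [le_div_iff₀ hp]
      norm_num
      nlinarith [sq_nonneg (L - 0.84)]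
    norm_num at h1 h2 ⊢
    linarith
  · rw [prod_inv_eq n (by omega), Nk_eq n (by omega)]
    exact good_all _ (five_le_nth n h)

end PR

theorem primorial_product_alpha_bound (i n : ℕ) (hi : 2 ≤ i) (hn : i ≤ n) :
    ∏ k ∈ Finset.range n, (1 + 1 / (Nat.nth Nat.Prime k : ℝ)) ≤
      (∏ j ∈ Finset.range i, (1 - 1 / (Nat.nth Nat.Prime j : ℝ) ^ 2)) *
        (Real.exp Real.eulerMascheroniConstant * Real.log (Real.log (Nk n)) +
          2.51 / Real.log (Real.log (Nk n))) := by
  have hp : ∀ k, (2:ℝ) ≤ Nat.nth Nat.Prime k := fun k => by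
    exact_mod_cast (Nat.prime_nth_prime k).two_le
  have hf : ∀ k, 0 ≤ 1 - 1 / (Nat.nth Nat.Prime k : ℝ) ^ 2 ∧ 1 - 1 / (Nat.nth Nat.Prime k : ℝ) ^ 2 ≤ 1 := by
    intro k
    have h := hp k
    have h1 : 1 / (Nat.nth Nat.Prime k : ℝ) ^ 2 ≤ 1 := by
      rw [div_le_one (by positivity)]; nlinarith
    have h2 : 0 ≤ 1 / (Nat.nth Nat.Prime k : ℝ) ^ 2 := by positivity
    constructor <;> linarith
  have e : ∏ k ∈ Finset.range n, (1 + 1 / (Nat.nth Nat.Prime k : ℝ)) =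
      (∏ j ∈ Finset.range n, (1 - 1 / (Nat.nth Nat.Prime j : ℝ) ^ 2)) *
      ∏ k ∈ Finset.range n, ((Nat.nth Nat.Prime k : ℝ) / ((Nat.nth Nat.Prime k : ℝ) - 1)) := by
    rw [← Finset.prod_mul_distrib]
    refine Finset.prod_congr rfl fun k _ => ?_
    have h := hp k
    have : (Nat.nth Nat.Prime k : ℝ) - 1 ≠ 0 := by linarith
    have : (Nat.nth Nat.Prime k : ℝ) ≠ 0 := by linarith
    field_simp
    ring
  have hL := PR.log_log_pos n (by omega)
  have hpos : 0 ≤ Real.exp Real.eulerMascheroniConstant * Real.log (Real.log (Nk n)) +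
          2.51 / Real.log (Real.log (Nk n)) := by positivity
  rw [e]
  refine le_trans (mul_le_mul_of_nonneg_left (PR.main_n n (by omega)) (Finset.prod_nonneg fun k _ => (hf k).1)) ?_
  refine mul_le_mul_of_nonneg_right ?_ hpos
  exact Finset.prod_le_prod_of_subset_of_le_one (Finset.range_mono hn) (fun k _ => (hf k).1) (fun k _ _ => (hf k).2)
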